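/- Every compact semialgebraic set can be triangulated by semialgebraic simplices: if S ⊆ ℝⁿ is a compact semialgebraic set, then there exist a finite simplicial complex K in some ℝ^N and a homeomorphism h from the underlying space |K| of K onto S such that h is a semialgebraic map and the image under h of each open simplex of K is a semialgebraic subset of ℝⁿ. -/

import Mathlib

/-- A basic semialgebraic subset of `ℝⁿ`. -/
def IsBasicSemialgebraic (n : ℕ) (S : Set (Fin n → ℝ)) : Prop :=
  ∃ (r s : ℕ) (f : Fin r → MvPolynomial (Fin n) ℝ) (g : Fin s → MvPolynomial (Fin n) ℝ),
    S = {x | (∀ i, MvPolynomial.eval x (f i) = 0) ∧ ∀ j, 0 < MvPolynomial.eval x (g j)}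

/-- A semialgebraic subset of `ℝⁿ`: a finite union of basic semialgebraic sets. -/
def IsSemialgebraic (n : ℕ) (S : Set (Fin n → ℝ)) : Prop :=
  ∃ (k : ℕ) (B : Fin k → Set (Fin n → ℝ)),
    (∀ i, IsBasicSemialgebraic n (B i)) ∧ S = ⋃ i, B i

/-- A map `f : S → S'` between semialgebraic sets `S ⊆ ℝⁿ`, `S' ⊆ ℝᵐ` is semialgebraic
if it is continuous and its graph is a semialgebraic subset of `ℝ^{n+m}`. -/
def IsSemialgebraicMap {n m : ℕ} (S : Set (Fin n → ℝ)) (S' : Set (Fin m → ℝ))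
    (f : S → S') : Prop :=
  Continuous f ∧
    IsSemialgebraic (n + m) {z : Fin (n + m) → ℝ | ∃ x : S, z = Fin.append x.val (f x).val}

/-- The open simplex spanned by a finite vertex set `s`: the (closed) simplex, i.e. the
convex hull of `s`, minus all its proper faces (the convex hulls of proper subsets of `s`). -/
def openSimplex {N : ℕ} (s : Finset (Fin N → ℝ)) : Set (Fin N → ℝ) :=
  convexHull ℝ (s : Set (Fin N → ℝ)) \ ⋃ (t : Finset (Fin N → ℝ)) (_ : t ⊂ s),
    convexHull ℝ (t : Set (Fin N → ℝ))

section

open Polynomial Set Filter Topology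

theorem exists_orderIso_bump {a b u v : ℝ} (hau : a < u) (hub : u < b) (hav : a < v)
    (hvb : v < b) : ∃ σ : ℝ ≃o ℝ, σ u = v ∧ ∀ y, y ≤ a ∨ b ≤ y → σ y = y := by
  obtain ⟨s, hs, hs'⟩ : ∃ s : ℝ, 0 < s ∧ s * (u - a) = v - a :=
    ⟨(v - a) / (u - a), div_pos (by linarith) (by linarith),
      div_mul_cancel₀ _ (by linarith)⟩
  obtain ⟨t, ht, ht'⟩ : ∃ t : ℝ, 0 < t ∧ t * (b - u) = b - v :=
    ⟨(b - v) / (b - u), div_pos (by linarith) (by linarith),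
      div_mul_cancel₀ _ (by linarith)⟩
  let F : ℝ → ℝ := fun y => if y ≤ a then y else if y ≤ u then a + s * (y - a) else
    if y ≤ b then b - t * (b - y) else y
  have hmono : StrictMono F := by
    intro x y hxy
    simp only [F]
    split_ifs <;> nlinarith
  have hsurj : Function.Surjective F := by
    intro w
    rcases le_or_gt w a with h | h
    · exact ⟨w, by simp [F, h]⟩
    rcases le_or_gt w v with h2 | h2
    · refine ⟨a + (w - a) / s, ?_⟩
      have h3 : 0 < (w - a) / s := div_pos (by linarith) hs
      have h4 : s * ((w - a) / s) = w - a := by field_simp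
      have h5 : a + (w - a) / s ≤ u := by
        by_contra hc
        nlinarith
      simp only [F]
      rw [if_neg (by linarith), if_pos h5]
      linarith
    rcases le_or_gt w b with h3 | h3
    · refine ⟨b - (b - w) / t, ?_⟩
      have h5 : 0 ≤ (b - w) / t := div_nonneg (by linarith) ht.le
      have h4 : t * ((b - w) / t) = b - w := by field_simp
      have h6 : u < b - (b - w) / t := by
        by_contra hc
        nlinarith
      simp only [F]
      rw [if_neg (by linarith), if_neg (by linarith), if_pos (by linarith)]
      linarith
    · refine ⟨w, ?_⟩
      simp only [F]
      rw [if_neg (by linarith), if_neg (by linarith), if_neg (by linarith)]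
  refine ⟨hmono.orderIsoOfSurjective F hsurj, ?_, ?_⟩
  · simp only [StrictMono.coe_orderIsoOfSurjective, F]
    rw [if_neg (by linarith), if_pos le_rfl]
    linarith
  · rintro y (h | h)
    · simp only [StrictMono.coe_orderIsoOfSurjective, F]
      rw [if_pos h]
    · simp only [StrictMono.coe_orderIsoOfSurjective, F]
      rw [if_neg (by linarith), if_neg (by linarith)]
      split_ifs with h2
      · have : y = b := le_antisymm h2 h
        subst this
        ring
      · rfl

/-- The points lying on the same side as `u` of every point of `Z`. -/
def sideSet (Z : Set ℝ) (u : ℝ) : Set ℝ := {y | ∀ z ∈ Z, (z < u ↔ z < y) ∧ (u < z ↔ y < z)}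

theorem mem_sideSet_self (Z : Set ℝ) (u : ℝ) : u ∈ sideSet Z u := fun _ _ => ⟨Iff.rfl, Iff.rfl⟩

theorem sideSet_eq {Z : Set ℝ} {u y : ℝ} (h : y ∈ sideSet Z u) : sideSet Z y = sideSet Z u := by
  ext w
  exact ⟨fun h' z hz => ⟨(h z hz).1.trans (h' z hz).1, (h z hz).2.trans (h' z hz).2⟩,
    fun h' z hz => ⟨(h z hz).1.symm.trans (h' z hz).1, (h z hz).2.symm.trans (h' z hz).2⟩⟩

theorem notMem_of_mem_sideSet {Z : Set ℝ} {u y : ℝ} (hu : u ∉ Z) (h : y ∈ sideSet Z u) :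
    y ∉ Z := by
  intro hy
  have h1 := h y hy
  have : u = y := le_antisymm (not_lt.1 fun hc => lt_irrefl _ (h1.1.1 hc))
    (not_lt.1 fun hc => lt_irrefl _ (h1.2.1 hc))
  exact hu (this ▸ hy)

theorem ordConnected_sideSet (Z : Set ℝ) (u : ℝ) : (sideSet Z u).OrdConnected := by
  refine ⟨fun x hx y hy w hw z hz => ?_⟩
  have h1 := hx z hz
  have h2 := hy z hz
  obtain ⟨h3, h4⟩ := hw
  refine ⟨⟨fun h => (h1.1.1 h).trans_le h3, fun h => h2.1.2 (h.trans_le h4)⟩,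
    ⟨fun h => h4.trans_lt (h2.2.1 h), fun h => h1.2.2 (h3.trans_lt h)⟩⟩

theorem isOpen_sideSet {Z : Set ℝ} (hZ : Z.Finite) {u : ℝ} (hu : u ∉ Z) :
    IsOpen (sideSet Z u) := by
  have : sideSet Z u = ⋂ z ∈ Z, {y | (z < u ↔ z < y) ∧ (u < z ↔ y < z)} := by
    ext y
    simp [sideSet]
  rw [this]
  refine hZ.isOpen_biInter fun z hz => ?_
  have hne : z ≠ u := fun h => hu (h ▸ hz)
  rcases lt_or_gt_of_ne hne with h | h
  · convert isOpen_Ioi (a := z) using 1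
    ext y
    simp [h, not_lt.2 h.le]
    intro h
    linarith
  · convert isOpen_Iio (a := z) using 1
    ext y
    simp [h, not_lt.2 h.le]
    intro h
    linarith

/-- The order isomorphisms attached to the sides of `Z` can be glued. -/
theorem exists_orderIso_glue {Z : Set ℝ} (P : ℝ → ℝ → Prop)
    (h : ∀ u ∉ Z, ∃ σ : ℝ ≃o ℝ, ∀ y ∈ sideSet Z u, (σ y ∈ sideSet Z u) ∧
      σ.symm y ∈ sideSet Z u ∧ P y (σ y)) :
    ∃ σ : ℝ ≃o ℝ, (∀ z ∈ Z, σ z = z) ∧ (∀ y, σ y ∈ sideSet Z y) ∧ ∀ y ∉ Z, P y (σ y) := by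
  classical
  have h' : ∀ J : Set ℝ, ∃ σ : ℝ ≃o ℝ, (∃ u ∉ Z, J = sideSet Z u) →
      ∀ y ∈ J, (σ y ∈ J) ∧ σ.symm y ∈ J ∧ P y (σ y) := by
    intro J
    by_cases hJ : ∃ u ∉ Z, J = sideSet Z u
    · obtain ⟨u, hu, rfl⟩ := hJ
      obtain ⟨σ, hσ⟩ := h u hu
      exact ⟨σ, fun _ => hσ⟩
    · exact ⟨OrderIso.refl _, fun h => absurd h hJ⟩
  choose s hs using h'
  have hs1 : ∀ y ∉ Z, (s (sideSet Z y) y ∈ sideSet Z y) ∧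
      (s (sideSet Z y)).symm y ∈ sideSet Z y ∧ P y (s (sideSet Z y) y) :=
    fun y hy => hs _ ⟨y, hy, rfl⟩ y (mem_sideSet_self _ _)
  let F : ℝ → ℝ := fun y => if y ∈ Z then y else s (sideSet Z y) y
  have hF : ∀ y, F y ∈ sideSet Z y := by
    intro y
    by_cases hy : y ∈ Z
    · simp [F, hy, mem_sideSet_self]
    · simpa [F, hy] using (hs1 y hy).1
  have hmono : StrictMono F := by
    intro x y hxy
    by_cases hc : y ∈ sideSet Z x
    · by_cases hx : x ∈ Z
      · exact absurd hxy (by simpa using (hc x hx).1)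
      · have hy := notMem_of_mem_sideSet hx hc
        simp only [F, hx, hy, if_false, sideSet_eq hc]
        exact (s _).strictMono hxy
    · simp only [sideSet, mem_ofPred_eq, not_forall] at hc
      obtain ⟨z, hz, hz'⟩ := hc
      have h1 : x ≤ z ∧ z ≤ y := by
        by_contra hcon
        apply hz'
        by_cases h1 : x ≤ z
        · have h2 : y < z := not_le.1 fun h => hcon ⟨h1, h⟩
          exact ⟨⟨fun h => h.trans hxy, fun h => absurd h h2.le.not_gt⟩,
            ⟨fun _ => h2, fun _ => hxy.trans h2⟩⟩
        · push Not at h1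
          exact ⟨⟨fun h => h1.trans hxy, fun h => h1⟩,
            ⟨fun h => absurd h h1.le.not_gt, fun h => hxy.trans h⟩⟩
      have hx := hF x z hz
      have hy := hF y z hz
      rcases lt_or_eq_of_le h1.1 with h2 | h2
      · exact (hx.2.1 h2).trans_le (not_lt.1 fun h => (hy.2.2 h).not_ge h1.2)
      · have h3 : z < y := h2 ▸ hxy
        exact lt_of_le_of_lt (not_lt.1 fun h => (hx.1.2 h).not_ge h1.1) (hy.1.1 h3)
  have hsurj : Function.Surjective F := by
    intro y
    by_cases hy : y ∈ Z
    · exact ⟨y, by simp [F, hy]⟩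
    · have h1 := (hs1 y hy).2.1
      refine ⟨(s (sideSet Z y)).symm y, ?_⟩
      simp only [F, notMem_of_mem_sideSet hy h1, if_false, sideSet_eq h1]
      simp
  refine ⟨hmono.orderIsoOfSurjective F hsurj, fun z hz => by simp [F, hz],
    fun y => by simpa using hF y, fun y hy => ?_⟩
  simpa [F, hy] using (hs1 y hy).2.2

theorem sign_eq_of_mem_sideSet {p : ℝ → ℝ} (hp : Continuous p) {Z : Set ℝ}
    (hZ : ∀ y, p y = 0 → y ∈ Z) {u y : ℝ} (h : y ∈ sideSet Z u) :
    SignType.sign (p y) = SignType.sign (p u) := by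
  by_cases hu : u ∈ Z
  · have h1 := h u hu
    have : y = u := le_antisymm (not_lt.1 fun hc => lt_irrefl _ (h1.1.2 hc))
      (not_lt.1 fun hc => lt_irrefl _ (h1.2.2 hc))
    rw [this]
  have hJ := (ordConnected_sideSet Z u).isPreconnected
  have hne : ∀ w ∈ sideSet Z u, p w ≠ 0 :=
    fun w hw h0 => notMem_of_mem_sideSet hu hw (hZ w h0)
  have hself := mem_sideSet_self Z u
  by_contra hs
  rcases lt_or_gt_of_ne (hne y h) with hy | hy <;> rcases lt_or_gt_of_ne (hne u hself) with hu' | hu'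
  · exact hs (by rw [sign_neg hy, sign_neg hu'])
  · obtain ⟨w, hw, hw0⟩ := hJ.intermediate_value h hself hp.continuousOn ⟨hy.le, hu'.le⟩
    exact hne w hw hw0
  · obtain ⟨w, hw, hw0⟩ := hJ.intermediate_value hself h hp.continuousOn ⟨hu'.le, hy.le⟩
    exact hne w hw hw0
  · exact hs (by rw [sign_pos hy, sign_pos hu'])

theorem exists_pos_iff_right {f : ℝ[X]} {Z : Set ℝ} {u : ℝ} (hu : u ∉ Z) (hZ : Z.Finite)
    (hd : ∀ y ∈ sideSet Z u, 0 < f.derivative.eval y) :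
    (∃ y ∈ sideSet Z u, 0 < f.eval y) ↔
      ∀ z ∈ Z, u < z → (∀ z' ∈ Z, u < z' → z ≤ z') → 0 < f.eval z := by
  constructor
  · rintro ⟨y, hy, hy0⟩ z hz huz hmin
    have hyz : y < z := (hy z hz).2.1 huz
    have hmono : StrictMonoOn (fun x => f.eval x) (Icc y z) := by
      refine strictMonoOn_of_deriv_pos (convex_Icc _ _) f.continuous.continuousOn fun x hx => ?_
      rw [interior_Icc] at hx
      rw [f.deriv]
      refine hd x fun z' hz' => ⟨⟨fun h => ((hy z' hz').1.1 h).trans hx.1, fun h => ?_⟩,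
        fun h => hx.2.trans_le (hmin z' hz' h), fun h => (hy z' hz').2.2 (hx.1.trans h)⟩
      by_contra hc
      have h2 : u < z' := lt_of_le_of_ne (not_lt.1 hc) (fun h => hu (h ▸ hz'))
      exact absurd (hmin z' hz' h2) (not_le.2 (h.trans hx.2))
    exact hy0.trans (hmono ⟨le_rfl, hyz.le⟩ ⟨hyz.le, le_rfl⟩ hyz)
  · intro h
    by_cases hex : (Z ∩ Ioi u).Nonempty
    · obtain ⟨z, ⟨hz, huz⟩, hmin⟩ := Set.exists_min_image (Z ∩ Ioi u) id
        (hZ.subset inter_subset_left) hex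
      have h0 := h z hz huz fun z' hz' h' => hmin z' ⟨hz', h'⟩
      have hev : ∀ᶠ y in 𝓝[<] z, 0 < f.eval y :=
        (f.continuous.continuousAt.eventually (lt_mem_nhds h0)).filter_mono nhdsWithin_le_nhds
      have hev2 : ∀ᶠ y in 𝓝[<] z, y ∈ Ioo u z := Ioo_mem_nhdsLT huz
      obtain ⟨y, hy1, hy2⟩ := (hev.and hev2).exists
      refine ⟨y, fun z' hz' => ⟨⟨fun h => h.trans hy2.1, fun h => ?_⟩,
        fun h => hy2.2.trans_le (hmin z' ⟨hz', h⟩), fun h => hy2.1.trans h⟩, hy1⟩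
      by_contra hc
      have h2 : u < z' := lt_of_le_of_ne (not_lt.1 hc) (fun h => hu (h ▸ hz'))
      exact absurd (hmin z' ⟨hz', h2⟩) (not_le.2 (h.trans hy2.2))
    · have hall : ∀ z ∈ Z, z < u := fun z hz =>
        lt_of_le_of_ne (not_lt.1 fun h => hex ⟨z, hz, h⟩) (fun h => hu (h ▸ hz))
      have hmem : ∀ y, u ≤ y → y ∈ sideSet Z u := fun y hy z hz =>
        ⟨⟨fun h => h.trans_le hy, fun _ => hall z hz⟩,
          ⟨fun h => absurd (hall z hz) h.le.not_gt,
            fun h => absurd ((hall z hz).trans_le hy) h.le.not_gt⟩⟩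
      have hmono : StrictMonoOn (fun x => f.eval x) (Ici u) := by
        refine strictMonoOn_of_deriv_pos (convex_Ici _) f.continuous.continuousOn fun x hx => ?_
        rw [interior_Ici] at hx
        rw [f.deriv]
        exact hd x (hmem x (le_of_lt hx))
      have hdeg : 0 < f.degree := by
        rw [← not_le]
        intro hle
        rw [eq_C_of_degree_le_zero hle] at hd
        simpa using hd u (mem_sideSet_self _ _)
      have ht := f.abs_tendsto_atTop hdeg
      obtain ⟨y, hy1, hy2⟩ := ((ht.eventually_gt_atTop |f.eval u|).and
        (eventually_gt_atTop u)).exists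
      refine ⟨y, hmem y hy2.le, ?_⟩
      have h3 : f.eval u < f.eval y := hmono (mem_Ici.2 le_rfl) (mem_Ici.2 hy2.le) hy2
      by_contra hc
      rw [abs_of_nonpos (not_lt.1 hc)] at hy1
      have := neg_abs_le (f.eval u)
      linarith

theorem exists_neg_iff_left {f : ℝ[X]} {Z : Set ℝ} {u : ℝ} (hu : u ∉ Z) (hZ : Z.Finite)
    (hd : ∀ y ∈ sideSet Z u, 0 < f.derivative.eval y) :
    (∃ y ∈ sideSet Z u, f.eval y < 0) ↔
      ∀ z ∈ Z, z < u → (∀ z' ∈ Z, z' < u → z' ≤ z) → f.eval z < 0 := by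
  have hside : ∀ y, y ∈ sideSet ((fun z => -z) '' Z) (-u) ↔ -y ∈ sideSet Z u := by
    intro y
    simp only [sideSet, mem_ofPred_eq, forall_mem_image, neg_lt_neg_iff]
    refine forall₂_congr fun z _ => ?_
    rw [and_comm, neg_lt (a := z) (b := y), lt_neg (a := y)]
  have key := exists_pos_iff_right (f := -(f.comp (-X))) (Z := (fun z => -z) '' Z) (u := -u)
    (by simpa using hu) (hZ.image _) (by
      intro y hy
      have := hd _ ((hside y).1 hy)
      simpa [derivative_comp] using this)
  constructor
  · rintro ⟨y, hy, hy0⟩ z hz huz hmin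
    have := key.1 ⟨-y, (hside _).2 (by simpa using hy), by simpa using hy0⟩ (-z) ⟨z, hz, rfl⟩
      (by simpa using huz) (by
        rintro _ ⟨z', hz', rfl⟩ h
        simpa using hmin z' hz' (by simpa using h))
    simpa using this
  · intro h
    obtain ⟨y, hy, hy0⟩ := key.2 (by
      rintro _ ⟨z, hz, rfl⟩ h1 h2
      have := h z hz (by simpa using h1) fun z' hz' h3 => by
        simpa using h2 (-z') ⟨z', hz', rfl⟩ (by simpa using h3)
      simpa using this)
    exact ⟨-y, (hside y).1 hy, by simpa using hy0⟩

theorem mem_sideSet_image (τ : ℝ ≃o ℝ) (Z : Set ℝ) (u y : ℝ) :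
    τ y ∈ sideSet (τ '' Z) (τ u) ↔ y ∈ sideSet Z u := by
  simp only [sideSet, mem_ofPred_eq, forall_mem_image, OrderIso.lt_iff_lt]

theorem strictMonoOn_sideSet {f : ℝ[X]} {Z : Set ℝ} {u : ℝ}
    (hd : ∀ y ∈ sideSet Z u, 0 < f.derivative.eval y) :
    StrictMonoOn (fun x => f.eval x) (sideSet Z u) := by
  refine strictMonoOn_of_deriv_pos (ordConnected_sideSet Z u).convex f.continuous.continuousOn
    fun x hx => ?_
  rw [f.deriv]
  exact hd x (interior_subset hx)

theorem exists_pair_of_pos {f g : ℝ[X]} {Z : Set ℝ} (hZ : Z.Finite) (τ : ℝ ≃o ℝ) {u : ℝ}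
    (hu : u ∉ Z) (h : ∀ z ∈ Z, SignType.sign (f.eval z) = SignType.sign (g.eval (τ z)))
    (hf : ∀ y ∈ sideSet Z u, 0 < f.derivative.eval y)
    (hg : ∀ y ∈ sideSet Z u, 0 < g.derivative.eval (τ y)) :
    ∃ a ∈ sideSet Z u, ∃ b ∈ sideSet Z u, ∀ σ : ℝ ≃o ℝ, σ a = b →
      (∀ y ∈ sideSet Z u, σ y ∈ sideSet Z u) → ∀ y ∈ sideSet Z u,
        SignType.sign (f.eval y) = SignType.sign (g.eval (τ (σ y))) := by
  have hu' : τ u ∉ τ '' Z := by simpa using hu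
  have hg' : ∀ y ∈ sideSet (τ '' Z) (τ u), 0 < g.derivative.eval y := by
    intro y hy
    obtain ⟨y, rfl⟩ := τ.surjective y
    exact hg y ((mem_sideSet_image τ Z u y).1 hy)
  have pf := exists_pos_iff_right hu hZ hf
  have pg := exists_pos_iff_right hu' (hZ.image _) hg'
  have nf := exists_neg_iff_left hu hZ hf
  have ng := exists_neg_iff_left hu' (hZ.image _) hg'
  have hpos : ∀ z ∈ Z, (0 < f.eval z ↔ 0 < g.eval (τ z)) := fun z hz => by
    rw [← sign_eq_one_iff, h z hz, sign_eq_one_iff]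
  have hneg : ∀ z ∈ Z, (f.eval z < 0 ↔ g.eval (τ z) < 0) := fun z hz => by
    rw [← sign_eq_neg_one_iff, h z hz, sign_eq_neg_one_iff]
  have hP : (∃ y ∈ sideSet Z u, 0 < f.eval y) ↔ ∃ y ∈ sideSet Z u, 0 < g.eval (τ y) := by
    rw [pf]
    have : (∃ y ∈ sideSet Z u, 0 < g.eval (τ y)) ↔
        ∃ y ∈ sideSet (τ '' Z) (τ u), 0 < g.eval y := by
      rw [τ.surjective.exists (p := fun y => y ∈ sideSet (τ '' Z) (τ u) ∧ 0 < g.eval y)]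
      simp only [mem_sideSet_image]
    rw [this, pg]
    simp only [forall_mem_image, OrderIso.lt_iff_lt, OrderIso.le_iff_le]
    exact forall₂_congr fun z hz => by rw [hpos z hz]
  have hN : (∃ y ∈ sideSet Z u, f.eval y < 0) ↔ ∃ y ∈ sideSet Z u, g.eval (τ y) < 0 := by
    rw [nf]
    have : (∃ y ∈ sideSet Z u, g.eval (τ y) < 0) ↔
        ∃ y ∈ sideSet (τ '' Z) (τ u), g.eval y < 0 := by
      rw [τ.surjective.exists (p := fun y => y ∈ sideSet (τ '' Z) (τ u) ∧ g.eval y < 0)]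
      simp only [mem_sideSet_image]
    rw [this, ng]
    simp only [forall_mem_image, OrderIso.lt_iff_lt, OrderIso.le_iff_le]
    exact forall₂_congr fun z hz => by rw [hneg z hz]
  have mf := strictMonoOn_sideSet hf
  have mg : StrictMonoOn (fun y => g.eval (τ y)) (sideSet Z u) := fun x hx y hy hxy =>
    strictMonoOn_sideSet hg' ((mem_sideSet_image τ Z u x).2 hx)
      ((mem_sideSet_image τ Z u y).2 hy) (τ.strictMono hxy)
  have hopen := isOpen_sideSet hZ hu
  have hself := mem_sideSet_self Z u
  have hlow : ∀ y ∈ sideSet Z u, ∃ x ∈ sideSet Z u, x < y := fun y hy => by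
    obtain ⟨ε, hε, hsub⟩ := Metric.isOpen_iff.1 hopen y hy
    exact ⟨y - ε / 2, hsub (by rw [Metric.mem_ball, Real.dist_eq, abs_lt]; constructor <;> linarith),
      by linarith⟩
  have hhigh : ∀ y ∈ sideSet Z u, ∃ x ∈ sideSet Z u, y < x := fun y hy => by
    obtain ⟨ε, hε, hsub⟩ := Metric.isOpen_iff.1 hopen y hy
    exact ⟨y + ε / 2, hsub (by rw [Metric.mem_ball, Real.dist_eq, abs_lt]; constructor <;> linarith),
      by linarith⟩
  by_cases hn : ∃ y ∈ sideSet Z u, f.eval y < 0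
  · by_cases hp : ∃ y ∈ sideSet Z u, 0 < f.eval y
    · obtain ⟨x1, hx1, hx1'⟩ := hn
      obtain ⟨x2, hx2, hx2'⟩ := hp
      obtain ⟨y1, hy1, hy1'⟩ := hN.1 ⟨x1, hx1, hx1'⟩
      obtain ⟨y2, hy2, hy2'⟩ := hP.1 ⟨x2, hx2, hx2'⟩
      have hJ := (ordConnected_sideSet Z u).isPreconnected
      obtain ⟨a, ha, ha0⟩ := hJ.intermediate_value hx1 hx2 f.continuous.continuousOn
        ⟨hx1'.le, hx2'.le⟩
      obtain ⟨b, hb, hb0⟩ := hJ.intermediate_value hy1 hy2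
        (f := fun y => g.eval (τ y)) (g.continuous.comp τ.continuous).continuousOn
        ⟨hy1'.le, hy2'.le⟩
      refine ⟨a, ha, b, hb, fun σ hσ hσJ y hy => ?_⟩
      rcases lt_trichotomy y a with hya | rfl | hya
      · have h1 : f.eval y < 0 := ha0 ▸ mf hy ha hya
        have h2 : g.eval (τ (σ y)) < 0 :=
          hb0 ▸ mg (hσJ y hy) hb (hσ ▸ σ.strictMono hya)
        rw [sign_neg h1, sign_neg h2]
      · rw [hσ]
        simp only at ha0 hb0
        rw [ha0, hb0]
      · have h1 : 0 < f.eval y := ha0 ▸ mf ha hy hya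
        have h2 : 0 < g.eval (τ (σ y)) :=
          hb0 ▸ mg hb (hσJ y hy) (hσ ▸ σ.strictMono hya)
        rw [sign_pos h1, sign_pos h2]
    · refine ⟨u, hself, u, hself, fun σ _ hσJ y hy => ?_⟩
      have hp' := mt hP.2 hp
      push Not at hp hp'
      obtain ⟨x, hx, hxy⟩ := hhigh y hy
      obtain ⟨x', hx', hxy'⟩ := hhigh _ (hσJ y hy)
      rw [sign_neg ((mf hy hx hxy).trans_le (hp x hx)),
        sign_neg ((mg (hσJ y hy) hx' hxy').trans_le (hp' x' hx'))]
  · refine ⟨u, hself, u, hself, fun σ _ hσJ y hy => ?_⟩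
    have hn' := mt hN.2 hn
    push Not at hn hn'
    obtain ⟨x, hx, hxy⟩ := hlow y hy
    obtain ⟨x', hx', hxy'⟩ := hlow _ (hσJ y hy)
    rw [sign_pos ((hn x hx).trans_lt (mf hx hy hxy)),
      sign_pos ((hn' x' hx').trans_lt (mg hx' (hσJ y hy) hxy'))]

theorem exists_pair {f g : ℝ[X]} {Z : Set ℝ} (hZ : Z.Finite) (τ : ℝ ≃o ℝ) {u : ℝ}
    (hu : u ∉ Z) (h : ∀ z ∈ Z, SignType.sign (f.eval z) = SignType.sign (g.eval (τ z)))
    (hfZ : ∀ y, f.derivative.eval y = 0 → y ∈ Z)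
    (hd : ∀ y, SignType.sign (f.derivative.eval y) = SignType.sign (g.derivative.eval (τ y))) :
    ∃ a ∈ sideSet Z u, ∃ b ∈ sideSet Z u, ∀ σ : ℝ ≃o ℝ, σ a = b →
      (∀ y ∈ sideSet Z u, σ y ∈ sideSet Z u) → ∀ y ∈ sideSet Z u,
        SignType.sign (f.eval y) = SignType.sign (g.eval (τ (σ y))) := by
  have hs : ∀ y ∈ sideSet Z u, SignType.sign (f.derivative.eval y) =
      SignType.sign (f.derivative.eval u) :=
    fun y hy => sign_eq_of_mem_sideSet f.derivative.continuous hfZ hy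
  rcases lt_trichotomy (f.derivative.eval u) 0 with h0 | h0 | h0
  · have h1 : ∀ y ∈ sideSet Z u, f.derivative.eval y < 0 := fun y hy => by
      rw [← sign_eq_neg_one_iff, hs y hy, sign_neg h0]
    have h2 : ∀ y ∈ sideSet Z u, g.derivative.eval (τ y) < 0 := fun y hy => by
      rw [← sign_eq_neg_one_iff, ← hd, hs y hy, sign_neg h0]
    obtain ⟨a, ha, b, hb, hab⟩ := exists_pair_of_pos (f := -f) (g := -g) hZ τ hu
      (fun z hz => by simp only [eval_neg, Left.sign_neg, h z hz])
      (fun y hy => by simpa using h1 y hy) (fun y hy => by simpa using h2 y hy)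
    refine ⟨a, ha, b, hb, fun σ h3 h4 y hy => ?_⟩
    have := hab σ h3 h4 y hy
    simpa only [eval_neg, Left.sign_neg, neg_inj] using this
  · exact absurd (hfZ u h0) hu
  · exact exists_pair_of_pos hZ τ hu h
      (fun y hy => by rw [← sign_eq_one_iff, hs y hy, sign_pos h0])
      (fun y hy => by rw [← sign_eq_one_iff, ← hd, hs y hy, sign_pos h0])

theorem exists_orderIso_sign_step {f g : ℝ[X]} {Z : Set ℝ} (hZ : Z.Finite) (τ : ℝ ≃o ℝ)
    (h : ∀ z ∈ Z, SignType.sign (f.eval z) = SignType.sign (g.eval (τ z)))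
    (hfZ : ∀ y, f.derivative.eval y = 0 → y ∈ Z)
    (hd : ∀ y, SignType.sign (f.derivative.eval y) = SignType.sign (g.derivative.eval (τ y))) :
    ∃ σ : ℝ ≃o ℝ, (∀ y, σ y ∈ sideSet Z y) ∧
      ∀ y, SignType.sign (f.eval y) = SignType.sign (g.eval (τ (σ y))) := by
  obtain ⟨σ, h1, h2, h3⟩ := exists_orderIso_glue (Z := Z)
    (fun y w => SignType.sign (f.eval y) = SignType.sign (g.eval (τ w))) (by
      intro u hu
      obtain ⟨a, ha, b, hb, hab⟩ := exists_pair hZ τ hu h hfZ hd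
      have hopen := isOpen_sideSet hZ hu
      have hJ := ordConnected_sideSet Z u
      obtain ⟨ε, hε, hsub⟩ := Metric.isOpen_iff.1 hopen _ (show min a b ∈ sideSet Z u by
        rcases min_choice a b with h | h <;> rwa [h])
      obtain ⟨δ, hδ, hsub'⟩ := Metric.isOpen_iff.1 hopen _ (show max a b ∈ sideSet Z u by
        rcases max_choice a b with h | h <;> rwa [h])
      have hl : min a b - ε / 2 ∈ sideSet Z u :=
        hsub (by rw [Metric.mem_ball, Real.dist_eq, abs_lt]; constructor <;> linarith)
      have hr : max a b + δ / 2 ∈ sideSet Z u :=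
        hsub' (by rw [Metric.mem_ball, Real.dist_eq, abs_lt]; constructor <;> linarith)
      have i1 := min_le_left a b
      have i2 := min_le_right a b
      have i3 := le_max_left a b
      have i4 := le_max_right a b
      obtain ⟨σ, hσ, hfix⟩ := exists_orderIso_bump (a := min a b - ε / 2) (b := max a b + δ / 2)
        (u := a) (v := b) (by linarith) (by linarith) (by linarith) (by linarith)
      have hmem : ∀ y ∈ sideSet Z u, σ y ∈ sideSet Z u := by
        intro y hy
        by_cases hy' : y ≤ min a b - ε / 2 ∨ max a b + δ / 2 ≤ y
        · rwa [hfix y hy']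
        · push Not at hy'
          refine hJ.out hl hr ⟨?_, ?_⟩
          · rw [← hfix _ (Or.inl le_rfl)]
            exact σ.monotone hy'.1.le
          · rw [← hfix _ (Or.inr le_rfl)]
            exact σ.monotone hy'.2.le
      have hmem' : ∀ y ∈ sideSet Z u, σ.symm y ∈ sideSet Z u := by
        intro y hy
        by_cases hy' : y ≤ min a b - ε / 2 ∨ max a b + δ / 2 ≤ y
        · rwa [σ.symm_apply_eq.2 (hfix y hy').symm]
        · push Not at hy'
          refine hJ.out hl hr ⟨?_, ?_⟩
          · rw [← σ.symm_apply_eq.2 (hfix _ (Or.inl le_rfl)).symm]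
            exact σ.symm.monotone hy'.1.le
          · rw [← σ.symm_apply_eq.2 (hfix _ (Or.inr le_rfl)).symm]
            exact σ.symm.monotone hy'.2.le
      exact ⟨σ, fun y hy => ⟨hmem y hy, hmem' y hy, hab σ hσ hmem y hy⟩⟩)
  refine ⟨σ, h2, fun y => ?_⟩
  by_cases hy : y ∈ Z
  · rw [h1 y hy, h y hy]
  · exact h3 y hy

theorem exists_pseudo_division {A : Type*} [CommRing A] (g : A[X]) (hg : 0 < g.natDegree)
    (f : A[X]) : ∃ (k : ℕ) (q r : A[X]), C (g.leadingCoeff ^ k) * f = q * g + r ∧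
      r.natDegree < g.natDegree := by
  induction hn : f.natDegree using Nat.strong_induction_on generalizing f with
  | _ n ih =>
    rcases lt_or_ge n g.natDegree with h | h
    · exact ⟨0, 0, f, by simp, hn ▸ h⟩
    · set f₁ : A[X] := C g.leadingCoeff * f - C f.leadingCoeff * X ^ (n - g.natDegree) * g with hf₁
      have hdeg : f₁.natDegree ≤ n := by
        refine (natDegree_sub_le _ _).trans (max_le ((natDegree_C_mul_le _ _).trans hn.le) ?_)
        refine natDegree_mul_le.trans ?_
        have := natDegree_C_mul_X_pow_le f.leadingCoeff (n - g.natDegree)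
        omega
      have hcoeff : f₁.coeff n = 0 := by
        rw [hf₁, coeff_sub, coeff_C_mul, mul_assoc, coeff_C_mul]
        obtain ⟨m, hm⟩ := Nat.exists_eq_add_of_le h
        have : (X ^ (n - g.natDegree) * g).coeff n = g.leadingCoeff := by
          rw [hm, Nat.add_sub_cancel_left, coeff_X_pow_mul]
          rfl
        rw [this, ← hn]
        change g.leadingCoeff * f.leadingCoeff - _ = 0
        ring
      have hlt : f₁.natDegree < n := by
        refine lt_of_le_of_ne hdeg fun heq => ?_
        have h0 : f₁.leadingCoeff = 0 := by rw [leadingCoeff, heq, hcoeff]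
        rw [leadingCoeff_eq_zero.1 h0, natDegree_zero] at heq
        omega
      obtain ⟨k, q, r, hq, hr⟩ := ih _ hlt f₁ rfl
      refine ⟨k + 1, q + C (g.leadingCoeff ^ k) * C f.leadingCoeff * X ^ (n - g.natDegree), r,
        ?_, hr⟩
      have : C (g.leadingCoeff ^ (k + 1)) * f = C (g.leadingCoeff ^ k) * f₁ +
          C (g.leadingCoeff ^ k) * C f.leadingCoeff * X ^ (n - g.natDegree) * g := by
        rw [hf₁, pow_succ, C_mul]
        ring
      rw [this, hq]
      ring

theorem eraseLead_map_eq {A : Type*} [CommRing A] (φ : A →+* ℝ) {g : A[X]}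
    (h : φ g.leadingCoeff = 0) : g.map φ = g.eraseLead.map φ := by
  have := congrArg (Polynomial.map φ) g.eraseLead_add_C_mul_X_pow
  rw [Polynomial.map_add, Polynomial.map_mul, map_C, h, C_0, zero_mul, add_zero] at this
  exact this.symm

/-- The order isomorphism `τ` transports the signs of `p` to those of `q`. -/
def SignMatch (p q : ℝ[X]) (τ : ℝ ≃o ℝ) : Prop :=
  ∀ y, SignType.sign (p.eval y) = SignType.sign (q.eval (τ y))

theorem SignMatch.C_iff {a b : ℝ} {τ : ℝ ≃o ℝ} :
    SignMatch (C a) (C b) τ ↔ SignType.sign a = SignType.sign b := by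
  simp [SignMatch]

theorem sign_mul_of_pos {c a : ℝ} (hc : 0 < c) : SignType.sign (c * a) = SignType.sign a := by
  rw [sign_mul, sign_pos hc, one_mul]

theorem exists_sign_at_roots {A X : Type*} [CommRing A] (ev : X → A →+* ℝ) (f : A[X])
    (hf : 0 < f.natDegree) (g : A[X]) (hg : g.natDegree ≤ f.natDegree) :
    ∃ R : Set A[X], R.Finite ∧ (∀ p ∈ R, p.natDegree < f.natDegree) ∧ ∀ x x' τ,
      (∀ p ∈ R, SignMatch (p.map (ev x)) (p.map (ev x')) τ) →
      SignMatch (g.map (ev x)) (g.map (ev x')) τ →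
      ∀ y, (g.map (ev x)).eval y = 0 → g.map (ev x) ≠ 0 →
        SignType.sign ((f.map (ev x)).eval y) = SignType.sign ((f.map (ev x')).eval (τ y)) := by
  induction hn : g.natDegree using Nat.strong_induction_on generalizing g with
  | _ n ih =>
    rcases Nat.eq_zero_or_pos g.natDegree with h0 | hpos
    · refine ⟨∅, finite_empty, by simp, fun x x' τ _ _ y hy hne => absurd ?_ hne⟩
      rw [eq_C_of_natDegree_eq_zero h0] at hy ⊢
      simpa using hy
    · obtain ⟨k, q, r, hqr, hr⟩ := exists_pseudo_division g hpos f
      have hle := eraseLead_natDegree_le g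
      obtain ⟨R, hRf, hRd, hR⟩ := ih g.eraseLead.natDegree (by omega) g.eraseLead (by omega) rfl
      refine ⟨insert (C g.leadingCoeff) (insert (C (g.leadingCoeff ^ k) * r)
        (insert g.eraseLead R)), ((hRf.insert _).insert _).insert _, ?_, ?_⟩
      · rintro p (rfl | rfl | rfl | hp)
        · simpa using hf
        · exact (natDegree_C_mul_le _ _).trans_lt (hr.trans_le hg)
        · omega
        · exact hRd p hp
      · intro x x' τ hm hgm y hy hne
        have m1 : SignType.sign (ev x g.leadingCoeff) = SignType.sign (ev x' g.leadingCoeff) := by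
          have := hm _ (mem_insert _ _)
          rwa [map_C, map_C, SignMatch.C_iff] at this
        by_cases hlc : ev x g.leadingCoeff = 0
        · have hlc' : ev x' g.leadingCoeff = 0 := by
            rw [← sign_eq_zero_iff, ← m1, hlc, sign_zero]
          rw [eraseLead_map_eq _ hlc] at hy hne
          exact hR x x' τ (fun p hp => hm p (by simp [hp])) (hm _ (by simp)) y hy hne
        · have hlc' : ev x' g.leadingCoeff ≠ 0 := by
            rwa [← sign_ne_zero, ← m1, sign_ne_zero]
          have m2 := hm (C (g.leadingCoeff ^ k) * r) (by simp) y
          have key : ∀ (z : X) (w : ℝ), ev z g.leadingCoeff ≠ 0 → (g.map (ev z)).eval w = 0 →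
              SignType.sign (((C (g.leadingCoeff ^ k) * r).map (ev z)).eval w) =
                SignType.sign ((f.map (ev z)).eval w) := by
            intro z w hz hw
            have h1 := congrArg (fun p => (p.map (ev z)).eval w) hqr
            simp only [Polynomial.map_mul, map_C, Polynomial.map_add, eval_mul, eval_C, eval_add,
              hw, mul_zero, zero_add] at h1
            simp only [Polynomial.map_mul, map_C, eval_mul, eval_C]
            rw [← h1, ← mul_assoc]
            refine sign_mul_of_pos ?_
            rw [map_pow]
            exact mul_self_pos.2 (pow_ne_zero _ hz)
          have hy' : (g.map (ev x')).eval (τ y) = 0 := by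
            rw [← sign_eq_zero_iff, ← hgm y, hy, sign_zero]
          rwa [← key x y hlc hy, m2, key x' (τ y) hlc']

/-- The sign diagram of a finite family of univariate polynomials is determined by the signs of
finitely many expressions in the coefficients. -/
theorem exists_sign_diagram {A X : Type*} [CommRing A] (ev : X → A →+* ℝ) (F : Set A[X])
    (hF : F.Finite) : ∃ D : Set A, D.Finite ∧ ∀ x x',
      (∀ a ∈ D, SignType.sign (ev x a) = SignType.sign (ev x' a)) →
      ∃ τ, ∀ p ∈ F, SignMatch (p.map (ev x)) (p.map (ev x')) τ := by
  suffices H : ∀ d : ℕ, ∀ F : Set A[X], F.Finite → (∀ p ∈ F, p.natDegree ≤ d) →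
      ∃ D : Set A, D.Finite ∧ ∀ x x',
      (∀ a ∈ D, SignType.sign (ev x a) = SignType.sign (ev x' a)) →
      ∃ τ, ∀ p ∈ F, SignMatch (p.map (ev x)) (p.map (ev x')) τ by
    obtain ⟨d, hd⟩ := (hF.image natDegree).bddAbove
    exact H d F hF fun p hp => hd ⟨p, hp, rfl⟩
  intro d
  induction d with
  | zero =>
    intro F hF hd
    refine ⟨(fun p => p.coeff 0) '' F, hF.image _, fun x x' h => ⟨OrderIso.refl _, ?_⟩⟩
    intro p hp
    rw [eq_C_of_natDegree_eq_zero (Nat.le_zero.1 (hd p hp)), map_C, map_C, SignMatch.C_iff]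
    exact h _ ⟨p, hp, rfl⟩
  | succ d ih =>
    suffices H : ∀ T : Set A[X], T.Finite → (∀ p ∈ T, p.natDegree = d + 1) →
        ∀ F : Set A[X], F.Finite → (∀ p ∈ F, p.natDegree ≤ d) →
        ∃ D : Set A, D.Finite ∧ ∀ x x',
        (∀ a ∈ D, SignType.sign (ev x a) = SignType.sign (ev x' a)) →
        ∃ τ, ∀ p ∈ F ∪ T, SignMatch (p.map (ev x)) (p.map (ev x')) τ by
      intro F hF hd
      obtain ⟨D, hD, h⟩ := H {p ∈ F | p.natDegree = d + 1} (hF.subset fun p hp => hp.1)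
        (fun p hp => hp.2) {p ∈ F | p.natDegree ≤ d} (hF.subset fun p hp => hp.1)
        (fun p hp => hp.2)
      refine ⟨D, hD, fun x x' hx => ?_⟩
      obtain ⟨τ, hτ⟩ := h x x' hx
      refine ⟨τ, fun p hp => hτ p ?_⟩
      have := hd p hp
      rcases this.lt_or_eq with h1 | h1
      · exact Or.inl ⟨hp, by omega⟩
      · exact Or.inr ⟨hp, h1⟩
    intro T hT
    induction T, hT using Set.Finite.induction_on with
    | empty =>
      intro _ F hF hd
      simpa using ih F hF hd
    | @insert f T hfT hT ihT =>
      intro hTd F hF hFd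
      have hfd : f.natDegree = d + 1 := hTd f (mem_insert _ _)
      have hder : f.derivative.natDegree ≤ d := by
        have := natDegree_derivative_le f
        omega
      set K : Set A[X] := insert f.derivative (F ∪ T) with hK
      have hKf : K.Finite := (hF.union hT).insert _
      have hKd : ∀ g ∈ K, g.natDegree ≤ f.natDegree := by
        rintro g (rfl | hg | hg)
        · omega
        · have := hFd g hg
          omega
        · rw [hTd g (mem_insert_of_mem _ hg), hfd]
      choose! R hRf hRd hR using fun g (hg : g ∈ K) =>
        exists_sign_at_roots ev f (by omega) g (hKd g hg)
      obtain ⟨D, hD, h⟩ := ihT (fun p hp => hTd p (mem_insert_of_mem _ hp))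
        (insert (C f.leadingCoeff) (insert f.eraseLead (insert f.derivative
          (F ∪ ⋃ g ∈ K, R g))))
        (((((hF.union (hKf.biUnion hRf))).insert _).insert _).insert _) (by
          rintro p (rfl | rfl | rfl | hp | hp)
          · simp
          · have := eraseLead_natDegree_le f
            omega
          · exact hder
          · exact hFd p hp
          · simp only [mem_iUnion] at hp
            obtain ⟨g, hg, hp⟩ := hp
            have := hRd g hg p hp
            omega)
      refine ⟨D, hD, fun x x' hx => ?_⟩
      obtain ⟨τ, hτ⟩ := h x x' hx
      have hKm : ∀ g ∈ K, SignMatch (g.map (ev x)) (g.map (ev x')) τ := by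
        rintro g (rfl | hg | hg)
        · exact hτ _ (by simp)
        · exact hτ _ (by simp [hg])
        · exact hτ _ (by simp [hg])
      have m1 : SignType.sign (ev x f.leadingCoeff) = SignType.sign (ev x' f.leadingCoeff) := by
        have := hτ (C f.leadingCoeff) (by simp)
        rwa [map_C, map_C, SignMatch.C_iff] at this
      by_cases hlc : ev x f.leadingCoeff = 0
      · have hlc' : ev x' f.leadingCoeff = 0 := by
          rw [← sign_eq_zero_iff, ← m1, hlc, sign_zero]
        refine ⟨τ, ?_⟩
        rintro p (hp | rfl | hp)
        · exact hKm p (by simp [hK, hp])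
        · rw [eraseLead_map_eq _ hlc, eraseLead_map_eq _ hlc']
          exact hτ _ (by simp)
        · exact hKm p (by simp [hK, hp])
      · set Z : Set ℝ := ⋃ g ∈ K, {y | (g.map (ev x)).eval y = 0 ∧ g.map (ev x) ≠ 0} with hZ
        have hZf : Z.Finite := by
          refine hKf.biUnion fun g _ => ?_
          by_cases h0 : g.map (ev x) = 0
          · simp [h0]
          · refine ((g.map (ev x)).roots.toFinset.finite_toSet).subset fun y hy => ?_
            simpa [h0] using hy.1
        have hdne : (f.derivative.map (ev x)) ≠ 0 := by
          intro h0
          have := congrArg (fun p => p.coeff d) h0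
          rw [coeff_map, coeff_derivative, ← hfd] at this
          simp only [map_mul, coeff_zero, mul_eq_zero] at this
          rcases this with h1 | h1
          · exact hlc h1
          · have h2 : ((d : ℝ) + 1) = 0 := by simpa using h1
            have h3 : (0 : ℝ) < d + 1 := by positivity
            linarith
        obtain ⟨σ, hσ, hfσ⟩ := exists_orderIso_sign_step (f := f.map (ev x)) (g := f.map (ev x'))
          hZf τ (by
            intro z hz
            simp only [hZ, mem_iUnion] at hz
            obtain ⟨g, hg, hz1, hz2⟩ := hz
            refine hR g hg x x' τ (fun p hp => hτ p ?_) (hKm g hg) z hz1 hz2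
            refine Or.inl (Or.inr (Or.inr (Or.inr (Or.inr ?_))))
            simp only [mem_iUnion]
            exact ⟨g, hg, hp⟩)
          (by
            intro y hy
            simp only [hZ, mem_iUnion]
            rw [derivative_map] at hy
            exact ⟨_, mem_insert _ _, hy, hdne⟩)
          (by
            intro y
            rw [derivative_map, derivative_map]
            exact hKm _ (mem_insert _ _) y)
        have hKσ : ∀ g ∈ K, SignMatch (g.map (ev x)) (g.map (ev x')) (σ.trans τ) := by
          intro g hg y
          rw [OrderIso.trans_apply, ← hKm g hg (σ y)]
          by_cases h0 : g.map (ev x) = 0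
          · simp [h0]
          · refine (sign_eq_of_mem_sideSet (g.map (ev x)).continuous (fun w hw => ?_) (hσ y)).symm
            simp only [hZ, mem_iUnion]
            exact ⟨g, hg, hw, h0⟩
        refine ⟨σ.trans τ, ?_⟩
        rintro p (hp | rfl | hp)
        · exact hKσ p (by simp [hK, hp])
        · exact hfσ
        · exact hKσ p (by simp [hK, hp])

section SAFramework

/-- The algebra of polynomial functions on a real vector space. -/
def polyFun (E : Type*) [NormedAddCommGroup E] [NormedSpace ℝ E] : Subalgebra ℝ (E → ℝ) :=
  Algebra.adjoin ℝ (range fun (φ : Module.Dual ℝ E) (x : E) => φ x)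

/-- Membership in `S` is determined by the signs of finitely many polynomial functions. -/
def SA {E : Type*} [NormedAddCommGroup E] [NormedSpace ℝ E] (S : Set E) : Prop :=
  ∃ D : Set (E → ℝ), D.Finite ∧ D ⊆ polyFun E ∧
    ∀ x y, (∀ f ∈ D, SignType.sign (f x) = SignType.sign (f y)) → x ∈ S → y ∈ S

variable {E F G : Type*} [NormedAddCommGroup E] [NormedSpace ℝ E]
  [NormedAddCommGroup F] [NormedSpace ℝ F] [NormedAddCommGroup G] [NormedSpace ℝ G]

theorem dual_mem_polyFun (φ : Module.Dual ℝ E) : (fun x => φ x) ∈ polyFun E :=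
  Algebra.subset_adjoin ⟨φ, rfl⟩

theorem comp_mem_polyFun {f : E → F} (hf : ∀ φ : Module.Dual ℝ F, (fun x => φ (f x)) ∈ polyFun E)
    {p : F → ℝ} (hp : p ∈ polyFun F) : (fun x => p (f x)) ∈ polyFun E := by
  induction hp using Algebra.adjoin_induction with
  | mem p hp =>
    obtain ⟨φ, rfl⟩ := hp
    exact hf φ
  | algebraMap r => exact (polyFun E).algebraMap_mem r
  | add p q _ _ hp hq => exact (polyFun E).add_mem hp hq
  | mul p q _ _ hp hq => exact (polyFun E).mul_mem hp hq

theorem comp_linear_mem_polyFun (f : E →ₗ[ℝ] F) {p : F → ℝ} (hp : p ∈ polyFun F) :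
    (fun x => p (f x)) ∈ polyFun E :=
  comp_mem_polyFun (fun φ => dual_mem_polyFun (φ.comp f)) hp

theorem const_mem_polyFun (c : ℝ) : (fun _ => c) ∈ polyFun E :=
  (polyFun E).algebraMap_mem c

theorem SA.preimage_of_polyFun {S : Set F} (hS : SA S) {f : E → F}
    (hf : ∀ φ : Module.Dual ℝ F, (fun x => φ (f x)) ∈ polyFun E) : SA {x | f x ∈ S} := by
  obtain ⟨D, hD, hDp, h⟩ := hS
  refine ⟨(fun p x => p (f x)) '' D, hD.image _, ?_, fun x y hxy hx => ?_⟩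
  · rintro _ ⟨p, hp, rfl⟩
    exact comp_mem_polyFun hf (hDp hp)
  · exact h _ _ (fun p hp => hxy _ ⟨p, hp, rfl⟩) hx

theorem SA.preimage_linear {S : Set F} (hS : SA S) (f : E →ₗ[ℝ] F) : SA {x | f x ∈ S} :=
  hS.preimage_of_polyFun fun φ => dual_mem_polyFun (φ.comp f)

theorem SA.not {P : E → Prop} (h : SA {x | P x}) : SA {x | ¬ P x} := by
  obtain ⟨D, hD, hDp, h⟩ := h
  exact ⟨D, hD, hDp, fun x y hxy hx hy => hx (h y x (fun f hf => (hxy f hf).symm) hy)⟩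

theorem SA.forall_mem {ι : Type*} {I : Set ι} (hI : I.Finite) {P : ι → E → Prop}
    (h : ∀ i ∈ I, SA {x | P i x}) : SA {x | ∀ i ∈ I, P i x} := by
  choose! D hD hDp h using h
  refine ⟨⋃ i ∈ I, D i, hI.biUnion hD, ?_, fun x y hxy hx i hi => ?_⟩
  · exact iUnion₂_subset hDp
  · exact h i hi x y (fun f hf => hxy f (mem_biUnion hi hf)) (hx i hi)

theorem SA.forall_finite {ι : Type*} [Finite ι] {P : ι → E → Prop}
    (h : ∀ i, SA {x | P i x}) : SA {x | ∀ i, P i x} := by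
  simpa using SA.forall_mem finite_univ (fun i _ => h i)

theorem SA.exists_mem {ι : Type*} {I : Set ι} (hI : I.Finite) {P : ι → E → Prop}
    (h : ∀ i ∈ I, SA {x | P i x}) : SA {x | ∃ i ∈ I, P i x} := by
  simpa using (SA.forall_mem hI fun i hi => (h i hi).not).not

theorem SA.exists_finite {ι : Type*} [Finite ι] {P : ι → E → Prop}
    (h : ∀ i, SA {x | P i x}) : SA {x | ∃ i, P i x} := by
  simpa using SA.exists_mem finite_univ (fun i _ => h i)

theorem SA.const (p : Prop) : SA {_x : E | p} :=
  ⟨∅, finite_empty, by simp, fun _ _ _ h => h⟩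

theorem SA.and {P Q : E → Prop} (hP : SA {x | P x}) (hQ : SA {x | Q x}) :
    SA {x | P x ∧ Q x} := by
  have := SA.forall_finite (ι := Bool) (P := fun b x => if b then P x else Q x)
    (by rintro (_ | _) <;> simpa)
  simpa [and_comm] using this

theorem SA.or {P Q : E → Prop} (hP : SA {x | P x}) (hQ : SA {x | Q x}) :
    SA {x | P x ∨ Q x} := by
  have := (hP.not.and hQ.not).not
  simpa only [not_and_or, not_not] using this

theorem SA.imp {P Q : E → Prop} (hP : SA {x | P x}) (hQ : SA {x | Q x}) :
    SA {x | P x → Q x} := by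
  simpa only [imp_iff_not_or] using hP.not.or hQ

theorem SA.univ : SA (univ : Set E) := SA.const True

theorem SA.pos {p : E → ℝ} (hp : p ∈ polyFun E) : SA {x | 0 < p x} := by
  refine ⟨{p}, finite_singleton _, by simpa, fun x y h hx => ?_⟩
  have := h p rfl
  rw [mem_ofPred_eq, ← sign_eq_one_iff] at hx ⊢
  rw [← this, hx]

theorem SA.zero {p : E → ℝ} (hp : p ∈ polyFun E) : SA {x | p x = 0} := by
  refine ⟨{p}, finite_singleton _, by simpa, fun x y h hx => ?_⟩
  have := h p rfl
  rw [mem_ofPred_eq, ← sign_eq_zero_iff] at hx ⊢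
  rw [← this, hx]

/-- Evaluation of polynomial functions at a point. -/
def evalPoly (x : E) : polyFun E →+* ℝ := (Pi.evalRingHom _ x).comp (polyFun E).val.toRingHom

theorem evalPoly_apply (x : E) (p : polyFun E) : evalPoly x p = p.1 x := rfl

theorem exists_polynomial_of_mem_polyFun {f : E × ℝ → ℝ} (hf : f ∈ polyFun (E × ℝ)) :
    ∃ p : (polyFun E)[X], ∀ x y, f (x, y) = (p.map (evalPoly x)).eval y := by
  induction hf using Algebra.adjoin_induction with
  | mem p hp =>
    obtain ⟨φ, rfl⟩ := hp
    refine ⟨C ⟨_, dual_mem_polyFun (φ.comp (LinearMap.inl ℝ E ℝ))⟩ +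
      C ⟨_, const_mem_polyFun (φ (0, 1))⟩ * X, fun x y => ?_⟩
    have : (x, y) = (x, (0 : ℝ)) + y • ((0 : E), (1 : ℝ)) := by simp
    simp only [Polynomial.map_add, map_C, Polynomial.map_mul, map_X, eval_add, eval_C, eval_mul,
      eval_X, evalPoly_apply]
    rw [this, map_add, map_smul, smul_eq_mul, mul_comm]
    rfl
  | algebraMap r =>
    refine ⟨C ⟨_, const_mem_polyFun r⟩, fun x y => ?_⟩
    simp [evalPoly_apply]
  | add p q _ _ hp hq =>
    obtain ⟨p', hp'⟩ := hp
    obtain ⟨q', hq'⟩ := hq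
    exact ⟨p' + q', fun x y => by simp [hp', hq']⟩
  | mul p q _ _ hp hq =>
    obtain ⟨p', hp'⟩ := hp
    obtain ⟨q', hq'⟩ := hq
    exact ⟨p' * q', fun x y => by simp [hp', hq']⟩

theorem SA.exists_real {P : E → ℝ → Prop} (hP : SA {p : E × ℝ | P p.1 p.2}) :
    SA {x | ∃ y, P x y} := by
  obtain ⟨D, hD, hDp, h⟩ := hP
  choose! p hp using fun f (hf : f ∈ D) => exists_polynomial_of_mem_polyFun (hDp hf)
  obtain ⟨D', hD', h'⟩ := exists_sign_diagram (evalPoly (E := E)) (p '' D) (hD.image _)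
  refine ⟨(fun q => q.1) '' D', hD'.image _, ?_, ?_⟩
  · rintro _ ⟨q, _, rfl⟩
    exact q.2
  · rintro x x' hx ⟨y, hy⟩
    obtain ⟨τ, hτ⟩ := h' x x' fun a ha => hx _ ⟨a, ha, rfl⟩
    refine ⟨τ y, h (x, y) (x', τ y) (fun f hf => ?_) hy⟩
    rw [hp f hf, hp f hf]
    exact hτ _ ⟨f, hf, rfl⟩ y

theorem SA.exists_pi (n : ℕ) {E : Type*} [NormedAddCommGroup E] [NormedSpace ℝ E]
    {P : E → (Fin n → ℝ) → Prop} (hP : SA {p : E × (Fin n → ℝ) | P p.1 p.2}) :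
    SA {x | ∃ y, P x y} := by
  induction n generalizing E with
  | zero =>
    have := hP.preimage_linear (LinearMap.inl ℝ E (Fin 0 → ℝ))
    have e : {x | ∃ y, P x y} = {x | LinearMap.inl ℝ E (Fin 0 → ℝ) x ∈
        {p : E × (Fin 0 → ℝ) | P p.1 p.2}} := by
      ext x
      exact ⟨fun ⟨y, hy⟩ => by simpa [Subsingleton.elim y 0] using hy, fun h => ⟨0, h⟩⟩
    rwa [e]
  | succ n ih =>
    let c : (E × ℝ) × (Fin n → ℝ) →ₗ[ℝ] E × (Fin (n + 1) → ℝ) :=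
      { toFun := fun p => (p.1.1, Fin.cons p.1.2 p.2)
        map_add' := fun p q => by
          ext i
          · rfl
          · refine Fin.cases ?_ (fun i => ?_) i <;> simp
        map_smul' := fun r p => by
          ext i
          · rfl
          · refine Fin.cases ?_ (fun i => ?_) i <;> simp }
    have h1 := hP.preimage_linear c
    have h2 := ih (P := fun (p : E × ℝ) z => P p.1 (Fin.cons p.2 z)) h1
    have h3 := SA.exists_real (P := fun x y => ∃ z : Fin n → ℝ, P x (Fin.cons y z)) h2
    have e : {x | ∃ y, P x y} = {x | ∃ (y : ℝ) (z : Fin n → ℝ), P x (Fin.cons y z)} := by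
      ext x
      constructor
      · rintro ⟨y, hy⟩
        exact ⟨y 0, Fin.tail y, by rwa [Fin.cons_self_tail]⟩
      · rintro ⟨y, z, h⟩
        exact ⟨_, h⟩
    rwa [e]

theorem SA.exists [FiniteDimensional ℝ F] {P : E → F → Prop}
    (hP : SA {p : E × F | P p.1 p.2}) : SA {x | ∃ y, P x y} := by
  let e := (Module.finBasis ℝ F).equivFun
  have h1 := hP.preimage_linear (LinearMap.prodMap (LinearMap.id (R := ℝ) (M := E))
    e.symm.toLinearMap)
  have h2 := SA.exists_pi _ (P := fun x z => P x (e.symm z)) h1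
  have e' : {x | ∃ y, P x y} = {x | ∃ z, P x (e.symm z)} := by
    ext x
    exact ⟨fun ⟨y, hy⟩ => ⟨e y, by simpa using hy⟩, fun ⟨z, hz⟩ => ⟨_, hz⟩⟩
  rwa [e']

theorem SA.forall [FiniteDimensional ℝ F] {P : E → F → Prop}
    (hP : SA {p : E × F | P p.1 p.2}) : SA {x | ∀ y, P x y} := by
  have := (SA.exists (P := fun x y => ¬ P x y) hP.not).not
  simpa only [not_exists, not_not] using this

/-- A function with semialgebraic graph (not necessarily continuous). -/
@[fun_prop]
def SAfun (f : E → F) : Prop := SA {p : E × F | p.2 = f p.1}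

theorem SA.eq_of_polyFun [FiniteDimensional ℝ F] {f g : E → F}
    (h : ∀ φ : Module.Dual ℝ F, (fun x => φ (f x) - φ (g x)) ∈ polyFun E) :
    SA {x | f x = g x} := by
  let b := Module.finBasis ℝ F
  have h1 := SA.forall_finite fun i => SA.zero (h (b.coord i))
  have e : {x | f x = g x} = {x | ∀ i, b.coord i (f x) - b.coord i (g x) = 0} := by
    ext x
    simp only [mem_ofPred_eq, sub_eq_zero]
    rw [← b.ext_elem_iff.symm]
    rfl
  rwa [e]

theorem SAfun.of_polyFun [FiniteDimensional ℝ F] {f : E → F}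
    (h : ∀ φ : Module.Dual ℝ F, (fun x => φ (f x)) ∈ polyFun E) : SAfun f :=
  SA.eq_of_polyFun fun φ => (polyFun _).sub_mem
    (dual_mem_polyFun (φ.comp (LinearMap.snd ℝ E F)))
    (comp_linear_mem_polyFun (LinearMap.fst ℝ E F) (h φ))

theorem SAfun.linear [FiniteDimensional ℝ F] (f : E →ₗ[ℝ] F) : SAfun (fun x => f x) :=
  .of_polyFun fun φ => dual_mem_polyFun (φ.comp f)

theorem SAfun.clinear [FiniteDimensional ℝ F] (f : E →L[ℝ] F) : SAfun (fun x => f x) :=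
  SAfun.linear f.toLinearMap

@[fun_prop]
theorem SAfun.id [FiniteDimensional ℝ E] : SAfun (fun x : E => x) := SAfun.linear LinearMap.id

@[fun_prop]
theorem SAfun.const [FiniteDimensional ℝ F] (c : F) : SAfun (fun _ : E => c) :=
  .of_polyFun fun φ => const_mem_polyFun (φ c)

theorem SA.preimage [FiniteDimensional ℝ F] {S : Set F} (hS : SA S) {f : E → F}
    (hf : SAfun f) : SA {x | f x ∈ S} := by
  have h1 := SA.and (P := fun p : E × F => p.2 = f p.1) (Q := fun p => p.2 ∈ S) hf
    (hS.preimage_linear (LinearMap.snd ℝ E F))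
  have := SA.exists (P := fun x y => y = f x ∧ y ∈ S) h1
  simpa using this

@[fun_prop]
theorem SAfun.comp [FiniteDimensional ℝ E] [FiniteDimensional ℝ F] [FiniteDimensional ℝ G]
    {g : F → G} {f : E → F} (hg : SAfun g) (hf : SAfun f) : SAfun (fun x => g (f x)) := by
  have h1 := SA.preimage_linear hf (LinearMap.prodMap (LinearMap.fst ℝ E G)
    (LinearMap.id (R := ℝ) (M := F)))
  have h2 := SA.preimage_linear hg (LinearMap.prod (LinearMap.snd ℝ (E × G) F)
    ((LinearMap.snd ℝ E G).comp (LinearMap.fst ℝ (E × G) F)))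
  have := SA.exists (P := fun (p : E × G) y => y = f p.1 ∧ p.2 = g y) (h1.and h2)
  simpa [SAfun] using this

@[fun_prop]
theorem SAfun.prodMk {f : E → F} {g : E → G} (hf : SAfun f) (hg : SAfun g) :
    SAfun (fun x => (f x, g x)) := by
  have h1 := SA.preimage_linear hf (LinearMap.prodMap (LinearMap.id (R := ℝ) (M := E))
    (LinearMap.fst ℝ F G))
  have h2 := SA.preimage_linear hg (LinearMap.prodMap (LinearMap.id (R := ℝ) (M := E))
    (LinearMap.snd ℝ F G))
  have := h1.and h2
  simpa [SAfun, Prod.ext_iff] using this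

variable [FiniteDimensional ℝ E] [FiniteDimensional ℝ F] [FiniteDimensional ℝ G]

@[fun_prop]
theorem SAfun.fst {f : E → F × G} (hf : SAfun f) : SAfun (fun x => (f x).1) :=
  (SAfun.linear (LinearMap.fst ℝ F G)).comp hf

@[fun_prop]
theorem SAfun.snd {f : E → F × G} (hf : SAfun f) : SAfun (fun x => (f x).2) :=
  (SAfun.linear (LinearMap.snd ℝ F G)).comp hf

@[fun_prop]
theorem SAfun.apply {ι : Type*} [Fintype ι] (i : ι) : SAfun (fun x : ι → ℝ => x i) :=
  SAfun.linear (LinearMap.proj i : (ι → ℝ) →ₗ[ℝ] ℝ)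

@[fun_prop]
theorem SAfun.add {f g : E → F} (hf : SAfun f) (hg : SAfun g) : SAfun (fun x => f x + g x) :=
  (SAfun.linear (LinearMap.fst ℝ F F + LinearMap.snd ℝ F F)).comp (hf.prodMk hg)

@[fun_prop]
theorem SAfun.sub {f g : E → F} (hf : SAfun f) (hg : SAfun g) : SAfun (fun x => f x - g x) :=
  (SAfun.linear (LinearMap.fst ℝ F F - LinearMap.snd ℝ F F)).comp (hf.prodMk hg)

@[fun_prop]
theorem SAfun.smul {f : E → ℝ} {g : E → F} (hf : SAfun f) (hg : SAfun g) :
    SAfun (fun x => f x • g x) := by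
  have : SAfun (fun p : ℝ × F => p.1 • p.2) := by
    refine .of_polyFun fun φ => ?_
    simp only [map_smul, smul_eq_mul]
    exact (polyFun _).mul_mem (dual_mem_polyFun (LinearMap.fst ℝ ℝ F))
      (dual_mem_polyFun (φ.comp (LinearMap.snd ℝ ℝ F)))
  exact this.comp (hf.prodMk hg)

@[fun_prop]
theorem SAfun.mul {f g : E → ℝ} (hf : SAfun f) (hg : SAfun g) : SAfun (fun x => f x * g x) :=
  hf.smul hg

omit [FiniteDimensional ℝ E] in
theorem SA.eq {f g : E → F} (hf : SAfun f) (hg : SAfun g) : SA {x | f x = g x} := by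
  have : SA {p : F × F | p.1 = p.2} := SA.eq_of_polyFun fun φ =>
    (polyFun _).sub_mem (dual_mem_polyFun (φ.comp (LinearMap.fst ℝ F F)))
      (dual_mem_polyFun (φ.comp (LinearMap.snd ℝ F F)))
  exact this.preimage (hf.prodMk hg)

theorem SA.lt {f g : E → ℝ} (hf : SAfun f) (hg : SAfun g) : SA {x | f x < g x} := by
  have : SA {y : ℝ | 0 < y} := SA.pos (dual_mem_polyFun LinearMap.id)
  have := this.preimage (hg.sub hf)
  simpa using this

theorem SA.le {f g : E → ℝ} (hf : SAfun f) (hg : SAfun g) : SA {x | f x ≤ g x} := by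
  simpa only [not_lt] using (SA.lt hg hf).not

@[fun_prop]
theorem SAfun.ite {P : E → Prop} [DecidablePred P] {f g : E → F} (hP : SA {x | P x})
    (hf : SAfun f) (hg : SAfun g) : SAfun (fun x => if P x then f x else g x) := by
  have hP' : SA {p : E × F | P p.1} := hP.preimage (f := Prod.fst) (by fun_prop)
  have := (hP'.and hf).or (hP'.not.and hg)
  unfold SAfun
  convert this using 2
  ext p
  by_cases h : P p.1 <;> simp [h]

@[fun_prop]
theorem SAfun.inv {f : E → ℝ} (hf : SAfun f) : SAfun (fun x => (f x)⁻¹) := by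
  have : SAfun (fun y : ℝ => y⁻¹) := by
    have h : SA {p : ℝ × ℝ | (p.1 = 0 ∧ p.2 = 0) ∨ p.1 * p.2 = 1} :=
      ((SA.eq (by fun_prop) (by fun_prop)).and (SA.eq (by fun_prop) (by fun_prop))).or
        (SA.eq (by fun_prop) (by fun_prop))
    unfold SAfun
    convert h using 2
    ext p
    by_cases h0 : p.1 = 0
    · simp [h0]
    · simp [h0, mul_eq_one_iff_inv_eq₀, eq_comm]
  exact this.comp hf

@[fun_prop]
theorem SAfun.div {f g : E → ℝ} (hf : SAfun f) (hg : SAfun g) : SAfun (fun x => f x / g x) := by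
  simp only [div_eq_mul_inv]
  fun_prop

@[fun_prop]
theorem SAfun.max {f g : E → ℝ} (hf : SAfun f) (hg : SAfun g) :
    SAfun (fun x => max (f x) (g x)) := by
  simp only [max_def]
  exact SAfun.ite (SA.le hf hg) hg hf

@[fun_prop]
theorem SAfun.neg {f : E → F} (hf : SAfun f) : SAfun (fun x => - f x) := by
  simpa using (SAfun.const 0).sub hf

@[fun_prop]
theorem SAfun.abs {f : E → ℝ} (hf : SAfun f) : SAfun (fun x => |f x|) := by
  simp only [abs_eq_max_neg]
  exact SAfun.max hf hf.neg

@[fun_prop]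
theorem SAfun.pi {ι : Type*} [Fintype ι] {f : E → ι → ℝ} (h : ∀ i, SAfun (fun x => f x i)) :
    SAfun f := by
  have := SA.forall_finite fun i => SA.eq (f := fun p : E × (ι → ℝ) => p.2 i)
    (g := fun p => f p.1 i) (by fun_prop) ((h i).comp (by fun_prop))
  simpa only [SAfun, funext_iff] using this

theorem SA.image {f : E → F} (hf : SAfun f) {S : Set E} (hS : SA S) : SA (f '' S) := by
  have h1 : SA {p : F × E | p.2 ∈ S} := hS.preimage (by fun_prop)
  have h2 : SA {p : F × E | f p.2 = p.1} := SA.eq (by fun_prop) (by fun_prop)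
  exact SA.exists (P := fun y x => x ∈ S ∧ f x = y) (h1.and h2)

theorem continuous_of_mem_polyFun {p : E → ℝ} (hp : p ∈ polyFun E) : Continuous p := by
  induction hp using Algebra.adjoin_induction with
  | mem p hp =>
    obtain ⟨φ, rfl⟩ := hp
    exact φ.continuous_of_finiteDimensional
  | algebraMap r => exact continuous_const
  | add p q _ _ hp hq => exact hp.add hq
  | mul p q _ _ hp hq => exact hp.mul hq

end SAFramework

section Link

theorem mem_polyFun_pi_iff {n : ℕ} {f : (Fin n → ℝ) → ℝ} :
    f ∈ polyFun (Fin n → ℝ) ↔ ∃ P : MvPolynomial (Fin n) ℝ, f = fun x => MvPolynomial.eval x P := by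
  constructor
  · intro hf
    induction hf using Algebra.adjoin_induction with
    | mem p hp =>
      obtain ⟨φ, rfl⟩ := hp
      refine ⟨∑ i, MvPolynomial.C (φ (Pi.single i 1)) * MvPolynomial.X i, ?_⟩
      ext x
      have hx : x = ∑ i, x i • (Pi.single i (1 : ℝ) : Fin n → ℝ) := by
        ext j
        simp [Finset.sum_apply, Pi.single_apply]
      conv_lhs => rw [hx]
      simp [mul_comm]
    | algebraMap r => exact ⟨MvPolynomial.C r, by ext; simp⟩
    | add p q _ _ hp hq =>
      obtain ⟨P, rfl⟩ := hp
      obtain ⟨Q, rfl⟩ := hq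
      exact ⟨P + Q, by ext; simp⟩
    | mul p q _ _ hp hq =>
      obtain ⟨P, rfl⟩ := hp
      obtain ⟨Q, rfl⟩ := hq
      exact ⟨P * Q, by ext; simp⟩
  · rintro ⟨P, rfl⟩
    induction P using MvPolynomial.induction_on with
    | C a => simpa using const_mem_polyFun a
    | add p q hp hq =>
      simp only [map_add]
      exact (polyFun _).add_mem hp hq
    | mul_X p i hp =>
      simp only [map_mul, MvPolynomial.eval_X]
      exact (polyFun _).mul_mem hp
        (dual_mem_polyFun (LinearMap.proj i : (Fin n → ℝ) →ₗ[ℝ] ℝ))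

theorem isBasicSemialgebraic_sign {n : ℕ} {ι : Type*} [Finite ι] (P : ι → MvPolynomial (Fin n) ℝ)
    (σ : ι → SignType) :
    IsBasicSemialgebraic n {x | ∀ i, SignType.sign (MvPolynomial.eval x (P i)) = σ i} := by
  obtain ⟨m, ⟨e⟩⟩ := Finite.exists_equiv_fin ι
  refine ⟨m, m, fun i => if σ (e.symm i) = 0 then P (e.symm i) else 0,
    fun i => if σ (e.symm i) = 1 then P (e.symm i) else
      if σ (e.symm i) = -1 then - P (e.symm i) else 1, ?_⟩
  ext x
  rw [mem_ofPred_eq, mem_ofPred_eq, ← forall_and, ← e.symm.forall_congr_right]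
  refine forall_congr' fun i => ?_
  rcases SignType.trichotomy (σ (e.symm i)) with h | h | h
  · simp [h, sign_eq_neg_one_iff]
  · simp [h]
  · simp [h, sign_eq_one_iff]

theorem isSemialgebraic_iff {n : ℕ} {S : Set (Fin n → ℝ)} : IsSemialgebraic n S ↔ SA S := by
  constructor
  · rintro ⟨k, B, hB, rfl⟩
    have : ∀ i, SA {x | x ∈ B i} := by
      intro i
      obtain ⟨r, s, f, g, h⟩ := hB i
      rw [h]
      exact (SA.forall_finite fun i => SA.zero (mem_polyFun_pi_iff.2 ⟨_, rfl⟩)).and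
        (SA.forall_finite fun i => SA.pos (mem_polyFun_pi_iff.2 ⟨_, rfl⟩))
    simpa [iUnion_ofPred, ofPred_exists] using SA.exists_finite this
  · rintro ⟨D, hD, hDp, h⟩
    have : Finite D := hD
    choose P hP using fun f : D => mem_polyFun_pi_iff.1 (hDp f.2)
    let T : Set (D → SignType) := {σ | ∃ x ∈ S, ∀ f : D, SignType.sign (f.1 x) = σ f}
    obtain ⟨k, ⟨e⟩⟩ := Finite.exists_equiv_fin T
    refine ⟨k, fun i => {x | ∀ f : D, SignType.sign (MvPolynomial.eval x (P f)) =
      (e.symm i).1 f}, fun i => isBasicSemialgebraic_sign _ _, ?_⟩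
    ext x
    rw [mem_iUnion]
    constructor
    · intro hx
      refine ⟨e ⟨fun f => SignType.sign (f.1 x), x, hx, fun f => rfl⟩, fun f => ?_⟩
      rw [Equiv.symm_apply_apply]
      exact congrArg _ (congrFun (hP f) x).symm
    · rintro ⟨i, hi⟩
      obtain ⟨y, hy, hyi⟩ := (e.symm i).2
      refine h y x (fun f hf => ?_) hy
      rw [hyi ⟨f, hf⟩, ← hi ⟨f, hf⟩]
      exact congrArg _ (congrFun (hP ⟨f, hf⟩) x).symm

end Link

section FinsetRoot

/-- The `j`-th smallest element of a finite set of reals, and `0` if there is none. -/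
noncomputable def nthElem (s : Finset ℝ) (j : ℕ) : ℝ :=
  if h : j < s.card then s.orderEmbOfFin rfl ⟨j, h⟩ else 0

theorem nthElem_mem {s : Finset ℝ} {j : ℕ} (h : j < s.card) : nthElem s j ∈ s := by
  rw [nthElem, dif_pos h]
  exact s.orderEmbOfFin_mem rfl _

theorem nthElem_lt {s : Finset ℝ} {i j : ℕ} (hij : i < j) (h : j < s.card) :
    nthElem s i < nthElem s j := by
  rw [nthElem, nthElem, dif_pos h, dif_pos (hij.trans h)]
  exact (s.orderEmbOfFin rfl).strictMono hij

theorem nthElem_le {s : Finset ℝ} {i j : ℕ} (hij : i ≤ j) (h : j < s.card) :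
    nthElem s i ≤ nthElem s j := by
  rcases hij.eq_or_lt with rfl | h1
  · exact le_rfl
  · exact (nthElem_lt h1 h).le

theorem lt_of_nthElem_lt {s : Finset ℝ} {i j : ℕ} (hi : i < s.card)
    (h : nthElem s i < nthElem s j) : i < j := by
  by_contra! hji
  exact (nthElem_le hji hi).not_gt h

theorem nthElem_injective {s : Finset ℝ} {i j : ℕ} (hi : i < s.card) (hj : j < s.card)
    (h : nthElem s i = nthElem s j) : i = j := by
  by_contra hne
  rcases lt_or_gt_of_ne hne with h1 | h1
  · exact (nthElem_lt h1 hj).ne h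
  · exact (nthElem_lt h1 hi).ne h.symm

theorem exists_nthElem {s : Finset ℝ} {z : ℝ} (hz : z ∈ s) : ∃ j < s.card, nthElem s j = z := by
  have : z ∈ range (s.orderEmbOfFin rfl) := by rwa [s.range_orderEmbOfFin]
  obtain ⟨j, rfl⟩ := this
  exact ⟨j, j.2, by rw [nthElem, dif_pos j.2]⟩

theorem nthElem_eq_of_strictMono {s : Finset ℝ} {f : ℕ → ℝ} (hf : ∀ i < s.card, f i ∈ s)
    (hm : ∀ i j, i < j → j < s.card → f i < f j) {j : ℕ} (hj : j < s.card) :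
    nthElem s j = f j := by
  have := s.orderEmbOfFin_unique rfl (f := fun i : Fin s.card => f i) (fun i => hf i i.2)
    (fun i j hij => hm i j hij j.2)
  rw [nthElem, dif_pos hj, ← this]

theorem card_filter_lt_nthElem {s : Finset ℝ} {j : ℕ} (hj : j < s.card) :
    (s.filter (· < nthElem s j)).card = j := by
  have : s.filter (· < nthElem s j) = (Finset.range j).image (nthElem s) := by
    ext z
    simp only [Finset.mem_filter, Finset.mem_image, Finset.mem_range]
    constructor
    · rintro ⟨hz, hlt⟩
      obtain ⟨i, hi, rfl⟩ := exists_nthElem hz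
      exact ⟨i, lt_of_nthElem_lt hi hlt, rfl⟩
    · rintro ⟨i, hi, rfl⟩
      exact ⟨nthElem_mem (hi.trans hj), nthElem_lt hi hj⟩
  rw [this, Finset.card_image_of_injOn, Finset.card_range]
  intro a ha b hb hab
  exact nthElem_injective ((Finset.mem_range.1 ha).trans hj) ((Finset.mem_range.1 hb).trans hj) hab

theorem le_card_filter_lt_succ_iff {s : Finset ℝ} {j : ℕ} {y : ℝ} :
    j + 1 ≤ (s.filter (· < y)).card ↔ ∃ z ∈ s, z < y ∧ j ≤ (s.filter (· < z)).card := by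
  constructor
  · intro h
    have hne : (s.filter (· < y)).Nonempty := Finset.card_pos.1 (by omega)
    have hmem := Finset.max'_mem _ hne
    set z := (s.filter (· < y)).max' hne with hz
    rw [Finset.mem_filter] at hmem
    refine ⟨z, hmem.1, hmem.2, ?_⟩
    have : s.filter (· < y) ⊆ insert z (s.filter (· < z)) := by
      intro w hw
      rw [Finset.mem_insert]
      rcases (Finset.le_max' _ w hw).eq_or_lt with h1 | h1
      · exact Or.inl h1
      · exact Or.inr (Finset.mem_filter.2 ⟨(Finset.mem_filter.1 hw).1, h1⟩)
    have := (Finset.card_le_card this).trans (Finset.card_insert_le _ _)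
    omega
  · rintro ⟨z, hz, hzy, hj⟩
    have : insert z (s.filter (· < z)) ⊆ s.filter (· < y) := by
      intro w hw
      rcases Finset.mem_insert.1 hw with rfl | hw
      · exact Finset.mem_filter.2 ⟨hz, hzy⟩
      · have := Finset.mem_filter.1 hw
        exact Finset.mem_filter.2 ⟨this.1, this.2.trans hzy⟩
    have := Finset.card_le_card this
    rw [Finset.card_insert_of_notMem (by simp)] at this
    omega

theorem eq_nthElem_iff {s : Finset ℝ} {j : ℕ} {y : ℝ} : y = nthElem s j ↔
    (j < s.card ∧ y ∈ s ∧ (s.filter (· < y)).card = j) ∨ (s.card ≤ j ∧ y = 0) := by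
  rcases lt_or_ge j s.card with h | h
  · simp only [h, true_and, not_le.2 h, false_and, or_false]
    constructor
    · rintro rfl
      exact ⟨nthElem_mem h, card_filter_lt_nthElem h⟩
    · rintro ⟨hy, hc⟩
      obtain ⟨i, hi, rfl⟩ := exists_nthElem hy
      rw [card_filter_lt_nthElem hi] at hc
      rw [hc]
  · simp [nthElem, not_lt.2 h, h]

theorem le_card_iff {s : Finset ℝ} {j : ℕ} : j ≤ s.card ↔ ∃ y, j ≤ (s.filter (· < y)).card := by
  constructor
  · intro h
    obtain ⟨M, hM⟩ := s.finite_toSet.bddAbove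
    refine ⟨M + 1, ?_⟩
    rwa [Finset.filter_true_of_mem]
    intro x hx
    have := hM hx
    linarith
  · rintro ⟨y, h⟩
    exact h.trans (Finset.card_filter_le _ _)

end FinsetRoot

section Sections

variable {E : Type} [NormedAddCommGroup E] [NormedSpace ℝ E] [FiniteDimensional ℝ E]

/-- A semialgebraic closed family of finite subsets of `ℝ` parametrized by `E`, varying lower
semicontinuously and locally bounded. -/
structure IsSections (Z : E → Finset ℝ) : Prop where
  card_le : ∃ N, ∀ x, (Z x).card ≤ N
  isClosed : IsClosed {p : E × ℝ | p.2 ∈ Z p.1}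
  bounded : ∀ x₀, ∃ M, ∀ᶠ x in 𝓝 x₀, ∀ y ∈ Z x, |y| ≤ M
  lower : ∀ x₀, ∀ y₀ ∈ Z x₀, ∀ ε > 0, ∀ᶠ x in 𝓝 x₀, ∃ y ∈ Z x, |y - y₀| < ε
  sa : SA {p : E × ℝ | p.2 ∈ Z p.1}

namespace IsSections

variable {Z : E → Finset ℝ} (hZ : IsSections Z)
include hZ

theorem sa_le_card_filter (j : ℕ) :
    SA {p : E × ℝ | j ≤ ((Z p.1).filter (· < p.2)).card} := by
  induction j with
  | zero => simpa using SA.univ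
  | succ j ih =>
    simp only [le_card_filter_lt_succ_iff]
    refine SA.exists (P := fun (p : E × ℝ) z => z ∈ Z p.1 ∧ z < p.2 ∧
      j ≤ ((Z p.1).filter (· < z)).card) (SA.and ?_ (SA.and ?_ ?_))
    · exact hZ.sa.preimage (f := fun p : (E × ℝ) × ℝ => (p.1.1, p.2)) (by fun_prop)
    · exact SA.lt (by fun_prop) (by fun_prop)
    · exact ih.preimage (f := fun p : (E × ℝ) × ℝ => (p.1.1, p.2)) (by fun_prop)

theorem sa_le_card (j : ℕ) : SA {x | j ≤ (Z x).card} := by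
  have e : {x | j ≤ (Z x).card} = {x | ∃ y, j ≤ ((Z x).filter (· < y)).card} := by
    ext x
    exact le_card_iff
  rw [e]
  exact SA.exists (P := fun x y => j ≤ ((Z x).filter (· < y)).card) (hZ.sa_le_card_filter j)

theorem sa_card_eq (j : ℕ) : SA {x | (Z x).card = j} := by
  have := (hZ.sa_le_card j).and (hZ.sa_le_card (j + 1)).not
  convert this using 2
  ext x
  omega

theorem saFun_nthElem (j : ℕ) : SAfun (fun x => nthElem (Z x) j) := by
  unfold SAfun
  simp only [eq_nthElem_iff]
  refine SA.or (SA.and ?_ (SA.and hZ.sa ?_)) (SA.and ?_ (SA.eq (by fun_prop) (by fun_prop)))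
  · exact (hZ.sa_le_card (j + 1)).preimage (f := Prod.fst) (by fun_prop)
  · have := (hZ.sa_le_card_filter j).and (hZ.sa_le_card_filter (j + 1)).not
    convert this using 2
    ext x
    omega
  · have := (hZ.sa_le_card (j + 1)).not.preimage (f := fun p : E × ℝ => p.1) (by fun_prop)
    convert this using 2
    ext x
    simp

omit [FiniteDimensional ℝ E] in
theorem continuousOn_nthElem {C : Set E} {k : ℕ} (hC : ∀ x ∈ C, (Z x).card = k) {j : ℕ}
    (hj : j < k) : ContinuousOn (fun x => nthElem (Z x) j) C := by
  intro x₀ hx₀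
  rw [ContinuousWithinAt, Metric.tendsto_nhds]
  intro ε hε
  have hk := hC x₀ hx₀
  obtain ⟨δ, hδ, hδε, hgap⟩ : ∃ δ > 0, δ ≤ ε ∧ ∀ a b, a < b → b < k →
      nthElem (Z x₀) a + δ ≤ nthElem (Z x₀) b - δ := by
    have hev : ∀ p ∈ Finset.range k ×ˢ Finset.range k, p.1 < p.2 → ∀ᶠ δ in 𝓝[>] (0 : ℝ),
        nthElem (Z x₀) p.1 + δ ≤ nthElem (Z x₀) p.2 - δ := by
      intro p hp hlt
      have h1 := nthElem_lt hlt (by rw [hk]; exact Finset.mem_range.1 (Finset.mem_product.1 hp).2)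
      have := Ioc_mem_nhdsGT (half_pos (sub_pos.2 h1))
      filter_upwards [this] with δ hδ
      linarith [hδ.2]
    have hall : ∀ᶠ δ in 𝓝[>] (0 : ℝ), ∀ p ∈ Finset.range k ×ˢ Finset.range k, p.1 < p.2 →
        nthElem (Z x₀) p.1 + δ ≤ nthElem (Z x₀) p.2 - δ := by
      rw [Filter.eventually_all_finset]
      intro p hp
      by_cases h : p.1 < p.2
      · filter_upwards [hev p hp h] with δ h1 _ using h1
      · exact Eventually.of_forall fun δ h1 => absurd h1 h
    obtain ⟨δ, h1, h2⟩ := (hall.and (Ioc_mem_nhdsGT hε)).exists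
    refine ⟨δ, h2.1, h2.2, fun a b hab hb => h1 (a, b) ?_ hab⟩
    simp [hab.trans hb, hb]
  have hall : ∀ᶠ x in 𝓝[C] x₀, ∀ i ∈ Finset.range k, ∃ y ∈ Z x, |y - nthElem (Z x₀) i| < δ := by
    rw [Filter.eventually_all_finset]
    intro i hi
    exact nhdsWithin_le_nhds (hZ.lower x₀ _ (nthElem_mem (by simpa [hk] using hi)) δ hδ)
  filter_upwards [hall, self_mem_nhdsWithin] with x hx hxC
  have hk' := hC x hxC
  choose! f hfZ hf using hx
  have := nthElem_eq_of_strictMono (s := Z x) (f := f)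
    (fun i hi => hfZ i (by simpa [hk'] using hi)) (fun a b hab hb => by
      rw [hk'] at hb
      have h1 := abs_lt.1 (hf a (by simpa using hab.trans hb))
      have h2 := abs_lt.1 (hf b (by simpa using hb))
      have h3 := hgap a b hab hb
      linarith) (j := j) (by omega)
  simp only [this]
  exact (hf j (by simpa using hj)).trans_le hδε

end IsSections

end Sections

section Direction

theorem natDegree_prod_pow_le_and_coeff {A ι : Type*} [CommRing A] (f : ι → A[X])
    (hf : ∀ i, (f i).natDegree ≤ 1) (s : ι → ℕ) (I : Finset ι) :
    (∏ i ∈ I, f i ^ s i).natDegree ≤ ∑ i ∈ I, s i ∧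
      (∏ i ∈ I, f i ^ s i).coeff (∑ i ∈ I, s i) = ∏ i ∈ I, (f i).coeff 1 ^ s i := by
  classical
  have hpow : ∀ i, (f i ^ s i).natDegree ≤ s i := fun i => by
    simpa using natDegree_pow_le_of_le (s i) (hf i)
  induction I using Finset.induction_on with
  | empty => simp
  | insert i I hi ih =>
    rw [Finset.prod_insert hi, Finset.sum_insert hi, Finset.prod_insert hi]
    refine ⟨natDegree_mul_le_of_le (hpow i) ih.1, ?_⟩
    rw [coeff_mul_add_eq_of_natDegree_le (hpow i) ih.1, ih.2]
    congr 1
    simpa using coeff_pow_of_natDegree_le (m := s i) (hf i)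

theorem aeval_linear_natDegree_le_and_coeff {A : Type*} [CommRing A] [Algebra ℝ A] {m : ℕ}
    (F : MvPolynomial (Fin m) ℝ) (a : Fin m → A) (v : Fin m → ℝ) :
    (MvPolynomial.aeval (fun i => C (a i) + C (algebraMap ℝ A (v i)) * X) F).natDegree ≤
        F.totalDegree ∧
      (MvPolynomial.aeval (fun i => C (a i) + C (algebraMap ℝ A (v i)) * X) F).coeff
        F.totalDegree = algebraMap ℝ A
          (MvPolynomial.eval v (F.homogeneousComponent F.totalDegree)) := by
  set f : Fin m → A[X] := fun i => C (a i) + C (algebraMap ℝ A (v i)) * X with hf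
  have hf1 : ∀ i, (f i).natDegree ≤ 1 := fun i => by
    simp only [hf]
    rw [add_comm]
    exact natDegree_linear_le
  have hc1 : ∀ i, (f i).coeff 1 = algebraMap ℝ A (v i) := fun i => by simp [hf]
  have key := fun s : Fin m →₀ ℕ => natDegree_prod_pow_le_and_coeff f hf1 s Finset.univ
  have hdeg : ∀ s : Fin m →₀ ℕ, ∑ i, s i = s.degree := fun s =>
    (s.degree_eq_sum).symm
  have hF : MvPolynomial.aeval f F =
      ∑ s ∈ F.support, C (algebraMap ℝ A (F.coeff s)) * ∏ i, f i ^ s i := by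
    rw [MvPolynomial.aeval_def, MvPolynomial.eval₂_eq']
    rfl
  have hle : ∀ s ∈ F.support, s.degree ≤ F.totalDegree := fun s hs => by
    rw [← hdeg, ← Finsupp.sum_fintype s (fun _ e => e) fun _ => rfl]
    exact MvPolynomial.le_totalDegree hs
  rw [hF]
  constructor
  · refine (natDegree_sum_le _ _).trans (Finset.sup_le fun s hs => ?_)
    refine (natDegree_C_mul_le _ _).trans ((key s).1.trans ?_)
    rw [hdeg]
    exact hle s hs
  · rw [finsetSum_coeff, MvPolynomial.homogeneousComponent_apply, map_sum, map_sum,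
      Finset.sum_filter]
    refine Finset.sum_congr rfl fun s hs => ?_
    rw [coeff_C_mul]
    split_ifs with h
    · rw [← h, ← hdeg, (key s).2, MvPolynomial.eval_monomial, map_mul]
      simp [hc1, Finsupp.prod_fintype]
    · rw [coeff_eq_zero_of_natDegree_lt, mul_zero]
      refine (key s).1.trans_lt ?_
      rw [hdeg]
      exact lt_of_le_of_ne (hle s hs) h

variable {E : Type*} [NormedAddCommGroup E] [NormedSpace ℝ E]

/-- Polynomials in one variable over `polyFun E` with nonzero constant leading coefficient. -/
def IsQuasiMonic (p : (polyFun E)[X]) : Prop :=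
  ∃ c : ℝ, c ≠ 0 ∧ p.leadingCoeff = algebraMap ℝ (polyFun E) c

theorem isQuasiMonic_of_coeff {p : (polyFun E)[X]} {d : ℕ} (hd : p.natDegree ≤ d) {c : ℝ}
    (hc : c ≠ 0) (h : p.coeff d = algebraMap ℝ (polyFun E) c) : IsQuasiMonic p := by
  refine ⟨c, hc, ?_⟩
  have h0 : p.coeff d ≠ 0 := by
    rw [h]
    intro h0
    exact hc (congrFun (congrArg Subtype.val h0) 0)
  rw [leadingCoeff, le_antisymm hd (le_natDegree_of_ne_zero h0), h]

variable [FiniteDimensional ℝ E]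

omit [FiniteDimensional ℝ E] in
theorem exists_mvPolynomial_of_mem_polyFun {n : ℕ} (b : Module.Basis (Fin n) ℝ E) {f : E → ℝ}
    (hf : f ∈ polyFun E) :
    ∃ P : MvPolynomial (Fin n) ℝ, ∀ x, f x = MvPolynomial.eval (b.equivFun x) P := by
  obtain ⟨P, hP⟩ := mem_polyFun_pi_iff.1 (comp_linear_mem_polyFun b.equivFun.symm.toLinearMap hf)
  refine ⟨P, fun x => ?_⟩
  have := congrFun hP (b.equivFun x)
  rw [← this]
  simp

theorem exists_direction [Nontrivial E] {D : Set (E → ℝ)} (hD : D.Finite) (hDp : D ⊆ polyFun E) :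
    ∃ v : E, v ≠ 0 ∧ ∀ f ∈ D, f ≠ 0 → ∀ W : Submodule ℝ E, ∃ p : (polyFun W)[X],
      IsQuasiMonic p ∧ ∀ (x : W) (t : ℝ), f (x + t • v) = (p.map (evalPoly x)).eval t := by
  classical
  let b := Module.finBasis ℝ E
  choose! P hP using fun f (hf : f ∈ D) => exists_mvPolynomial_of_mem_polyFun b (hDp hf)
  let i₀ : Fin (Module.finrank ℝ E) := ⟨0, Module.finrank_pos⟩
  let Q : MvPolynomial (Fin (Module.finrank ℝ E)) ℝ := MvPolynomial.X i₀ *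
    ∏ f ∈ hD.toFinset with f ≠ 0, (P f).homogeneousComponent (P f).totalDegree
  have hP0 : ∀ f ∈ D, f ≠ 0 → P f ≠ 0 := by
    intro f hf h0 hP0
    apply h0
    ext x
    rw [hP f hf, hP0, map_zero]
    rfl
  have hQ : Q ≠ 0 := by
    refine mul_ne_zero (MvPolynomial.X_ne_zero _) (Finset.prod_ne_zero_iff.2 fun f hf => ?_)
    rw [Finset.mem_filter, hD.mem_toFinset] at hf
    intro h
    have hPf := hP0 f hf.1 hf.2
    obtain ⟨s, hs, hs'⟩ := Finset.exists_mem_eq_sup (P f).support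
      (MvPolynomial.support_nonempty.2 hPf) Finsupp.degree
    have htd : (P f).totalDegree = s.degree := by
      rw [← hs']
      rfl
    have := congrArg (MvPolynomial.coeff s) h
    rw [MvPolynomial.coeff_homogeneousComponent, if_pos htd.symm] at this
    exact MvPolynomial.mem_support_iff.1 hs this
  obtain ⟨w, hw⟩ : ∃ w, MvPolynomial.eval w Q ≠ 0 := by
    by_contra! h
    exact hQ (MvPolynomial.funext fun w => by simpa using h w)
  rw [map_mul, MvPolynomial.eval_X, map_prod, mul_ne_zero_iff, Finset.prod_ne_zero_iff] at hw
  refine ⟨b.equivFun.symm w, ?_, fun f hf h0 W => ?_⟩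
  · intro h
    rw [LinearEquiv.map_eq_zero_iff] at h
    exact hw.1 (by rw [h]; rfl)
  · let a : Fin (Module.finrank ℝ E) → polyFun W := fun i =>
      ⟨fun x => b.coord i x, dual_mem_polyFun ((b.coord i).comp W.subtype)⟩
    obtain ⟨h1, h2⟩ := aeval_linear_natDegree_le_and_coeff (P f) a w
    refine ⟨_, isQuasiMonic_of_coeff h1 (hw.2 f (by simp [hf, h0])) h2, fun x t => ?_⟩
    rw [hP f hf, ← coe_mapRingHom, ← coe_evalRingHom]
    have : ((evalRingHom t).comp (mapRingHom (evalPoly x))).comp (MvPolynomial.aeval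
        (fun i => C (a i) + C (algebraMap ℝ (polyFun W) (w i)) * X)).toRingHom =
        MvPolynomial.eval (b.equivFun (x + t • b.equivFun.symm w)) := by
      refine MvPolynomial.ringHom_ext (fun r => ?_) (fun i => ?_)
      · simp
        rfl
      · have h3 : b.equivFun (x + t • b.equivFun.symm w) i = b.coord i x + w i * t := by
          rw [map_add, map_smul, LinearEquiv.apply_symm_apply, mul_comm]
          rfl
        rw [MvPolynomial.eval_X, h3]
        simp only [RingHom.coe_comp, Function.comp_apply, AlgHom.toRingHom_eq_coe,
          RingHom.coe_coe, MvPolynomial.aeval_X, coe_mapRingHom, Polynomial.map_add, map_C,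
          Polynomial.map_mul, map_X, coe_evalRingHom, eval_add, eval_C, eval_mul, eval_X]
        rfl
    exact (congrFun (congrArg DFunLike.coe this) (P f)).symm

end Direction

section Family

theorem lt_iff_lt_of_notMem_uIcc {a b y : ℝ} (hy : y ∉ uIcc a b) :
    (y < a ↔ y < b) ∧ (a < y ↔ b < y) := by
  rw [mem_uIcc] at hy
  grind

variable {E : Type} [NormedAddCommGroup E] [NormedSpace ℝ E]

theorem IsQuasiMonic.leadingCoeff_map {p : (polyFun E)[X]} (hp : IsQuasiMonic p) (x : E) :
    evalPoly x p.leadingCoeff ≠ 0 := by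
  obtain ⟨c, hc, h⟩ := hp
  rw [h]
  exact hc

theorem IsQuasiMonic.map_ne_zero {p : (polyFun E)[X]} (hp : IsQuasiMonic p) (x : E) :
    p.map (evalPoly x) ≠ 0 := by
  intro h
  have := congrArg (fun q => q.coeff p.natDegree) h
  rw [coeff_map] at this
  exact hp.leadingCoeff_map x this

theorem IsQuasiMonic.natDegree_map {p : (polyFun E)[X]} (hp : IsQuasiMonic p) (x : E) :
    (p.map (evalPoly x)).natDegree = p.natDegree :=
  natDegree_map_of_leadingCoeff_ne_zero _ (hp.leadingCoeff_map x)

theorem IsQuasiMonic.derivative {p : (polyFun E)[X]} (hp : IsQuasiMonic p)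
    (h : 0 < p.natDegree) : IsQuasiMonic p.derivative ∧ p.derivative.natDegree < p.natDegree := by
  obtain ⟨c, hc, hpc⟩ := hp
  have h1 := natDegree_derivative_le p
  refine ⟨isQuasiMonic_of_coeff h1 (c := c * p.natDegree) ?_ ?_, by omega⟩
  · exact mul_ne_zero hc (by exact_mod_cast h.ne')
  · obtain ⟨n, hn⟩ := Nat.exists_eq_succ_of_ne_zero h.ne'
    rw [coeff_derivative, hn, Nat.succ_sub_one]
    have : p.coeff (n + 1) = algebraMap ℝ (polyFun E) c := by
      rw [← hpc, leadingCoeff, hn]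
    rw [this, map_mul]
    simp

theorem isQuasiMonic_X_sub_C (M : ℝ) :
    IsQuasiMonic (X - C (algebraMap ℝ (polyFun E) M)) :=
  isQuasiMonic_of_coeff (natDegree_X_sub_C_le _) one_ne_zero (by simp)

theorem eval_map_mem_polyFun (p : (polyFun E)[X]) :
    (fun z : E × ℝ => (p.map (evalPoly z.1)).eval z.2) ∈ polyFun (E × ℝ) := by
  induction p using Polynomial.induction_on' with
  | add p q hp hq =>
    simp only [Polynomial.map_add, eval_add]
    exact (polyFun _).add_mem hp hq
  | monomial n a =>
    simp only [map_monomial, eval_monomial]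
    exact (polyFun _).mul_mem (comp_linear_mem_polyFun (LinearMap.fst ℝ E ℝ) a.2)
      ((polyFun _).pow_mem (dual_mem_polyFun (LinearMap.snd ℝ E ℝ)) n)

open scoped Classical in
/-- A finite set of quasi-monic polynomials lies in one that is closed under differentiation. -/
theorem exists_derivative_closed (P : Finset (polyFun E)[X]) (hP : ∀ p ∈ P, IsQuasiMonic p) :
    ∃ Q : Finset (polyFun E)[X], P ⊆ Q ∧ (∀ p ∈ Q, IsQuasiMonic p) ∧
      ∀ p ∈ Q, 0 < p.natDegree → p.derivative ∈ Q := by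
  suffices H : ∀ d, ∀ p : (polyFun E)[X], IsQuasiMonic p → p.natDegree ≤ d →
      ∃ Q : Finset (polyFun E)[X], p ∈ Q ∧ (∀ p ∈ Q, IsQuasiMonic p) ∧
      ∀ p ∈ Q, 0 < p.natDegree → p.derivative ∈ Q by
    choose! Q h1 h2 h3 using fun p (hp : p ∈ P) => H _ p (hP p hp) le_rfl
    refine ⟨P.biUnion Q, fun p hp => Finset.mem_biUnion.2 ⟨p, hp, h1 p hp⟩, ?_, ?_⟩
    · intro p hp
      obtain ⟨q, hq, hpq⟩ := Finset.mem_biUnion.1 hp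
      exact h2 q hq p hpq
    · intro p hp hd
      obtain ⟨q, hq, hpq⟩ := Finset.mem_biUnion.1 hp
      exact Finset.mem_biUnion.2 ⟨q, hq, h3 q hq p hpq hd⟩
  intro d
  induction d with
  | zero =>
    intro p hp hd
    refine ⟨{p}, Finset.mem_singleton_self _, by simpa, fun q hq hq0 => ?_⟩
    rw [Finset.mem_singleton.1 hq] at hq0
    omega
  | succ d ih =>
    intro p hp hd
    rcases Nat.eq_zero_or_pos p.natDegree with h0 | hpos
    · exact ih p hp (by omega)
    · obtain ⟨h1, h2⟩ := hp.derivative hpos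
      obtain ⟨Q, hQ1, hQ2, hQ3⟩ := ih _ h1 (by omega)
      refine ⟨insert p Q, Finset.mem_insert_self _ _, ?_, ?_⟩
      · intro q hq
        rcases Finset.mem_insert.1 hq with rfl | hq
        · exact hp
        · exact hQ2 q hq
      · intro q hq hq0
        rcases Finset.mem_insert.1 hq with rfl | hq
        · exact Finset.mem_insert_of_mem hQ1
        · exact Finset.mem_insert_of_mem (hQ3 q hq hq0)

/-- The roots of the members of a family of polynomials. -/
noncomputable def familyRoots (Q : Finset (polyFun E)[X]) (x : E) : Finset ℝ :=
  (Q.val.bind fun p => (p.map (evalPoly x)).roots).toFinset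

theorem mem_familyRoots {Q : Finset (polyFun E)[X]} (hQ : ∀ p ∈ Q, IsQuasiMonic p) {x : E} {y : ℝ} :
    y ∈ familyRoots Q x ↔ ∃ p ∈ Q, (p.map (evalPoly x)).eval y = 0 := by
  simp only [familyRoots, Multiset.mem_toFinset, Multiset.mem_bind, Finset.mem_val]
  refine exists_congr fun p => and_congr_right fun hp => ?_
  rw [mem_roots ((hQ p hp).map_ne_zero x), IsRoot.def]

theorem abs_root_le {p : (polyFun E)[X]} (hp : IsQuasiMonic p) {x : E} {y : ℝ}
    (hy : (p.map (evalPoly x)).eval y = 0) :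
    |y| ≤ (∑ i ∈ Finset.range p.natDegree, |(p.coeff i).1 x|) / |p.leadingCoeff.1 0| + 1 := by
  have h1 : |y| < ((cauchyBound (p.map (evalPoly x)) : NNReal) : ℝ) := by
    rw [← Real.norm_eq_abs, ← coe_nnnorm]
    exact_mod_cast IsRoot.norm_lt_cauchyBound (hp.map_ne_zero x) hy
  refine h1.le.trans ?_
  have hlc : (p.map (evalPoly x)).leadingCoeff = p.leadingCoeff.1 0 := by
    rw [leadingCoeff_map_of_leadingCoeff_ne_zero _ (hp.leadingCoeff_map x)]
    obtain ⟨c, -, h⟩ := hp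
    rw [h]
    rfl
  rw [cauchyBound, hlc, hp.natDegree_map]
  push_cast
  rw [Real.norm_eq_abs]
  gcongr
  rw [← NNReal.coe_mk (∑ i ∈ Finset.range p.natDegree, |(p.coeff i).1 x|)
    (Finset.sum_nonneg fun _ _ => abs_nonneg _), NNReal.coe_le_coe]
  refine Finset.sup_le fun i hi => ?_
  rw [← NNReal.coe_le_coe, coe_nnnorm, NNReal.coe_mk, coeff_map, Real.norm_eq_abs]
  exact Finset.single_le_sum (f := fun i => |(p.coeff i).1 x|) (fun _ _ => abs_nonneg _) hi

omit [NormedSpace ℝ E] in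
theorem eventually_exists_zero {g : E × ℝ → ℝ} (hg : Continuous g) {x₀ : E} {y₀ : ℝ}
    (h0 : g (x₀, y₀) = 0) (hd : deriv (fun y => g (x₀, y)) y₀ ≠ 0) {ε : ℝ} (hε : 0 < ε) :
    ∀ᶠ x in 𝓝 x₀, ∃ y, |y - y₀| < ε ∧ g (x, y) = 0 := by
  wlog hpos : 0 < deriv (fun y => g (x₀, y)) y₀ generalizing g
  · have := this hg.neg (by simp [h0]) (by simpa [deriv.fun_neg] using hd)
      (by
        rw [show (fun y => (-g) (x₀, y)) = fun y => - g (x₀, y) from rfl, deriv.fun_neg]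
        have := lt_of_le_of_ne (not_lt.1 hpos) hd
        linarith)
    simpa using this
  have hs := eventually_nhdsWithin_sign_eq_of_deriv_pos hpos h0
  obtain ⟨δ, hδ, hs⟩ := Metric.eventually_nhds_iff.1 hs
  set r := min δ ε / 2 with hr
  have hr0 : 0 < r := by positivity
  have hrδ : r < δ := by
    have := min_le_left δ ε
    have : 0 < min δ ε := by positivity
    linarith
  have hrε : r < ε := by
    have := min_le_right δ ε
    have : 0 < min δ ε := by positivity
    linarith
  have hlo : g (x₀, y₀ - r) < 0 := by
    have := hs (y := y₀ - r) (by simpa [Real.dist_eq, abs_of_pos hr0])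
    rw [sub_sub_cancel_left, sign_neg (neg_neg_of_pos hr0), sign_eq_neg_one_iff] at this
    exact this
  have hhi : 0 < g (x₀, y₀ + r) := by
    have := hs (y := y₀ + r) (by simpa [Real.dist_eq, abs_of_pos hr0])
    rw [add_sub_cancel_left, sign_pos hr0, sign_eq_one_iff] at this
    exact this
  have e1 : ∀ᶠ x in 𝓝 x₀, g (x, y₀ - r) < 0 :=
    (hg.comp (continuous_id.prodMk continuous_const)).continuousAt.eventually_lt_const hlo
  have e2 : ∀ᶠ x in 𝓝 x₀, 0 < g (x, y₀ + r) :=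
    (hg.comp (continuous_id.prodMk continuous_const)).continuousAt.eventually_const_lt hhi
  filter_upwards [e1, e2] with x h1 h2
  have hc : ContinuousOn (fun y => g (x, y)) (Icc (y₀ - r) (y₀ + r)) :=
    (hg.comp (continuous_const.prodMk continuous_id)).continuousOn
  obtain ⟨y, hy, hy0⟩ := intermediate_value_Icc (by linarith) hc ⟨h1.le, h2.le⟩
  refine ⟨y, ?_, hy0⟩
  rw [abs_lt]
  exact ⟨by linarith [hy.1], by linarith [hy.2]⟩

variable [FiniteDimensional ℝ E]

theorem isSections_familyRoots {Q : Finset (polyFun E)[X]} (hQ : ∀ p ∈ Q, IsQuasiMonic p)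
    (hder : ∀ p ∈ Q, 0 < p.natDegree → p.derivative ∈ Q) : IsSections (familyRoots Q) where
  card_le := by
    refine ⟨∑ p ∈ Q, p.natDegree, fun x => ?_⟩
    refine (Multiset.toFinset_card_le _).trans ?_
    rw [Multiset.card_bind]
    refine Finset.sum_le_sum fun p hp => ?_
    exact (card_roots' _).trans ((hQ p hp).natDegree_map x).le
  isClosed := by
    have : {p : E × ℝ | p.2 ∈ familyRoots Q p.1} =
        ⋃ q ∈ Q, {p : E × ℝ | (q.map (evalPoly p.1)).eval p.2 = 0} := by
      ext p
      simp [mem_familyRoots hQ]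
    rw [this]
    exact isClosed_biUnion_finset fun q _ => isClosed_eq
      (continuous_of_mem_polyFun (eval_map_mem_polyFun q)) continuous_const
  bounded := by
    intro x₀
    let B : E → ℝ := fun x => ∑ p ∈ Q,
      ((∑ i ∈ Finset.range p.natDegree, |(p.coeff i).1 x|) / |p.leadingCoeff.1 0| + 1)
    have hB : Continuous B := continuous_finsetSum _ fun p _ =>
      ((continuous_finsetSum _ fun i _ =>
        (continuous_of_mem_polyFun (p.coeff i).2).abs).div_const _).add continuous_const
    refine ⟨B x₀ + 1, ?_⟩
    filter_upwards [hB.continuousAt.eventually_lt_const (lt_add_one (B x₀))] with x hx y hy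
    obtain ⟨p, hp, hy⟩ := (mem_familyRoots hQ).1 hy
    refine (abs_root_le (hQ p hp) hy).trans (le_trans ?_ hx.le)
    exact Finset.single_le_sum (f := fun p => (∑ i ∈ Finset.range p.natDegree,
      |(p.coeff i).1 x|) / |p.leadingCoeff.1 0| + 1) (fun _ _ => by positivity) hp
  lower := by
    intro x₀ y₀ hy₀ ε hε
    obtain ⟨p, ⟨hp, hpz⟩, hmin⟩ := exists_minimalFor_of_wellFoundedLT
      (fun p : (polyFun E)[X] => p ∈ Q ∧ (p.map (evalPoly x₀)).eval y₀ = 0)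
      natDegree ((mem_familyRoots hQ).1 hy₀)
    have hpos : 0 < p.natDegree := by
      rw [Nat.pos_iff_ne_zero]
      intro h0
      have h1 := (hQ p hp).leadingCoeff_map x₀
      rw [eq_C_of_natDegree_eq_zero h0, map_C, eval_C] at hpz
      rw [leadingCoeff, h0] at h1
      exact h1 hpz
    have hd : (p.derivative.map (evalPoly x₀)).eval y₀ ≠ 0 := by
      intro h0
      have h1 := ((hQ p hp).derivative hpos).2
      have := hmin ⟨hder p hp hpos, h0⟩ h1.le
      omega
    have := eventually_exists_zero (continuous_of_mem_polyFun (eval_map_mem_polyFun p)) hpz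
      (by simpa [← derivative_map] using hd) hε
    filter_upwards [this] with x hx
    obtain ⟨y, hy, hy0⟩ := hx
    exact ⟨y, (mem_familyRoots hQ).2 ⟨p, hp, hy0⟩, hy⟩
  sa := by
    simp only [mem_familyRoots hQ]
    exact SA.exists_mem Q.finite_toSet fun p _ => SA.zero (eval_map_mem_polyFun p)

theorem exists_isSections [Nontrivial E] {𝒜 : Set (Set E)} (h𝒜 : 𝒜.Finite)
    (hSA : ∀ A ∈ 𝒜, SA A) : ∃ (W : Submodule ℝ E) (e : (W × ℝ) ≃L[ℝ] E),
      Module.finrank ℝ W < Module.finrank ℝ E ∧ ∀ M : ℝ, ∃ Z : W → Finset ℝ,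
      IsSections Z ∧ (∀ x, M ∈ Z x ∧ -M ∈ Z x) ∧
      ∀ A ∈ 𝒜, ∀ x a b, (∀ y ∈ uIcc a b, y ∉ Z x) → e (x, a) ∈ A → e (x, b) ∈ A := by
  classical
  choose! D hDf hDp hD using hSA
  obtain ⟨v, hv, hdir⟩ := exists_direction (h𝒜.biUnion hDf) (iUnion₂_subset hDp)
  obtain ⟨W, hW⟩ := Submodule.exists_isCompl (ℝ ∙ v)
  have hfin : Module.finrank ℝ W < Module.finrank ℝ E := by
    have h1 := Submodule.finrank_add_eq_of_isCompl hW
    rw [finrank_span_singleton hv] at h1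
    omega
  let e : (W × ℝ) ≃L[ℝ] E := (((LinearEquiv.refl ℝ W).prodCongr
    (LinearEquiv.toSpanNonzeroSingleton ℝ E v hv)).trans
    (Submodule.prodEquivOfIsCompl W (ℝ ∙ v) hW.symm)).toContinuousLinearEquiv
  have he : ∀ x t, e (x, t) = x + t • v := fun x t => rfl
  choose! p hpm hp using fun f hf h0 => hdir f hf h0 W
  refine ⟨W, e, hfin, fun M => ?_⟩
  let D' : Finset (E → ℝ) := (h𝒜.biUnion hDf).toFinset.filter (· ≠ 0)
  obtain ⟨Q, hPQ, hQ, hder⟩ := exists_derivative_closed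
    (insert (X - C (algebraMap ℝ (polyFun W) M)) (insert (X - C (algebraMap ℝ (polyFun W) (-M)))
      (D'.image p))) (by
      intro q hq
      simp only [Finset.mem_insert, Finset.mem_image] at hq
      rcases hq with rfl | rfl | ⟨f, hf, rfl⟩
      · exact isQuasiMonic_X_sub_C _
      · exact isQuasiMonic_X_sub_C _
      · rw [Finset.mem_filter, Set.Finite.mem_toFinset] at hf
        exact hpm f hf.1 hf.2)
  refine ⟨familyRoots Q, isSections_familyRoots hQ hder, fun x => ⟨?_, ?_⟩, ?_⟩
  · refine (mem_familyRoots hQ).2 ⟨_, hPQ (Finset.mem_insert_self _ _), ?_⟩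
    simp [evalPoly_apply]
  · refine (mem_familyRoots hQ).2 ⟨_, hPQ (Finset.mem_insert_of_mem (Finset.mem_insert_self _ _)), ?_⟩
    simp [evalPoly_apply]
  · intro A hA x a b hab
    refine hD A hA _ _ fun f hf => ?_
    by_cases h0 : f = 0
    · simp [h0]
    have hf' : f ∈ ⋃ A ∈ 𝒜, D A := mem_biUnion hA hf
    rw [he, he, hp f hf' h0, hp f hf' h0]
    have hpQ : p f ∈ Q := hPQ <| Finset.mem_insert_of_mem <| Finset.mem_insert_of_mem <|
      Finset.mem_image_of_mem p <| Finset.mem_filter.2 ⟨(Set.Finite.mem_toFinset _).2 hf', h0⟩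
    refine (sign_eq_of_mem_sideSet (Z := {y | ((p f).map (evalPoly x)).eval y = 0})
      ((p f).map (evalPoly x)).continuous (fun w hw => hw) ?_).symm
    intro y hy0
    have hy : y ∉ uIcc a b := fun hy => hab y hy ((mem_familyRoots hQ).2 ⟨_, hpQ, hy0⟩)
    exact lt_iff_lt_of_notMem_uIcc hy

end Family

section Cells

theorem setOf_lt_subset_le {α : Type*} {r : α → ℝ} : {v | r v < 1} ⊆ {v | r v ≤ 1} :=
  fun v (hv : r v < 1) => hv.le

variable {V E : Type} [NormedAddCommGroup V] [NormedSpace ℝ V]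
  [NormedAddCommGroup E] [NormedSpace ℝ E]

/-- A continuous semialgebraic nonnegative function that is positively homogeneous and vanishes
only at the origin. -/
structure IsGauge (r : V → ℝ) : Prop where
  continuous : Continuous r
  saFun : SAfun r
  nonneg : ∀ v, 0 ≤ r v
  eq_zero : ∀ v, r v = 0 → v = 0
  smul : ∀ t, 0 ≤ t → ∀ v, r (t • v) = t * r v

namespace IsGauge

variable {r : V → ℝ} (hr : IsGauge r)
include hr

theorem map_zero : r 0 = 0 := by
  have := hr.smul 0 le_rfl 0
  simpa using this

theorem inv_smul {v : V} (hv : v ≠ 0) : r ((r v)⁻¹ • v) = 1 := by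
  rw [hr.smul _ (inv_nonneg.2 (hr.nonneg v)), inv_mul_cancel₀ fun h => hv (hr.eq_zero v h)]

theorem inv_smul_le (v : V) : r ((r v)⁻¹ • v) ≤ 1 := by
  rcases eq_or_ne v 0 with rfl | hv
  · simp [hr.map_zero]
  · exact (hr.inv_smul hv).le

theorem isCompact_le [FiniteDimensional ℝ V] (c : ℝ) : IsCompact {v | r v ≤ c} := by
  refine Metric.isCompact_of_isClosed_isBounded (isClosed_le hr.continuous continuous_const) ?_
  rcases subsingleton_or_nontrivial V with hV | hV
  · exact (Set.toFinite _).isBounded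
  obtain ⟨v₀, hv₀, hmin⟩ := (isCompact_sphere (0 : V) 1).exists_isMinOn
    (NormedSpace.sphere_nonempty.2 zero_le_one) hr.continuous.continuousOn
  have hpos : 0 < r v₀ := by
    refine lt_of_le_of_ne (hr.nonneg _) fun h => ?_
    have := hr.eq_zero v₀ h.symm
    simp [this] at hv₀
  refine (Metric.isBounded_closedBall (x := (0 : V)) (r := c / r v₀)).subset fun v hv => ?_
  rw [mem_closedBall_zero_iff, le_div_iff₀ hpos]
  rcases eq_or_ne v 0 with rfl | hv0
  · simpa [hr.map_zero] using hv
  have h1 : ‖v‖⁻¹ • v ∈ Metric.sphere (0 : V) 1 := by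
    simp [norm_smul, hv0]
  have h2 := hmin h1
  rw [mem_ofPred_eq, hr.smul _ (by positivity)] at h2
  have h3 : 0 < ‖v‖ := norm_pos_iff.2 hv0
  calc ‖v‖ * r v₀ ≤ ‖v‖ * (‖v‖⁻¹ * r v) := by gcongr
    _ = r v := by field_simp
    _ ≤ c := hv

theorem isOpen_lt : IsOpen {v | r v < 1} := _root_.isOpen_lt hr.continuous continuous_const

theorem smul_lt {v : V} (hv : r v ≤ 1) {t : ℝ} (h0 : 0 ≤ t) (h1 : t < 1) : r (t • v) < 1 := by
  rw [hr.smul t h0]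
  nlinarith [hr.nonneg v]

theorem smul_lt' {v : V} (hv : r v < 1) {t : ℝ} (h0 : 0 ≤ t) (h1 : t ≤ 1) : r (t • v) < 1 := by
  rw [hr.smul t h0]
  nlinarith [hr.nonneg v]

theorem tendsto_smul {v : V} (hv : r v ≤ 1) :
    Tendsto (fun t : ℝ => t • v) (𝓝[<] 1) (𝓝[{v | r v < 1}] v) := by
  refine tendsto_nhdsWithin_iff.2 ⟨?_, ?_⟩
  · have : Tendsto (fun t : ℝ => t • v) (𝓝 1) (𝓝 ((1 : ℝ) • v)) :=
      (continuous_id.smul continuous_const).tendsto _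
    rw [one_smul] at this
    exact this.mono_left nhdsWithin_le_nhds
  · have h0 : ∀ᶠ t : ℝ in 𝓝[<] 1, 0 < t := nhdsWithin_le_nhds (lt_mem_nhds one_pos)
    filter_upwards [h0, self_mem_nhdsWithin] with t h0 h1
    exact hr.smul_lt hv h0.le h1

theorem neBot {v : V} (hv : r v ≤ 1) : (𝓝[{v | r v < 1}] v).NeBot :=
  (hr.tendsto_smul hv).neBot

theorem closure_lt : closure {v | r v < 1} = {v | r v ≤ 1} := by
  refine Subset.antisymm (closure_lt_subset_le hr.continuous continuous_const) fun v hv => ?_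
  rw [mem_closure_iff_nhdsWithin_neBot]
  exact hr.neBot hv

theorem isPreconnected_lt : IsPreconnected {v | r v < 1} := by
  refine isPreconnected_of_forall (0 : V) fun v hv => ⟨segment ℝ 0 v, ?_, left_mem_segment _ _ _,
    right_mem_segment _ _ _, (convex_segment _ _).isPreconnected⟩
  rw [segment_eq_image]
  rintro _ ⟨t, ht, rfl⟩
  simp only [smul_zero, zero_add]
  exact hr.smul_lt' hv ht.1 ht.2

/-- The open unit set of a gauge is locally connected along its boundary. -/
theorem exists_isPreconnected {v₀ : V} (hv₀ : r v₀ ≤ 1) {U : Set V} (hU : U ∈ 𝓝 v₀) :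
    ∃ p, ∀ᶠ v in 𝓝[{v | r v < 1}] v₀, ∃ T, IsPreconnected T ∧ p ∈ T ∧ v ∈ T ∧
      T ⊆ {v | r v < 1} ∩ U := by
  obtain ⟨ρ, hρ, hUρ⟩ := Metric.mem_nhds_iff.1 hU
  have hc := (hr.tendsto_smul hv₀).eventually
    (inter_mem self_mem_nhdsWithin (nhdsWithin_le_nhds (Metric.ball_mem_nhds v₀ hρ)))
  have h0 : ∀ᶠ t : ℝ in 𝓝[<] 1, 0 < t := nhdsWithin_le_nhds (lt_mem_nhds one_pos)
  obtain ⟨t, ⟨ht, htρ⟩, ht0, ht1⟩ := (hc.and (h0.and self_mem_nhdsWithin)).exists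
  have hopen := hr.isOpen_lt.inter (Metric.isOpen_ball (x := v₀) (ε := ρ))
  obtain ⟨δ, hδ, hball⟩ := Metric.isOpen_iff.1 hopen _ ⟨ht, htρ⟩
  refine ⟨t • v₀, ?_⟩
  have hcont : Tendsto (fun v : V => t • v) (𝓝[{v | r v < 1}] v₀) (𝓝 (t • v₀)) :=
    ((continuous_const_smul t).tendsto v₀).mono_left nhdsWithin_le_nhds
  filter_upwards [self_mem_nhdsWithin, nhdsWithin_le_nhds (Metric.ball_mem_nhds v₀ hρ),
    hcont (Metric.ball_mem_nhds _ hδ)] with v hv hvρ htv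
  refine ⟨segment ℝ (t • v₀) (t • v) ∪ segment ℝ (t • v) v,
    IsPreconnected.union (t • v) (right_mem_segment _ _ _) (left_mem_segment _ _ _)
      (convex_segment _ _).isPreconnected (convex_segment _ _).isPreconnected,
    Or.inl (left_mem_segment _ _ _), Or.inr (right_mem_segment _ _ _), ?_⟩
  refine Subset.trans ?_ (inter_subset_inter_right _ hUρ)
  refine union_subset ?_ (subset_inter ?_ ?_)
  · exact ((convex_ball _ _).segment_subset (Metric.mem_ball_self hδ) htv).trans hball
  · rw [segment_eq_image]
    rintro _ ⟨s, hs, rfl⟩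
    simp only [smul_smul, ← add_smul]
    refine hr.smul_lt' hv ?_ ?_ <;> nlinarith [hs.1, hs.2]
  · exact (convex_ball _ _).segment_subset (hball htv).2 hvρ

end IsGauge

/-- A parametrised closed semialgebraic cell. -/
structure IsChart (r : V → ℝ) (φ : V → E) : Prop where
  gauge : IsGauge r
  saFun : SAfun φ
  continuousOn : ContinuousOn φ {v | r v ≤ 1}
  injOn : InjOn φ {v | r v ≤ 1}

namespace IsChart

variable {r : V → ℝ} {φ : V → E} (h : IsChart r φ)
include h

theorem nonempty : (φ '' {v | r v < 1}).Nonempty :=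
  ⟨φ 0, 0, by simp [h.gauge.map_zero], rfl⟩

theorem isPreconnected : IsPreconnected (φ '' {v | r v < 1}) :=
  h.gauge.isPreconnected_lt.image _ (h.continuousOn.mono setOf_lt_subset_le)

variable [FiniteDimensional ℝ V]

theorem isCompact : IsCompact (φ '' {v | r v ≤ 1}) :=
  (h.gauge.isCompact_le 1).image_of_continuousOn h.continuousOn

theorem closure_image : closure (φ '' {v | r v < 1}) = φ '' {v | r v ≤ 1} := by
  refine Subset.antisymm
    (closure_minimal (image_mono setOf_lt_subset_le) h.isCompact.isClosed) ?_
  rw [← h.gauge.closure_lt]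
  refine ContinuousOn.image_closure ?_
  rw [h.gauge.closure_lt]
  exact h.continuousOn

theorem continuousOn_of_comp {X : Type*} [TopologicalSpace X] {g : E → X}
    (hg : ContinuousOn (fun v => g (φ v)) {v | r v ≤ 1}) :
    ContinuousOn g (φ '' {v | r v ≤ 1}) := by
  rw [continuousOn_iff_isClosed]
  intro t ht
  have hD := h.gauge.isCompact_le 1
  refine ⟨φ '' ({v | r v ≤ 1} ∩ (fun v => g (φ v)) ⁻¹' t), ?_, ?_⟩
  · refine IsCompact.isClosed (IsCompact.image_of_continuousOn ?_
      (h.continuousOn.mono inter_subset_left))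
    exact hD.of_isClosed_subset (hg.preimage_isClosed_of_isClosed hD.isClosed ht)
      inter_subset_left
  · ext x
    constructor
    · rintro ⟨hx, v, hv, rfl⟩
      exact ⟨⟨v, ⟨hv, hx⟩, rfl⟩, v, hv, rfl⟩
    · rintro ⟨⟨v, ⟨hv, hx⟩, rfl⟩, hx'⟩
      exact ⟨hx, hx'⟩

end IsChart

/-- The image of the open unit set of a gauge under a chart. -/
def IsCell (C : Set E) : Prop :=
  ∃ (V : Type) (_ : NormedAddCommGroup V) (_ : NormedSpace ℝ V) (_ : FiniteDimensional ℝ V)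
    (r : V → ℝ) (φ : V → E), IsChart r φ ∧ φ '' {v | r v < 1} = C

/-- A finite family of disjoint cells satisfying the frontier condition. -/
structure IsCellComplex (𝒞 : Set (Set E)) : Prop where
  finite : 𝒞.Finite
  isCell : ∀ C ∈ 𝒞, IsCell C
  eq_of_mem : ∀ C ∈ 𝒞, ∀ C' ∈ 𝒞, ∀ x ∈ C, x ∈ C' → C = C'
  frontier : ∀ C ∈ 𝒞, ∀ x ∈ closure C, ∃ C' ∈ 𝒞, x ∈ C' ∧ C' ⊆ closure C

theorem IsCell.nonempty {C : Set E} (hC : IsCell C) : C.Nonempty := by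
  obtain ⟨V, _, _, _, r, φ, h, rfl⟩ := hC
  exact h.nonempty

theorem IsCell.isPreconnected {C : Set E} (hC : IsCell C) : IsPreconnected C := by
  obtain ⟨V, _, _, _, r, φ, h, rfl⟩ := hC
  exact h.isPreconnected

variable {F : Type} [NormedAddCommGroup F] [NormedSpace ℝ F] [FiniteDimensional ℝ F]

theorem IsCell.image [FiniteDimensional ℝ E] {C : Set E} (hC : IsCell C) (e : E ≃L[ℝ] F) :
    IsCell (e '' C) := by
  obtain ⟨V, _, _, _, r, φ, h, rfl⟩ := hC
  refine ⟨V, _, _, ‹_›, r, e ∘ φ, ⟨h.gauge, ?_, ?_, ?_⟩, image_comp _ _ _⟩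
  · exact (SAfun.clinear e.toContinuousLinearMap).comp (g := e) h.saFun
  · exact e.continuous.comp_continuousOn h.continuousOn
  · exact e.injective.comp_injOn h.injOn

theorem IsCellComplex.image [FiniteDimensional ℝ E] {𝒞 : Set (Set E)} (h𝒞 : IsCellComplex 𝒞)
    (e : E ≃L[ℝ] F) : IsCellComplex ((fun C => e '' C) '' 𝒞) where
  finite := h𝒞.finite.image _
  isCell := by
    rintro _ ⟨C, hC, rfl⟩
    exact (h𝒞.isCell C hC).image e
  eq_of_mem := by
    rintro _ ⟨C, hC, rfl⟩ _ ⟨C', hC', rfl⟩ _ ⟨x, hx, rfl⟩ ⟨y, hy, hxy⟩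
    rw [e.injective hxy] at hy
    rw [h𝒞.eq_of_mem C hC C' hC' x hx hy]
  frontier := by
    rintro _ ⟨C, hC, rfl⟩ x hx
    rw [← e.image_closure] at hx ⊢
    obtain ⟨x, hx, rfl⟩ := hx
    obtain ⟨C', hC', hxC, hCC⟩ := h𝒞.frontier C hC x hx
    exact ⟨_, ⟨C', hC', rfl⟩, mem_image_of_mem _ hxC, image_mono hCC⟩

end Cells

section Extension

variable {V E : Type} [NormedAddCommGroup V] [NormedSpace ℝ V] [FiniteDimensional ℝ V]
  [NormedAddCommGroup E] [NormedSpace ℝ E] [FiniteDimensional ℝ E]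

theorem SA.tendsto_smul {u : V → ℝ} (hu : SAfun u) :
    SA {p : V × ℝ | Tendsto (fun t : ℝ => u (t • p.1)) (𝓝[<] 1) (𝓝 p.2)} := by
  have key : ∀ p : V × ℝ, Tendsto (fun t : ℝ => u (t • p.1)) (𝓝[<] 1) (𝓝 p.2) ↔
      ∀ ε : ℝ, 0 < ε → ∃ δ : ℝ, δ < 1 ∧ ∀ t : ℝ, δ < t → t < 1 → |u (t • p.1) - p.2| < ε := by
    intro p
    rw [Metric.tendsto_nhds]
    refine forall₂_congr fun ε hε => ?_
    rw [Filter.Eventually, mem_nhdsLT_iff_exists_Ioo_subset]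
    simp only [mem_Iio, subset_def, mem_Ioo, mem_ofPred_eq, Real.dist_eq, and_imp]
  simp only [key]
  refine SA.forall (P := fun (p : V × ℝ) (ε : ℝ) => 0 < ε → ∃ δ : ℝ, δ < 1 ∧
    ∀ t : ℝ, δ < t → t < 1 → |u (t • p.1) - p.2| < ε) ?_
  refine SA.imp (SA.lt (by fun_prop) (by fun_prop)) ?_
  refine SA.exists (P := fun (p : (V × ℝ) × ℝ) (δ : ℝ) => δ < 1 ∧
    ∀ t : ℝ, δ < t → t < 1 → |u (t • p.1.1) - p.1.2| < p.2) ?_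
  refine SA.and (SA.lt (by fun_prop) (by fun_prop)) ?_
  refine SA.forall (P := fun (p : ((V × ℝ) × ℝ) × ℝ) (t : ℝ) => p.2 < t → t < 1 →
    |u (t • p.1.1.1) - p.1.1.2| < p.1.2) ?_
  exact SA.imp (SA.lt (by fun_prop) (by fun_prop)) <|
    SA.imp (SA.lt (by fun_prop) (by fun_prop)) (SA.lt (by fun_prop) (by fun_prop))

theorem IsPreconnected.lt_of_forall_ne {X : Type*} [TopologicalSpace X] {T : Set X}
    (hT : IsPreconnected T) {g : X → ℝ} (hg : ContinuousOn g T) {c : ℝ} (hc : ∀ x ∈ T, g x ≠ c)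
    {a b : X} (ha : a ∈ T) (hb : b ∈ T) (h : g a < c) : g b < c := by
  by_contra! hbc
  obtain ⟨x, hx, hxc⟩ := hT.intermediate_value ha hb hg ⟨h.le, hbc⟩
  exact hc x hx hxc

omit [FiniteDimensional ℝ V] [FiniteDimensional ℝ E] in
theorem IsSections.exists_tendsto {Z : E → Finset ℝ} (hZ : IsSections Z) {r : V → ℝ} {φ : V → E}
    (h : IsChart r φ) {u : V → ℝ} (hu : ContinuousOn u {v | r v < 1})
    (huZ : ∀ v, r v < 1 → u v ∈ Z (φ v)) {v₀ : V} (hv₀ : r v₀ ≤ 1) :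
    ∃ z ∈ Z (φ v₀), Tendsto u (𝓝[{v | r v < 1}] v₀) (𝓝 z) := by
  have hne := h.gauge.neBot hv₀
  have hφ : Tendsto φ (𝓝[{v | r v < 1}] v₀) (𝓝 (φ v₀)) :=
    (h.continuousOn v₀ hv₀).mono_left (nhdsWithin_mono _ setOf_lt_subset_le)
  have hmem : ∀ᶠ v in 𝓝[{v | r v < 1}] v₀, u v ∈ Z (φ v) := by
    filter_upwards [self_mem_nhdsWithin] with v hv using huZ v hv
  obtain ⟨M, hM⟩ := hZ.bounded (φ v₀)
  have hIcc : ∀ᶠ v in 𝓝[{v | r v < 1}] v₀, u v ∈ Icc (-M) M := by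
    filter_upwards [hmem, hφ.eventually hM] with v h1 h2 using abs_le.1 (h2 _ h1)
  obtain ⟨z, -, hz⟩ := isCompact_Icc.exists_mapClusterPt (f := 𝓝[{v | r v < 1}] v₀) (u := u)
    (tendsto_principal.2 hIcc)
  have hzZ : z ∈ Z (φ v₀) := by
    obtain ⟨U, hU, hUz⟩ := mapClusterPt_iff_ultrafilter.1 hz
    have hm : ∀ᶠ v in (U : Filter V), (φ v, u v) ∈ {p : E × ℝ | p.2 ∈ Z p.1} := hU hmem
    exact hZ.isClosed.mem_of_tendsto ((hφ.mono_left hU).prodMk_nhds hUz) hm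
  refine ⟨z, hzZ, Metric.tendsto_nhds.2 fun ε hε => ?_⟩
  have hne : ∀ w ∉ Z (φ v₀), ∀ᶠ v in 𝓝[{v | r v < 1}] v₀, u v ≠ w := by
    intro w hw
    have hop : IsOpen {x | w ∉ Z x} := by
      have := hZ.isClosed.isOpen_compl.preimage (f := fun x : E => (x, w)) (by fun_prop)
      exact this
    filter_upwards [hmem, hφ.eventually (hop.mem_nhds hw)] with v h1 h2 h3
    exact h2 (h3 ▸ h1)
  obtain ⟨c, ⟨hc0, hcε⟩, hc⟩ := (Ioo_infinite hε).exists_notMem_finset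
    ((Z (φ v₀)).image (fun y => y - z) ∪ (Z (φ v₀)).image (fun y => z - y))
  simp only [Finset.mem_union, Finset.mem_image, not_or, not_exists, not_and] at hc
  have hnec : ∀ᶠ v in 𝓝[{v | r v < 1}] v₀, |u v - z| ≠ c := by
    filter_upwards [hne (z + c) (fun hw => hc.1 _ hw (by ring)),
      hne (z - c) (fun hw => hc.2 _ hw (by ring))] with v h1 h2 h3
    rcases abs_cases (u v - z) with h4 | h4
    · exact h1 (by linarith)
    · exact h2 (by linarith)
  obtain ⟨U, hU, hUc⟩ := mem_nhdsWithin_iff_exists_mem_nhds_inter.1 hnec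
  obtain ⟨p, hp⟩ := h.gauge.exists_isPreconnected hv₀ hU
  have hfreq : ∃ᶠ v in 𝓝[{v | r v < 1}] v₀, |u v - z| < c :=
    mapClusterPt_iff_frequently.1 hz _ (Metric.ball_mem_nhds z hc0)
  have hcont : ContinuousOn (fun v => |u v - z|) {v | r v < 1} :=
    (hu.sub continuousOn_const).abs
  have hpc : |u p - z| < c := by
    obtain ⟨v, hv, T, hT, hpT, hvT, hTU⟩ := (hfreq.and_eventually hp).exists
    exact hT.lt_of_forall_ne (hcont.mono (hTU.trans inter_subset_left))
      (fun x hx => hUc ((inter_comm _ _).subset (hTU hx))) hvT hpT hv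
  filter_upwards [hp] with v ⟨T, hT, hpT, hvT, hTU⟩
  exact (hT.lt_of_forall_ne (hcont.mono (hTU.trans inter_subset_left))
    (fun x hx => hUc ((inter_comm _ _).subset (hTU hx))) hpT hvT hpc).trans hcε

open scoped Classical in
theorem IsSections.exists_extension {Z : E → Finset ℝ} (hZ : IsSections Z) {r : V → ℝ} {φ : V → E}
    (h : IsChart r φ) {k : ℕ} (hk : ∀ v, r v < 1 → (Z (φ v)).card = k) {j : ℕ} (hj : j < k) :
    ∃ u : V → ℝ, SAfun u ∧ ContinuousOn u {v | r v ≤ 1} ∧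
      (∀ v, r v < 1 → u v = nthElem (Z (φ v)) j) ∧ ∀ v, r v ≤ 1 → u v ∈ Z (φ v) := by
  have hcont : ContinuousOn (fun v => nthElem (Z (φ v)) j) {v | r v < 1} :=
    (hZ.continuousOn_nthElem (C := φ '' {v | r v < 1}) (k := k)
      (by rintro _ ⟨v, hv, rfl⟩; exact hk v hv) hj).comp
      (h.continuousOn.mono setOf_lt_subset_le) (mapsTo_image _ _)
  have hsa : SAfun (fun v => nthElem (Z (φ v)) j) := (hZ.saFun_nthElem j).comp h.saFun
  have hlim := fun v (hv : r v ≤ 1) => hZ.exists_tendsto h hcont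
    (fun v hv => nthElem_mem (by rwa [hk v hv])) hv
  choose! w hwZ hw using hlim
  refine ⟨fun v => if r v ≤ 1 then w v else 0, ?_, ?_, ?_, ?_⟩
  · have h1 : SA {p : V × ℝ | r p.1 ≤ 1} :=
      SA.le (h.gauge.saFun.comp (f := Prod.fst) (by fun_prop)) (by fun_prop)
    have h2 := (h1.and (SA.tendsto_smul hsa)).or
      (h1.not.and (SA.eq (f := fun p : V × ℝ => p.2) (g := fun _ => 0) (by fun_prop)
        (by fun_prop)))
    unfold SAfun
    convert h2 using 2
    ext ⟨v, y⟩
    by_cases hv : r v ≤ 1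
    · simp only [hv, if_true, true_and, not_true, false_and, or_false]
      have := (hw v hv).comp (h.gauge.tendsto_smul hv)
      constructor
      · rintro rfl
        exact this
      · intro h3
        exact tendsto_nhds_unique h3 this
    · simp [hv]
  · have := continuousOn_extendFrom (A := {v | r v < 1}) (B := {v | r v ≤ 1})
      h.gauge.closure_lt.ge (fun v hv => ⟨w v, hw v hv⟩)
    refine this.congr fun v (hv : r v ≤ 1) => ?_
    have hne := h.gauge.neBot hv
    simp only [hv, if_true]
    exact (extendFrom_eq (h.gauge.closure_lt.ge hv) (hw v hv)).symm
  · intro v hv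
    have hne := h.gauge.neBot hv.le
    simp only [hv.le, if_true]
    exact tendsto_nhds_unique (hw v hv.le) (hcont v hv)
  · intro v hv
    simp only [hv, if_true]
    exact hwZ v hv

end Extension

section Band

variable {V E : Type} [NormedAddCommGroup V] [NormedSpace ℝ V]

theorem IsChart.graph [NormedAddCommGroup E] [NormedSpace ℝ E] {r : V → ℝ} {φ : V → E}
    (h : IsChart r φ) {α : V → ℝ} (hα : SAfun α)
    (hαc : ContinuousOn α {v | r v ≤ 1}) : IsChart r (fun v => (φ v, α v)) where
  gauge := h.gauge
  saFun := h.saFun.prodMk hα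
  continuousOn := h.continuousOn.prodMk hαc
  injOn := fun _ hv _ hw hvw => h.injOn hv hw (congrArg Prod.fst hvw)

/-- The positively homogeneous extension of `1 - ρ` from the unit sphere of a gauge. -/
noncomputable def sphericalDefect (r ρ : V → ℝ) (v : V) : ℝ := r v * (1 - ρ ((r v)⁻¹ • v))

section SphericalDefect

variable {r ρ : V → ℝ}

theorem sphericalDefect_smul (hr : IsGauge r) {t : ℝ} (ht : 0 ≤ t) (v : V) :
    sphericalDefect r ρ (t • v) = t * sphericalDefect r ρ v := by
  rcases ht.eq_or_lt with rfl | ht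
  · simp [sphericalDefect, hr.map_zero]
  · rw [sphericalDefect, sphericalDefect, hr.smul t ht.le, smul_smul, mul_inv,
      mul_comm t⁻¹, mul_assoc (r v)⁻¹, inv_mul_cancel₀ ht.ne', mul_one]
    ring

theorem sphericalDefect_le (hr : IsGauge r) (hρ : ∀ v, r v ≤ 1 → 0 ≤ ρ v) (v : V) :
    sphericalDefect r ρ v ≤ r v := by
  have := hρ _ (hr.inv_smul_le v)
  rw [sphericalDefect]
  nlinarith [hr.nonneg v]

theorem sphericalDefect_of_eq_one {v : V} (hv : r v = 1) :
    sphericalDefect r ρ v = 1 - ρ v := by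
  simp [sphericalDefect, hv]

theorem continuous_sphericalDefect [FiniteDimensional ℝ V] (hr : IsGauge r)
    (hρ : ContinuousOn ρ {v | r v ≤ 1}) :
    Continuous (sphericalDefect r ρ) := by
  obtain ⟨K, hK⟩ := (hr.isCompact_le 1).exists_bound_of_continuousOn
    (continuousOn_const (c := (1 : ℝ)).sub hρ)
  refine continuous_iff_continuousAt.2 fun v => ?_
  rcases eq_or_ne v 0 with rfl | hv
  · have h0 : sphericalDefect r ρ 0 = 0 := by simp [sphericalDefect, hr.map_zero]
    rw [ContinuousAt, h0]
    refine squeeze_zero_norm (a := fun v => r v * K) (fun v => ?_) ?_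
    · rw [sphericalDefect, norm_mul, Real.norm_of_nonneg (hr.nonneg v)]
      exact mul_le_mul_of_nonneg_left (hK _ (hr.inv_smul_le v)) (hr.nonneg v)
    · have : Tendsto (fun v => r v * K) (𝓝 0) (𝓝 (r 0 * K)) :=
        (hr.continuous.mul (continuous_const (y := K))).tendsto (0 : V)
      rwa [hr.map_zero, zero_mul] at this
  · have hrv : r v ≠ 0 := fun h => hv (hr.eq_zero v h)
    have h1 : ContinuousAt (fun v => (r v)⁻¹ • v) v :=
      (hr.continuous.continuousAt.inv₀ hrv).smul continuousAt_id
    have h2 : Tendsto (fun v => (r v)⁻¹ • v) (𝓝 v) (𝓝[{v | r v ≤ 1}] ((r v)⁻¹ • v)) :=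
      tendsto_nhdsWithin_iff.2 ⟨h1, .of_forall hr.inv_smul_le⟩
    exact hr.continuous.continuousAt.mul
      (continuousAt_const.sub ((hρ _ (hr.inv_smul_le v)).tendsto.comp h2))

theorem saFun_sphericalDefect [FiniteDimensional ℝ V] (hr : IsGauge r) (hρ : SAfun ρ) :
    SAfun (sphericalDefect r ρ) := by
  have := hr.saFun
  unfold sphericalDefect
  fun_prop

/-- A gauge whose unit ball is, over the unit ball of `r`, a band of half-width
`1 - sphericalDefect r ρ`. -/
noncomputable def bandGauge (r ρ : V → ℝ) (p : V × ℝ) : ℝ :=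
  max (r p.1) (|p.2| + sphericalDefect r ρ p.1)

theorem IsGauge.band [FiniteDimensional ℝ V] (hr : IsGauge r) (hρ : SAfun ρ)
    (hρc : ContinuousOn ρ {v | r v ≤ 1}) :
    IsGauge (bandGauge r ρ) where
  continuous := by
    have h1 := continuous_sphericalDefect hr hρc
    have h2 := hr.continuous
    unfold bandGauge
    fun_prop
  saFun := by
    have h1 := saFun_sphericalDefect hr hρ
    have h2 := hr.saFun
    unfold bandGauge
    fun_prop
  nonneg p := (hr.nonneg _).trans (le_max_left _ _)
  eq_zero := by
    rintro ⟨v, y⟩ h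
    have h1 : r v ≤ 0 := h ▸ le_max_left _ _
    obtain rfl := hr.eq_zero v (le_antisymm h1 (hr.nonneg v))
    have h2 : |y| + sphericalDefect r ρ 0 ≤ 0 := h ▸ le_max_right _ _
    have h0 : sphericalDefect r ρ 0 = 0 := by simp [sphericalDefect, hr.map_zero]
    rw [h0, add_zero] at h2
    rw [abs_nonpos_iff.1 h2]
    rfl
  smul t ht p := by
    simp only [bandGauge, Prod.smul_fst, Prod.smul_snd, hr.smul t ht, sphericalDefect_smul hr ht,
      smul_eq_mul, abs_mul, abs_of_nonneg ht]
    rw [← mul_add, mul_max_of_nonneg _ _ ht]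

theorem bandGauge_lt {v : V} {y : ℝ} :
    bandGauge r ρ (v, y) < 1 ↔ r v < 1 ∧ |y| < 1 - sphericalDefect r ρ v := by
  simp only [bandGauge, max_lt_iff, lt_sub_iff_add_lt]

theorem bandGauge_le {v : V} {y : ℝ} :
    bandGauge r ρ (v, y) ≤ 1 ↔ r v ≤ 1 ∧ |y| ≤ 1 - sphericalDefect r ρ v := by
  simp only [bandGauge, max_le_iff, le_sub_iff_add_le]

end SphericalDefect

/-- The parametrisation of the band between `m - ρ` and `m + ρ`. -/
noncomputable def bandMap (r : V → ℝ) (φ : V → E) (m ρ : V → ℝ) (p : V × ℝ) : E × ℝ :=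
  (φ p.1, m p.1 + ρ p.1 * p.2 / (1 - sphericalDefect r ρ p.1))

variable {r : V → ℝ} {φ : V → E} {m ρ : V → ℝ}

theorem half_width_pos (hr : IsGauge r) (h0 : ∀ v, r v ≤ 1 → 0 ≤ ρ v)
    (hpos : ∀ v, r v < 1 → 0 < ρ v) {v : V} (hv : r v ≤ 1) :
    (0 < ρ v ∧ 0 < 1 - sphericalDefect r ρ v) ∨ (ρ v = 0 ∧ 1 - sphericalDefect r ρ v = 0) := by
  rcases hv.lt_or_eq with h | h
  · exact Or.inl ⟨hpos v h, by linarith [sphericalDefect_le hr h0 v]⟩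
  · rw [sphericalDefect_of_eq_one h, sub_sub_cancel]
    rcases (h0 v hv).lt_or_eq with h1 | h1
    · exact Or.inl ⟨h1, h1⟩
    · exact Or.inr ⟨h1.symm, h1.symm⟩

theorem IsChart.band [FiniteDimensional ℝ V] [NormedAddCommGroup E] [NormedSpace ℝ E]
    [FiniteDimensional ℝ E] (h : IsChart r φ) (hm : SAfun m)
    (hmc : ContinuousOn m {v | r v ≤ 1}) (hρ : SAfun ρ) (hρc : ContinuousOn ρ {v | r v ≤ 1})
    (h0 : ∀ v, r v ≤ 1 → 0 ≤ ρ v) (hpos : ∀ v, r v < 1 → 0 < ρ v) :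
    IsChart (bandGauge r ρ) (bandMap r φ m ρ) where
  gauge := h.gauge.band hρ hρc
  saFun := by
    have h1 := saFun_sphericalDefect h.gauge hρ
    have h2 := h.saFun
    unfold bandMap
    fun_prop
  continuousOn := by
    have hfst : MapsTo (Prod.fst : V × ℝ → V) {p | bandGauge r ρ p ≤ 1} {v | r v ≤ 1} :=
      fun p hp => (bandGauge_le.1 hp).1
    have hc1 : ContinuousOn (Prod.fst : V × ℝ → V) {p | bandGauge r ρ p ≤ 1} :=
      continuous_fst.continuousOn
    refine (h.continuousOn.comp hc1 hfst).prodMk ((hmc.comp hc1 hfst).add ?_)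
    have hρ1 : ContinuousOn (fun p : V × ℝ => ρ p.1) {p | bandGauge r ρ p ≤ 1} :=
      hρc.comp hc1 hfst
    have hw : Continuous (fun p : V × ℝ => 1 - sphericalDefect r ρ p.1) :=
      continuous_const.sub ((continuous_sphericalDefect h.gauge hρc).comp continuous_fst)
    rintro ⟨v, y⟩ hvy
    obtain ⟨hv, hy⟩ := bandGauge_le.1 hvy
    rcases half_width_pos h.gauge h0 hpos hv with ⟨-, h2⟩ | ⟨h1, h2⟩
    · exact ((hρ1 _ hvy).mul continuous_snd.continuousWithinAt).div
        hw.continuousAt.continuousWithinAt h2.ne'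
    · rw [ContinuousWithinAt]
      simp only [h1, zero_mul, zero_div]
      refine squeeze_zero_norm' (a := fun p : V × ℝ => ρ p.1) ?_ ?_
      · filter_upwards [self_mem_nhdsWithin] with p hp
        obtain ⟨hv, hy⟩ := bandGauge_le.1 (show bandGauge r ρ (p.1, p.2) ≤ 1 from hp)
        rw [norm_div, norm_mul, Real.norm_of_nonneg (h0 _ hv), Real.norm_eq_abs, mul_div_assoc,
          Real.norm_eq_abs, abs_of_nonneg ((abs_nonneg _).trans hy)]
        exact mul_le_of_le_one_right (h0 _ hv) (div_le_one_of_le₀ hy ((abs_nonneg _).trans hy))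
      · have := hρ1 _ hvy
        rw [ContinuousWithinAt] at this
        simpa only [h1] using this
  injOn := by
    rintro ⟨v, y⟩ hvy ⟨v', y'⟩ hvy' heq
    obtain ⟨hv, hy⟩ := bandGauge_le.1 hvy
    obtain ⟨hv', hy'⟩ := bandGauge_le.1 hvy'
    rw [bandMap, bandMap, Prod.mk.injEq] at heq
    obtain rfl := h.injOn hv hv' heq.1
    have h2 := heq.2
    simp only at h2
    rcases half_width_pos h.gauge h0 hpos hv with ⟨h3, h4⟩ | ⟨h3, h4⟩
    · rw [add_right_inj, div_left_inj' h4.ne', mul_right_inj' h3.ne'] at h2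
      rw [h2]
    · rw [h4, abs_nonpos_iff] at hy hy'
      rw [hy, hy']

theorem bandMap_image_le (hr : IsGauge r)
    (h0 : ∀ v, r v ≤ 1 → 0 ≤ ρ v) (hpos : ∀ v, r v < 1 → 0 < ρ v) :
    bandMap r φ m ρ '' {p | bandGauge r ρ p ≤ 1} =
      {p | ∃ v, r v ≤ 1 ∧ p.1 = φ v ∧ m v - ρ v ≤ p.2 ∧ p.2 ≤ m v + ρ v} := by
  ext ⟨x, z⟩
  constructor
  · rintro ⟨⟨v, y⟩, hvy, heq⟩
    obtain ⟨hv, hy⟩ := bandGauge_le.1 hvy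
    rw [bandMap, Prod.mk.injEq] at heq
    refine ⟨v, hv, heq.1.symm, ?_⟩
    rw [← heq.2, sub_le_iff_le_add, ← sub_le_iff_le_add', add_le_add_iff_left]
    rcases half_width_pos hr h0 hpos hv with ⟨h3, h4⟩ | ⟨h3, h4⟩
    · rw [abs_le] at hy
      simp only [mul_div_assoc]
      have h5 : y / (1 - sphericalDefect r ρ v) ≤ 1 := (div_le_one h4).2 hy.2
      have h6 : -1 ≤ y / (1 - sphericalDefect r ρ v) := by
        rw [le_div_iff₀ h4]
        linarith
      constructor <;> nlinarith
    · simp [h3]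
  · rintro ⟨v, hv, hx, hz⟩
    simp only at hx hz
    rcases half_width_pos hr h0 hpos hv with ⟨h3, h4⟩ | ⟨h3, h4⟩
    · refine ⟨(v, (z - m v) / ρ v * (1 - sphericalDefect r ρ v)), bandGauge_le.2 ⟨hv, ?_⟩, ?_⟩
      · rw [abs_mul, abs_div, abs_of_pos h4, abs_of_pos h3]
        refine mul_le_of_le_one_left h4.le ((div_le_one h3).2 (abs_le.2 ?_))
        constructor <;> linarith
      · simp only [bandMap, hx, Prod.mk.injEq, true_and]
        field_simp
        ring
    · refine ⟨(v, 0), bandGauge_le.2 ⟨hv, by simp [h4]⟩, ?_⟩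
      simp only [bandMap, hx, Prod.mk.injEq, true_and, h3, zero_mul, zero_div]
      linarith

theorem bandMap_image_lt (hr : IsGauge r)
    (h0 : ∀ v, r v ≤ 1 → 0 ≤ ρ v) (hpos : ∀ v, r v < 1 → 0 < ρ v) :
    bandMap r φ m ρ '' {p | bandGauge r ρ p < 1} =
      {p | ∃ v, r v < 1 ∧ p.1 = φ v ∧ m v - ρ v < p.2 ∧ p.2 < m v + ρ v} := by
  have hw : ∀ v, r v < 1 → 0 < 1 - sphericalDefect r ρ v := fun v hv => by
    linarith [sphericalDefect_le hr h0 v]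
  ext ⟨x, z⟩
  constructor
  · rintro ⟨⟨v, y⟩, hvy, heq⟩
    obtain ⟨hv, hy⟩ := bandGauge_lt.1 hvy
    rw [bandMap, Prod.mk.injEq] at heq
    refine ⟨v, hv, heq.1.symm, ?_⟩
    rw [← heq.2, sub_lt_iff_lt_add, ← sub_lt_iff_lt_add', add_lt_add_iff_left]
    have h3 := hpos v hv
    have h4 := hw v hv
    rw [abs_lt] at hy
    simp only [mul_div_assoc]
    have h5 : y / (1 - sphericalDefect r ρ v) < 1 := (div_lt_one h4).2 hy.2
    have h6 : -1 < y / (1 - sphericalDefect r ρ v) := by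
      rw [lt_div_iff₀ h4]
      linarith
    constructor <;> nlinarith
  · rintro ⟨v, hv, hx, hz⟩
    simp only at hx hz
    have h3 := hpos v hv
    have h4 := hw v hv
    refine ⟨(v, (z - m v) / ρ v * (1 - sphericalDefect r ρ v)), bandGauge_lt.2 ⟨hv, ?_⟩, ?_⟩
    · rw [abs_mul, abs_div, abs_of_pos h4, abs_of_pos h3]
      refine mul_lt_of_lt_one_left h4 ((div_lt_one h3).2 (abs_lt.2 ?_))
      constructor <;> linarith
    · simp only [bandMap, hx, Prod.mk.injEq, true_and]
      field_simp
      ring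

end Band

section Strips

theorem exists_nthElem_strip {s : Finset ℝ} {a b : ℕ} (hab : a ≤ b) (hb : b < s.card) {y : ℝ}
    (h1 : nthElem s a ≤ y) (h2 : y ≤ nthElem s b) : ∃ j k, a ≤ j ∧ k ≤ b ∧ j ≤ k ∧
      ((j = k ∧ y = nthElem s j) ∨ (k = j + 1 ∧ nthElem s j < y ∧ y < nthElem s k)) := by
  induction b, hab using Nat.le_induction with
  | base => exact ⟨a, a, le_rfl, le_rfl, le_rfl, Or.inl ⟨rfl, le_antisymm h2 h1⟩⟩
  | succ b hab ih =>
    rcases le_or_gt y (nthElem s b) with h | h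
    · obtain ⟨j, k, hj, hk, hjk, H⟩ := ih (by omega) h
      exact ⟨j, k, hj, by omega, hjk, H⟩
    · rcases h2.eq_or_lt with h2 | h2
      · exact ⟨b + 1, b + 1, by omega, le_rfl, le_rfl, Or.inl ⟨rfl, h2⟩⟩
      · exact ⟨b, b + 1, hab, le_rfl, by omega, Or.inr ⟨rfl, h, h2⟩⟩

variable {V E : Type} [NormedAddCommGroup E] [NormedSpace ℝ E]

/-- The graph of the `j`-th section (for `j = k`), or the band between the `j`-th and the `k`-th
section (for `k = j + 1`). -/
def strip (Z : E → Finset ℝ) (C : Set E) (j k : ℕ) : Set (E × ℝ) :=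
  {p | p.1 ∈ C ∧ ((j = k ∧ p.2 = nthElem (Z p.1) j) ∨
    (k = j + 1 ∧ nthElem (Z p.1) j < p.2 ∧ p.2 < nthElem (Z p.1) k))}

omit [NormedAddCommGroup E] [NormedSpace ℝ E] in
theorem nthElem_le_of_mem_strip {Z : E → Finset ℝ} {C : Set E} {j k : ℕ} {p : E × ℝ}
    (hp : p ∈ strip Z C j k) : nthElem (Z p.1) j ≤ p.2 ∧ p.2 ≤ nthElem (Z p.1) k := by
  rcases hp with ⟨-, ⟨rfl, h⟩ | ⟨-, h1, h2⟩⟩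
  · exact ⟨h.ge, h.le⟩
  · exact ⟨h1.le, h2.le⟩

omit [NormedAddCommGroup E] [NormedSpace ℝ E] in
theorem eq_of_mem_strip {Z : E → Finset ℝ} {C C' : Set E} {j k j' k' : ℕ} {p : E × ℝ}
    (hk : k < (Z p.1).card) (hk' : k' < (Z p.1).card)
    (hp : p ∈ strip Z C j k) (hp' : p ∈ strip Z C' j' k') : j = j' ∧ k = k' := by
  rcases hp with ⟨-, ⟨rfl, h⟩ | ⟨rfl, h1, h2⟩⟩ <;>
    rcases hp' with ⟨-, ⟨rfl, h'⟩ | ⟨rfl, h1', h2'⟩⟩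
  · have := nthElem_injective hk hk' (h.symm.trans h')
    exact ⟨this, this⟩
  · have h3 := lt_of_nthElem_lt (by omega) (h1'.trans_eq h)
    have h4 := lt_of_nthElem_lt hk (h.symm.trans_lt h2')
    omega
  · have h3 := lt_of_nthElem_lt (by omega) (h1.trans_eq h')
    have h4 := lt_of_nthElem_lt hk' (h'.symm.trans_lt h2)
    omega
  · have h3 := lt_of_nthElem_lt (by omega) (h1.trans h2')
    have h4 := lt_of_nthElem_lt (by omega) (h1'.trans h2)
    omega

variable [NormedAddCommGroup V] [NormedSpace ℝ V] [FiniteDimensional ℝ V] [FiniteDimensional ℝ E]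

theorem IsSections.isCell_strip {Z : E → Finset ℝ} (hZ : IsSections Z) {r : V → ℝ} {φ : V → E}
    (h : IsChart r φ) {l : ℕ} (hl : ∀ v, r v < 1 → (Z (φ v)).card = l) {j k : ℕ}
    (hjk : j = k ∨ k = j + 1) (hkl : k < l) :
    IsCell (strip Z (φ '' {v | r v < 1}) j k) ∧ ∃ α β : V → ℝ,
      ContinuousOn α {v | r v ≤ 1} ∧ ContinuousOn β {v | r v ≤ 1} ∧
      (∀ v, r v ≤ 1 → α v ∈ Z (φ v) ∧ β v ∈ Z (φ v)) ∧
      closure (strip Z (φ '' {v | r v < 1}) j k) =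
        {p | ∃ v, r v ≤ 1 ∧ p.1 = φ v ∧ α v ≤ p.2 ∧ p.2 ≤ β v} := by
  obtain ⟨α, hα, hαc, hα1, hαZ⟩ := hZ.exists_extension h hl (j := j) (by omega)
  rcases hjk with rfl | rfl
  · have hs : strip Z (φ '' {v | r v < 1}) j j = (fun v => (φ v, α v)) '' {v | r v < 1} := by
      ext ⟨x, y⟩
      constructor
      · rintro ⟨⟨v, hv, rfl⟩, ⟨-, hy⟩ | ⟨hy, -⟩⟩
        · exact ⟨v, hv, Prod.ext rfl ((hα1 v hv).trans hy.symm)⟩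
        · omega
      · rintro ⟨v, hv, hvx⟩
        obtain ⟨rfl, rfl⟩ := Prod.mk.injEq _ _ _ _ ▸ hvx
        exact ⟨⟨v, hv, rfl⟩, Or.inl ⟨rfl, hα1 v hv⟩⟩
    have hch := h.graph hα hαc
    refine ⟨⟨V, _, _, ‹_›, r, _, hch, hs.symm⟩, α, α, hαc, hαc, fun v hv => ⟨hαZ v hv, hαZ v hv⟩, ?_⟩
    rw [hs, hch.closure_image]
    ext ⟨x, y⟩
    constructor
    · rintro ⟨v, hv, hvx⟩
      obtain ⟨rfl, rfl⟩ := Prod.mk.injEq _ _ _ _ ▸ hvx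
      exact ⟨v, hv, rfl, le_rfl, le_rfl⟩
    · rintro ⟨v, hv, hx, h1, h2⟩
      exact ⟨v, hv, Prod.ext hx.symm (le_antisymm h1 h2)⟩
  · obtain ⟨β, hβ, hβc, hβ1, hβZ⟩ := hZ.exists_extension h hl hkl
    have hlt : ∀ v, r v < 1 → α v < β v := fun v hv => by
      rw [hα1 v hv, hβ1 v hv]
      exact nthElem_lt (by omega) (by rwa [hl v hv])
    have hle : ∀ v, r v ≤ 1 → α v ≤ β v := fun v hv =>
      ContinuousWithinAt.closure_le (h.gauge.closure_lt.ge hv)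
        ((hαc v hv).mono setOf_lt_subset_le) ((hβc v hv).mono setOf_lt_subset_le)
        fun w hw => (hlt w hw).le
    set m : V → ℝ := fun v => (α v + β v) / 2 with hm
    set ρ : V → ℝ := fun v => (β v - α v) / 2 with hρ
    have hmα : ∀ v, m v - ρ v = α v := fun v => by simp only [hm, hρ]; ring
    have hmβ : ∀ v, m v + ρ v = β v := fun v => by simp only [hm, hρ]; ring
    have hρ0 : ∀ v, r v ≤ 1 → 0 ≤ ρ v := fun v hv => by
      have := hle v hv
      simp only [hρ]
      linarith
    have hρ1 : ∀ v, r v < 1 → 0 < ρ v := fun v hv => by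
      have := hlt v hv
      simp only [hρ]
      linarith
    have hch := h.band (m := m) (ρ := ρ) (by fun_prop) ((hαc.add hβc).div_const 2) (by fun_prop)
      ((hβc.sub hαc).div_const 2) hρ0 hρ1
    have hs : strip Z (φ '' {v | r v < 1}) j (j + 1) =
        bandMap r φ m ρ '' {p | bandGauge r ρ p < 1} := by
      rw [bandMap_image_lt h.gauge hρ0 hρ1]
      simp only [hmα, hmβ]
      ext ⟨x, y⟩
      constructor
      · rintro ⟨⟨v, hv, rfl⟩, ⟨hy, -⟩ | ⟨-, hy1, hy2⟩⟩
        · omega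
        · exact ⟨v, hv, rfl, (hα1 v hv).trans_lt hy1, hy2.trans_eq (hβ1 v hv).symm⟩
      · rintro ⟨v, hv, hx, hy1, hy2⟩
        obtain rfl : x = φ v := hx
        exact ⟨⟨v, hv, rfl⟩, Or.inr ⟨rfl, (hα1 v hv).symm.trans_lt hy1, hy2.trans_eq (hβ1 v hv)⟩⟩
    refine ⟨⟨V × ℝ, _, _, inferInstance, _, _, hch, hs.symm⟩, α, β, hαc, hβc,
      fun v hv => ⟨hαZ v hv, hβZ v hv⟩, ?_⟩
    rw [hs, hch.closure_image, bandMap_image_le h.gauge hρ0 hρ1]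
    simp only [hmα, hmβ]

omit [FiniteDimensional ℝ E] in
theorem IsSections.exists_eq_nthElem {Z : E → Finset ℝ} (hZ : IsSections Z) {C : Set E}
    (hC : IsPreconnected C) {l : ℕ} (hl : ∀ x ∈ C, (Z x).card = l) {f : E → ℝ}
    (hf : ContinuousOn f C) (hfZ : ∀ x ∈ C, f x ∈ Z x) {x₀ : E} (hx₀ : x₀ ∈ C) :
    ∃ i < l, ∀ x ∈ C, f x = nthElem (Z x) i := by
  obtain ⟨i, hi, hix⟩ := exists_nthElem (hfZ x₀ hx₀)
  rw [hl x₀ hx₀] at hi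
  refine ⟨i, hi, ?_⟩
  have : PreconnectedSpace C := isPreconnected_iff_preconnectedSpace.1 hC
  have hcl : ∀ j < l, IsClosed {x : C | f x = nthElem (Z x) j} := fun j hj =>
    isClosed_eq hf.domRestrict (hZ.continuousOn_nthElem hl hj).domRestrict
  have hop : IsOpen {x : C | f x = nthElem (Z x) i} := by
    rw [← isClosed_compl_iff]
    have : {x : C | f x = nthElem (Z x) i}ᶜ =
        ⋃ j ∈ (Finset.range l).erase i, {x : C | f x = nthElem (Z x) j} := by
      ext x
      simp only [mem_compl_iff, mem_ofPred_eq, mem_iUnion, Finset.mem_erase, Finset.mem_range,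
        exists_prop]
      constructor
      · intro h
        obtain ⟨j, hj, hjx⟩ := exists_nthElem (hfZ x x.2)
        rw [hl x x.2] at hj
        refine ⟨j, ⟨?_, hj⟩, hjx.symm⟩
        rintro rfl
        exact h hjx.symm
      · rintro ⟨j, ⟨hji, hj⟩, hjx⟩ h
        refine hji (nthElem_injective (s := Z x) ?_ ?_ (hjx.symm.trans h)) <;> rwa [hl x x.2]
    rw [this]
    exact isClosed_biUnion_finset fun j hj =>
      hcl j (Finset.mem_range.1 (Finset.mem_of_mem_erase hj))
  have huniv := IsClopen.eq_univ ⟨hcl i hi, hop⟩ ⟨⟨x₀, hx₀⟩, hix.symm⟩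
  intro x hx
  exact huniv.ge (mem_univ (⟨x, hx⟩ : C))

/-- The strips of a family of sections over the cells of a complex. -/
def strips (Z : E → Finset ℝ) (𝒞 : Set (Set E)) : Set (Set (E × ℝ)) :=
  {G | ∃ C ∈ 𝒞, ∃ j k, (j = k ∨ k = j + 1) ∧ (∀ x ∈ C, k < (Z x).card) ∧ G = strip Z C j k}

theorem IsCellComplex.strips {𝒞 : Set (Set E)} (h𝒞 : IsCellComplex 𝒞) {Z : E → Finset ℝ}
    (hZ : IsSections Z) (hcard : ∀ C ∈ 𝒞, ∃ l, ∀ x ∈ C, (Z x).card = l) :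
    IsCellComplex (strips Z 𝒞) where
  finite := by
    obtain ⟨N, hN⟩ := hZ.card_le
    refine ((h𝒞.finite.prod ((finite_Iic N).prod (finite_Iic N))).image
      fun q => strip Z q.1 q.2.1 q.2.2).subset ?_
    rintro _ ⟨C, hC, j, k, hjk, hk, rfl⟩
    obtain ⟨x, hx⟩ := (h𝒞.isCell C hC).nonempty
    have := (hk x hx).trans_le (hN x)
    refine ⟨(C, j, k), ⟨hC, ?_, ?_⟩, rfl⟩ <;> simp only [mem_Iic] <;> omega
  isCell := by
    rintro _ ⟨C, hC, j, k, hjk, hk, rfl⟩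
    obtain ⟨l, hl⟩ := hcard C hC
    obtain ⟨V, _, _, _, r, φ, h, rfl⟩ := h𝒞.isCell C hC
    have hk' := hk _ ⟨0, by simp [h.gauge.map_zero], rfl⟩
    rw [hl _ ⟨0, by simp [h.gauge.map_zero], rfl⟩] at hk'
    exact (hZ.isCell_strip h (fun v hv => hl _ ⟨v, hv, rfl⟩) hjk hk').1
  eq_of_mem := by
    rintro _ ⟨C, hC, j, k, hjk, hk, rfl⟩ _ ⟨C', hC', j', k', hjk', hk', rfl⟩ p hp hp'
    obtain rfl := h𝒞.eq_of_mem C hC C' hC' p.1 hp.1 hp'.1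
    obtain ⟨rfl, rfl⟩ := eq_of_mem_strip (hk _ hp.1) (hk' _ hp.1) hp hp'
    rfl
  frontier := by
    rintro _ ⟨C, hC, j, k, hjk, hk, rfl⟩ p hp
    obtain ⟨l, hl⟩ := hcard C hC
    obtain ⟨V, _, _, _, r, φ, h, rfl⟩ := h𝒞.isCell C hC
    have hk' := hk _ ⟨0, by simp [h.gauge.map_zero], rfl⟩
    rw [hl _ ⟨0, by simp [h.gauge.map_zero], rfl⟩] at hk'
    obtain ⟨-, α, β, hα, hβ, hZαβ, hcl⟩ :=
      hZ.isCell_strip h (fun v hv => hl _ ⟨v, hv, rfl⟩) hjk hk'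
    rw [hcl] at hp ⊢
    obtain ⟨v, hv, hpv, hp1, hp2⟩ := hp
    have hpcl : p.1 ∈ closure (φ '' {v | r v < 1}) := by
      rw [h.closure_image, hpv]
      exact mem_image_of_mem _ hv
    obtain ⟨C', hC', hpC', hCC'⟩ := h𝒞.frontier _ hC _ hpcl
    rw [h.closure_image] at hCC'
    obtain ⟨l', hl'⟩ := hcard C' hC'
    have hconst : ∀ f : V → ℝ, ContinuousOn f {v | r v ≤ 1} →
        (∀ v, r v ≤ 1 → f v ∈ Z (φ v)) →
        ∃ i < l', ∀ w, r w ≤ 1 → φ w ∈ C' → f w = nthElem (Z (φ w)) i := by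
      intro f hf hfZ
      have hinv := h.injOn.leftInvOn_invFunOn
      have hg : ContinuousOn (fun x => f (Function.invFunOn φ {v | r v ≤ 1} x)) C' := by
        refine (h.continuousOn_of_comp (hf.congr fun w hw => ?_)).mono hCC'
        simp only [hinv hw]
      obtain ⟨i, hi, H⟩ := hZ.exists_eq_nthElem (h𝒞.isCell C' hC').isPreconnected hl' hg
        (fun x hx => by
          obtain ⟨w, hw, rfl⟩ := hCC' hx
          simp only [hinv hw]
          exact hfZ w hw) hpC'
      refine ⟨i, hi, fun w hw hwC => ?_⟩
      have := H _ hwC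
      simpa only [hinv hw] using this
    obtain ⟨a, ha, haα⟩ := hconst α hα fun v hv => (hZαβ v hv).1
    obtain ⟨b, hb, hbβ⟩ := hconst β hβ fun v hv => (hZαβ v hv).2
    rw [hpv] at hpC'
    have hcp := hl' _ hpC'
    rw [haα v hv hpC'] at hp1
    rw [hbβ v hv hpC'] at hp2
    have hab : a ≤ b := by
      by_contra! hba
      exact absurd (nthElem_lt hba (s := Z (φ v)) (by omega)) (not_lt.2 (hp1.trans hp2))
    obtain ⟨j', k', hj', hk', hjk', H⟩ := exists_nthElem_strip hab (by omega) hp1 hp2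
    refine ⟨strip Z C' j' k', ⟨C', hC', j', k', ?_, fun x hx => ?_, rfl⟩, ⟨?_, ?_⟩, ?_⟩
    · exact H.imp And.left And.left
    · rw [hl' x hx]
      omega
    · rwa [hpv]
    · rwa [hpv]
    · intro q hq
      obtain ⟨w, hw, hqw⟩ := hCC' hq.1
      have hwC : φ w ∈ C' := hqw ▸ hq.1
      have hcw := hl' _ hwC
      obtain ⟨h1, h2⟩ := nthElem_le_of_mem_strip hq
      rw [← hqw] at h1 h2
      refine ⟨w, hw, hqw.symm, ?_, ?_⟩
      · rw [haα w hw hwC]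
        exact (nthElem_le hj' (by omega)).trans h1
      · rw [hbβ w hw hwC]
        exact h2.trans (nthElem_le hk' (by omega))

end Strips

section Decomposition

theorem isCellComplex_univ {E : Type} [NormedAddCommGroup E] [NormedSpace ℝ E]
    [FiniteDimensional ℝ E] [Subsingleton E] : IsCellComplex {(univ : Set E)} where
  finite := finite_singleton _
  isCell := by
    rintro _ rfl
    refine ⟨E, _, _, ‹_›, fun _ => 0, id, ⟨⟨continuous_const, by fun_prop, fun _ => le_rfl,
      fun _ _ => Subsingleton.elim _ _, by simp⟩, SAfun.id, continuousOn_id, injOn_id _⟩, by simp⟩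
  eq_of_mem := by simp
  frontier := by simp

theorem exists_isCellComplex (n : ℕ) : ∀ (E : Type) [NormedAddCommGroup E] [NormedSpace ℝ E]
    [FiniteDimensional ℝ E], Module.finrank ℝ E = n → ∀ 𝒜 : Set (Set E), 𝒜.Finite →
    (∀ A ∈ 𝒜, SA A) → ∀ B : Set E, Bornology.IsBounded B → ∃ 𝒞 : Set (Set E), IsCellComplex 𝒞 ∧
      B ⊆ ⋃₀ 𝒞 ∧ ∀ C ∈ 𝒞, ∀ A ∈ 𝒜, ∀ x ∈ C, ∀ y ∈ C, x ∈ A → y ∈ A := by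
  induction n using Nat.strong_induction_on with
  | _ n ih =>
  intro E _ _ _ hn 𝒜 h𝒜 hSA B hB
  rcases subsingleton_or_nontrivial E with hE | hE
  · refine ⟨_, isCellComplex_univ, by simp, fun C _ A _ x _ y _ hxA => ?_⟩
    rwa [Subsingleton.elim y x]
  obtain ⟨W, e, hW, H⟩ := exists_isSections h𝒜 hSA
  obtain ⟨M, hM⟩ := (e.symm.lipschitz.isBounded_image hB).exists_norm_le
  obtain ⟨Z, hZ, hZM, hZA⟩ := H M
  obtain ⟨N, hN⟩ := hZ.card_le
  let mid : ℕ → W → ℝ := fun j x => (nthElem (Z x) j + nthElem (Z x) (j + 1)) / 2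
  have hsec := hZ.saFun_nthElem
  have hmid : ∀ j, SAfun (mid j) := fun j => by
    have h1 := hsec j
    have h2 := hsec (j + 1)
    simp only [mid]
    fun_prop
  have he : SAfun (fun p : W × ℝ => e p) := SAfun.clinear e.toContinuousLinearMap
  let 𝒜₁ : Set (Set W) := (fun l => {x | (Z x).card = l}) '' Iic N
  let 𝒜₂ : Set (Set W) := (fun q : Set E × ℕ => {x | e (x, nthElem (Z x) q.2) ∈ q.1}) '' (𝒜 ×ˢ Iic N)
  let 𝒜₃ : Set (Set W) := (fun q : Set E × ℕ => {x | e (x, mid q.2 x) ∈ q.1}) '' (𝒜 ×ˢ Iic N)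
  obtain ⟨𝒞, h𝒞, hcov, hcompat⟩ := ih _ (hn ▸ hW) W rfl (𝒜₁ ∪ (𝒜₂ ∪ 𝒜₃))
    (((finite_Iic N).image _).union (((h𝒜.prod (finite_Iic N)).image _).union
      ((h𝒜.prod (finite_Iic N)).image _))) (by
      rintro _ (⟨l, -, rfl⟩ | ⟨q, hq, rfl⟩ | ⟨q, hq, rfl⟩)
      · exact hZ.sa_card_eq l
      · exact (hSA _ hq.1).preimage (he.comp (SAfun.id.prodMk (hsec _)))
      · exact (hSA _ hq.1).preimage (he.comp (SAfun.id.prodMk (hmid _))))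
    (Prod.fst '' (e.symm '' B))
    (LipschitzWith.prod_fst.isBounded_image (e.symm.lipschitz.isBounded_image hB))
  have hcard : ∀ C ∈ 𝒞, ∃ l, ∀ x ∈ C, (Z x).card = l := by
    intro C hC
    obtain ⟨x, hx⟩ := (h𝒞.isCell C hC).nonempty
    exact ⟨(Z x).card, fun y hy => hcompat C hC {y | (Z y).card = (Z x).card}
      (Or.inl ⟨_, hN x, rfl⟩) x hx y hy rfl⟩
  refine ⟨_, (h𝒞.strips hZ hcard).image e, ?_, ?_⟩
  · intro b hb
    obtain ⟨⟨x, y⟩, rfl⟩ := e.surjective b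
    have hxy := hM _ (mem_image_of_mem _ hb)
    rw [e.symm_apply_apply] at hxy
    have hy : |y| ≤ M := (norm_snd_le (x, y)).trans hxy
    obtain ⟨C, hC, hxC⟩ := hcov ⟨(x, y), ⟨_, hb, e.symm_apply_apply _⟩, rfl⟩
    obtain ⟨i, hi, hiM⟩ := exists_nthElem (hZM x).1
    obtain ⟨i', hi', hiM'⟩ := exists_nthElem (hZM x).2
    rw [abs_le] at hy
    have hii : i' ≤ i := by
      by_contra! h
      have := nthElem_lt h hi'
      linarith
    obtain ⟨j, k, hj, hk, -, hjk⟩ := exists_nthElem_strip hii hi (hiM'.trans_le hy.1)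
      (hy.2.trans_eq hiM.symm)
    obtain ⟨l, hl⟩ := hcard C hC
    refine ⟨_, ⟨strip Z C j k, ⟨C, hC, j, k, hjk.imp And.left And.left, fun z hz => ?_, rfl⟩, rfl⟩,
      mem_image_of_mem _ ⟨hxC, hjk⟩⟩
    have := hl x hxC
    have := hl z hz
    omega
  · rintro _ ⟨_, ⟨C, hC, j, k, -, hk, rfl⟩, rfl⟩ A hA _ ⟨⟨x, y⟩, ⟨hx, hy⟩, rfl⟩ _
      ⟨⟨x', y'⟩, ⟨hx', hy'⟩, rfl⟩ hmem
    simp only at hx hy hx' hy'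
    have hjN : j ≤ N := by
      have := (hk x hx).trans_le (hN x)
      rcases hy with hy | hy <;> omega
    rcases hy with ⟨rfl, rfl⟩ | ⟨rfl, hy1, hy2⟩
    · obtain ⟨-, rfl⟩ : j = j ∧ y' = nthElem (Z x') j := hy'.resolve_right (by simp)
      exact hcompat C hC _ (Or.inr (Or.inl ⟨(A, j), ⟨hA, hjN⟩, rfl⟩)) x hx x' hx' hmem
    · obtain ⟨-, hy1', hy2'⟩ := hy'.resolve_left (by simp)
      have hmem_mid : ∀ x ∈ C, mid j x ∈ Ioo (nthElem (Z x) j) (nthElem (Z x) (j + 1)) := by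
        intro x hx
        have := nthElem_lt (Nat.lt_succ_self j) (hk x hx)
        constructor <;> simp only [mid] <;> linarith
      have hno : ∀ x ∈ C, ∀ a b, a ∈ Ioo (nthElem (Z x) j) (nthElem (Z x) (j + 1)) →
          b ∈ Ioo (nthElem (Z x) j) (nthElem (Z x) (j + 1)) → ∀ z ∈ uIcc a b, z ∉ Z x := by
        intro x hx a b ha hb z hz hzZ
        obtain ⟨i, hi, rfl⟩ := exists_nthElem hzZ
        have hz' := ordConnected_Ioo.uIcc_subset ha hb hz
        have hkx := hk x hx
        have h1 := lt_of_nthElem_lt (by omega) hz'.1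
        have h2 := lt_of_nthElem_lt hi hz'.2
        omega
      have h1 := hZA A hA x _ _ (hno x hx _ _ ⟨hy1, hy2⟩ (hmem_mid x hx)) hmem
      have h2 := hcompat C hC _ (Or.inr (Or.inr ⟨(A, j), ⟨hA, hjN⟩, rfl⟩)) x hx x' hx' h1
      exact hZA A hA x' _ _ (hno x' hx' _ _ (hmem_mid x' hx') ⟨hy1', hy2'⟩) h2

end Decomposition

section Barycentric

variable {E : Type} [NormedAddCommGroup E] [NormedSpace ℝ E] [FiniteDimensional ℝ E]

theorem IsChart.exists_inverse {V : Type} [NormedAddCommGroup V] [NormedSpace ℝ V]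
    [FiniteDimensional ℝ V] {r : V → ℝ} {φ : V → E} (h : IsChart r φ) :
    ∃ ψ : E → V, SAfun ψ ∧ ∀ v, r v ≤ 1 → ψ (φ v) = v := by
  classical
  have hex : ∀ x, ∃ v, (r v ≤ 1 ∧ φ v = x) ∨ (¬ ∃ v, r v ≤ 1 ∧ φ v = x) ∧ v = 0 := by
    intro x
    by_cases hx : ∃ v, r v ≤ 1 ∧ φ v = x
    · exact ⟨hx.choose, Or.inl hx.choose_spec⟩
    · exact ⟨0, Or.inr ⟨hx, rfl⟩⟩
  choose ψ hψ using hex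
  refine ⟨ψ, ?_, fun v hv => ?_⟩
  · have hgraph : {p : E × V | p.2 = ψ p.1} = {p : E × V | (r p.2 ≤ 1 ∧ φ p.2 = p.1) ∨
        (¬ ∃ v, r v ≤ 1 ∧ φ v = p.1) ∧ p.2 = 0} := by
      ext ⟨x, v⟩
      constructor
      · rintro (rfl : v = ψ x)
        exact hψ x
      · intro hv
        rcases hψ x with h1 | ⟨h1, h2⟩ <;> rcases hv with h3 | ⟨h3, h4⟩
        · exact h.injOn h3.1 h1.1 (h3.2.trans h1.2.symm)
        · exact absurd ⟨_, h1⟩ h3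
        · exact absurd ⟨_, h3⟩ h1
        · exact h4.trans h2.symm
    rw [SAfun, hgraph]
    have hr := h.gauge.saFun
    have hφ := h.saFun
    refine SA.or (SA.and ?_ ?_) (SA.and (SA.not (SA.exists
      (P := fun (p : E × V) (v : V) => r v ≤ 1 ∧ φ v = p.1) (SA.and ?_ ?_))) ?_)
    · exact SA.le (hr.comp (SAfun.snd .id)) (.const _)
    · exact SA.eq (hφ.comp (SAfun.snd .id)) (SAfun.fst .id)
    · exact SA.le (hr.comp (SAfun.snd .id)) (.const _)
    · exact SA.eq (hφ.comp (SAfun.snd .id)) (SAfun.fst (SAfun.fst .id))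
    · exact SA.eq (SAfun.snd .id) (.const _)
  · rcases hψ (φ v) with h1 | h1
    · exact h.injOn h1.1 hv h1.2
    · exact absurd ⟨v, hv, rfl⟩ h1.1

variable {ι : Type} [Fintype ι] [DecidableEq ι]

/-- An injectively indexed cell complex. -/
structure IsCellFamily (C : ι → Set E) : Prop where
  isCell : ∀ i, IsCell (C i)
  eq_of_mem : ∀ i j x, x ∈ C i → x ∈ C j → i = j
  frontier : ∀ j, ∀ x ∈ closure (C j), ∃ i, x ∈ C i ∧ C i ⊆ closure (C j)

/-- Barycentric coordinates with support a flag of cells with indices in `L`. -/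
def flagSimplex (C : ι → Set E) (L : Finset ι) : Set (ι → ℝ) :=
  {w | (∀ k, 0 ≤ w k) ∧ ∑ k, w k = 1 ∧ (∀ k, w k ≠ 0 → k ∈ L) ∧
    ∀ i j, w i ≠ 0 → w j ≠ 0 → C i ⊆ closure (C j) ∨ C j ⊆ closure (C i)}

/-- A semialgebraic barycentric subdivision of the union of the cells with indices in `L`. -/
structure IsBarycentric (C : ι → Set E) (L : Finset ι) (g : E → ι → ℝ) : Prop where
  saFun : SAfun g
  continuousOn : ContinuousOn g (⋃ i ∈ L, C i)
  mem : ∀ i ∈ L, ∀ x ∈ C i, g x ∈ flagSimplex C L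
  pos : ∀ i ∈ L, ∀ x ∈ C i, 0 < g x i
  subset : ∀ i ∈ L, ∀ x ∈ C i, ∀ k, g x k ≠ 0 → C k ⊆ closure (C i)
  injOn : InjOn g (⋃ i ∈ L, C i)
  surj : ∀ w ∈ flagSimplex C L, ∃ i ∈ L, ∃ x ∈ C i, g x = w

omit [NormedSpace ℝ E] [FiniteDimensional ℝ E] [Fintype ι] [DecidableEq ι] in
theorem closure_trans {C : ι → Set E} {i j k : ι} (hij : C i ⊆ closure (C j))
    (hjk : C j ⊆ closure (C k)) : C i ⊆ closure (C k) :=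
  hij.trans (closure_minimal hjk isClosed_closure)

namespace IsCellFamily

variable {C : ι → Set E} (hC : IsCellFamily C)
include hC

omit [FiniteDimensional ℝ E] [Fintype ι] [DecidableEq ι] in
theorem antisymm {i j : ι} (hij : C i ⊆ closure (C j)) (hji : C j ⊆ closure (C i)) : i = j := by
  obtain ⟨V, _, _, _, r, φ, h, hφ⟩ := hC.isCell j
  by_contra hne
  have hK : IsCompact (φ '' {v | r v = 1}) := by
    refine IsCompact.image_of_continuousOn ?_ (h.continuousOn.mono fun v (hv : r v = 1) => hv.le)
    exact (h.gauge.isCompact_le 1).of_isClosed_subset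
      (isClosed_eq h.gauge.continuous continuous_const) fun v (hv : r v = 1) => hv.le
  have hi : C i ⊆ φ '' {v | r v = 1} := by
    intro x hx
    have h1 := hij hx
    rw [← hφ, h.closure_image] at h1
    obtain ⟨v, hv, rfl⟩ := h1
    refine ⟨v, ?_, rfl⟩
    refine (lt_or_eq_of_le hv).resolve_left fun hlt => hne ?_
    exact hC.eq_of_mem _ _ _ hx (hφ ▸ mem_image_of_mem _ hlt)
  have h0 : φ 0 ∈ C j := by
    rw [← hφ]
    exact ⟨0, by simp [h.gauge.map_zero], rfl⟩
  obtain ⟨v, hv : r v = 1, hv0⟩ := closure_minimal hi hK.isClosed (hji h0)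
  have : v = 0 := h.injOn (show v ∈ {v | r v ≤ 1} from hv.le)
    (show r 0 ≤ 1 by simp [h.gauge.map_zero]) hv0
  rw [this, h.gauge.map_zero] at hv
  exact zero_ne_one hv

omit [FiniteDimensional ℝ E] [Fintype ι] [DecidableEq ι] in
theorem isClosed_iUnion {L : Finset ι} (hL : ∀ j ∈ L, ∀ i, C i ⊆ closure (C j) → i ∈ L) :
    IsClosed (⋃ i ∈ L, C i) := by
  have : (⋃ i ∈ L, C i) = ⋃ i ∈ L, closure (C i) := by
    refine Subset.antisymm (iUnion₂_mono fun i _ => subset_closure) ?_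
    refine iUnion₂_subset fun j hj x hx => ?_
    obtain ⟨i, hi, hij⟩ := hC.frontier j x hx
    exact mem_iUnion₂_of_mem (hL j hj i hij) hi
  rw [this]
  exact isClosed_biUnion_finset fun i _ => isClosed_closure

theorem exists_isBarycentric_insert {L : Finset ι} {j : ι} (hj : j ∉ L)
    (hL : ∀ j ∈ L, ∀ i, C i ⊆ closure (C j) → i ∈ L)
    (hLj : ∀ i, C i ⊆ closure (C j) → i ≠ j → i ∈ L) {g : E → ι → ℝ}
    (hg : IsBarycentric C L g) : ∃ g', IsBarycentric C (insert j L) g' := by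
  classical
  obtain ⟨V, _, _, _, r, φ, h, hφ⟩ := hC.isCell j
  obtain ⟨ψ, hψ, hψφ⟩ := h.exists_inverse
  have hr := h.gauge
  have hcl : closure (C j) = φ '' {v | r v ≤ 1} := by rw [← hφ, h.closure_image]
  have hmemj : ∀ v, r v ≤ 1 → (φ v ∈ C j ↔ r v < 1) := by
    intro v hv
    rw [← hφ]
    constructor
    · rintro ⟨u, hu, huv⟩
      rwa [← h.injOn (setOf_lt_subset_le hu) hv huv]
    · exact fun hv => mem_image_of_mem _ hv
  have hbd : ∀ u, r u = 1 → ∃ i ∈ L, φ u ∈ C i ∧ C i ⊆ closure (C j) := by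
    intro u hu
    obtain ⟨i, hi, hij⟩ := hC.frontier j (φ u) (by rw [hcl]; exact ⟨u, hu.le, rfl⟩)
    refine ⟨i, hLj i hij ?_, hi, hij⟩
    rintro rfl
    exact ((hmemj u hu.le).1 hi).ne hu
  have hLne : ∀ i ∈ L, ∀ x ∈ C i, x ∉ C j := by
    intro i hi x hx hxj
    exact hj (hC.eq_of_mem i j x hx hxj ▸ hi)
  set e : ι → ℝ := Pi.single j 1 with he
  let G : V → ι → ℝ := fun v => (1 - r v) • e + r v • g (φ ((r v)⁻¹ • v))
  have hGj : ∀ v, G v j = 1 - r v := by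
    intro v
    simp only [G, he, Pi.add_apply, Pi.smul_apply, Pi.single_eq_same, smul_eq_mul, mul_one]
    rcases eq_or_ne v 0 with rfl | hv
    · simp [hr.map_zero]
    obtain ⟨i, hi, hvi, -⟩ := hbd _ (hr.inv_smul hv)
    have : g (φ ((r v)⁻¹ • v)) j = 0 := by
      by_contra h0
      exact hj ((hg.mem i hi _ hvi).2.2.1 j h0)
    rw [this]
    ring
  have hGk : ∀ v k, k ≠ j → G v k = r v * g (φ ((r v)⁻¹ • v)) k := by
    intro v k hk
    simp [G, he, hk]
  let g' : E → ι → ℝ := fun x => if x ∈ C j then G (ψ x) else g x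
  have hg'φ : ∀ v, r v ≤ 1 → g' (φ v) = G v := by
    intro v hv
    by_cases hv1 : r v < 1
    · simp only [g', if_pos ((hmemj v hv).2 hv1), hψφ v hv]
    · have hv2 : r v = 1 := le_antisymm hv (not_lt.1 hv1)
      simp [g', if_neg (mt (hmemj v hv).1 hv1), G, hv2]
  have hg'L : ∀ i ∈ L, ∀ x ∈ C i, g' x = g x := fun i hi x hx => if_neg (hLne i hi x hx)
  have hpos : ∀ i ∈ insert j L, ∀ x ∈ C i, 0 < g' x i := by
    intro i hi x hx
    rcases Finset.mem_insert.1 hi with rfl | hi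
    · rw [← hφ] at hx
      obtain ⟨v, hv : r v < 1, rfl⟩ := hx
      rw [hg'φ v hv.le, hGj]
      linarith
    · rw [hg'L i hi x hx]
      exact hg.pos i hi x hx
  have hsub : ∀ i ∈ insert j L, ∀ x ∈ C i, ∀ k, g' x k ≠ 0 → C k ⊆ closure (C i) := by
    intro i hi x hx k hk
    rcases Finset.mem_insert.1 hi with rfl | hi
    · rcases eq_or_ne k i with rfl | hki
      · exact subset_closure
      rw [← hφ] at hx
      obtain ⟨v, hv : r v < 1, rfl⟩ := hx
      rw [hg'φ v hv.le, hGk v k hki] at hk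
      have hv0 : v ≠ 0 := by
        rintro rfl
        exact hk (by simp [hr.map_zero])
      obtain ⟨l, hl, hvl, hli⟩ := hbd _ (hr.inv_smul hv0)
      exact closure_trans (hg.subset l hl _ hvl k (right_ne_zero_of_mul hk)) hli
    · rw [hg'L i hi x hx] at hk
      exact hg.subset i hi x hx k hk
  have hSA : SAfun g' := by
    have hSj : SA (C j) := by
      rw [← hφ]
      exact SA.image h.saFun (SA.lt hr.saFun (.const _))
    have h1 : SAfun (fun x => r (ψ x)) := hr.saFun.comp hψ
    exact SAfun.ite hSj (((SAfun.const 1).sub h1).smul (.const _) |>.add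
      (h1.smul (hg.saFun.comp (h.saFun.comp (h1.inv.smul hψ))))) hg.saFun
  have hmem : ∀ i ∈ insert j L, ∀ x ∈ C i, g' x ∈ flagSimplex C (insert j L) := by
    intro i hi x hx
    rcases Finset.mem_insert.1 hi with rfl | hi'
    · have hs := hsub i hi x hx
      rw [← hφ] at hx
      obtain ⟨v, hv : r v < 1, rfl⟩ := hx
      rw [hg'φ v hv.le] at hs ⊢
      rcases eq_or_ne v 0 with rfl | hv0
      · have hG0 : G 0 = Pi.single i 1 := by simp [G, hr.map_zero, he]
        rw [hG0]
        refine ⟨fun k => ?_, by simp, fun k hk => ?_, fun k l hk hl => ?_⟩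
        · by_cases hk : k = i
          · subst hk; simp
          · simp [hk]
        · by_contra hki
          have : k ≠ i := fun h => hki (h ▸ Finset.mem_insert_self _ _)
          simp [this] at hk
        · have hk' : k = i := by
            by_contra h
            simp [h] at hk
          have hl' : l = i := by
            by_contra h
            simp [h] at hl
          subst hk' hl'
          exact Or.inl subset_closure
      obtain ⟨l, hl, hvl, hli⟩ := hbd _ (hr.inv_smul hv0)
      obtain ⟨m1, m2, m3, m4⟩ := hg.mem l hl _ hvl
      refine ⟨fun k => ?_, ?_, fun k hk => ?_, fun k m hk hm => ?_⟩
      · rcases eq_or_ne k i with rfl | hki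
        · rw [hGj]
          linarith
        · rw [hGk v k hki]
          exact mul_nonneg (hr.nonneg v) (m1 k)
      · simp only [G, Pi.add_apply, Pi.smul_apply, smul_eq_mul, Finset.sum_add_distrib,
          ← Finset.mul_sum, m2]
        simp [he]
      · rcases eq_or_ne k i with rfl | hki
        · exact hi
        · exact Finset.mem_insert_of_mem (hLj k (hs k hk) hki)
      · rcases eq_or_ne k i with rfl | hki
        · exact Or.inr (hs m hm)
        rcases eq_or_ne m i with rfl | hmi
        · exact Or.inl (hs k hk)
        rw [hGk _ _ hki] at hk
        rw [hGk _ _ hmi] at hm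
        exact m4 k m (right_ne_zero_of_mul hk) (right_ne_zero_of_mul hm)
    · rw [hg'L i hi' x hx]
      obtain ⟨m1, m2, m3, m4⟩ := hg.mem i hi' x hx
      exact ⟨m1, m2, fun k hk => Finset.mem_insert_of_mem (m3 k hk), m4⟩
  refine ⟨g', hSA, ?_, hmem, hpos, hsub, ?_, ?_⟩
  · have hcover : (⋃ i ∈ insert j L, C i) ⊆ (⋃ i ∈ L, C i) ∪ closure (C j) := by
      rw [Finset.set_biUnion_insert, union_comm]
      exact union_subset_union_right _ subset_closure
    refine ContinuousOn.mono (ContinuousOn.union_of_isClosed ?_ ?_ (hC.isClosed_iUnion hL)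
      isClosed_closure) hcover
    · refine hg.continuousOn.congr fun x hx => ?_
      obtain ⟨i, hi, hx⟩ := mem_iUnion₂.1 hx
      exact hg'L i hi x hx
    rw [hcl]
    refine h.continuousOn_of_comp (ContinuousOn.congr (f := G) ?_ fun v hv => hg'φ v hv)
    intro v hv
    have hrc := hr.continuous
    refine ContinuousWithinAt.add (by fun_prop) ?_
    rcases eq_or_ne v 0 with rfl | hv0
    · rw [ContinuousWithinAt, hr.map_zero, zero_smul]
      refine tendsto_pi_nhds.2 fun k => ?_
      have h0 : Tendsto r (𝓝[{v | r v ≤ 1}] 0) (𝓝 0) := by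
        have := hrc.tendsto 0
        rw [hr.map_zero] at this
        exact this.mono_left nhdsWithin_le_nhds
      refine squeeze_zero_norm (fun v => ?_) h0
      rw [Pi.smul_apply, smul_eq_mul, norm_mul, Real.norm_of_nonneg (hr.nonneg v)]
      rcases eq_or_ne v 0 with rfl | hv0
      · simp [hr.map_zero]
      obtain ⟨l, hl, hvl, hli⟩ := hbd _ (hr.inv_smul hv0)
      obtain ⟨m1, m2, m3, m4⟩ := hg.mem l hl _ hvl
      refine mul_le_of_le_one_right (hr.nonneg v) ?_
      rw [Real.norm_of_nonneg (m1 k), ← m2]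
      exact Finset.single_le_sum (fun k _ => m1 k) (Finset.mem_univ k)
    · have hrv : r v ≠ 0 := fun h => hv0 (hr.eq_zero v h)
      refine ContinuousWithinAt.smul hrc.continuousWithinAt ?_
      have hU : {v : V | v ≠ 0} ∈ 𝓝 v := isOpen_ne.mem_nhds hv0
      refine ContinuousAt.continuousWithinAt (ContinuousOn.continuousAt ?_ hU)
      have hin : ContinuousOn (fun v => (r v)⁻¹ • v) {v | v ≠ 0} :=
        (hrc.continuousOn.inv₀ fun v (hv : v ≠ 0) h => hv (hr.eq_zero v h)).smul continuousOn_id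
      refine hg.continuousOn.comp (h.continuousOn.comp hin fun v hv => (hr.inv_smul hv).le)
        fun v hv => ?_
      obtain ⟨l, hl, hvl, -⟩ := hbd _ (hr.inv_smul hv)
      exact mem_iUnion₂_of_mem hl hvl
  · intro x hx y hy hxy
    obtain ⟨i, hi, hxi⟩ := mem_iUnion₂.1 hx
    obtain ⟨i', hi', hyi⟩ := mem_iUnion₂.1 hy
    have hii : i = i' := by
      refine hC.antisymm (hsub i' hi' y hyi i ?_) (hsub i hi x hxi i' ?_)
      · rw [← hxy]
        exact (hpos i hi x hxi).ne'
      · rw [hxy]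
        exact (hpos i' hi' y hyi).ne'
    subst hii
    rcases Finset.mem_insert.1 hi with rfl | hiL
    · rw [← hφ] at hxi hyi
      obtain ⟨u, hu : r u < 1, rfl⟩ := hxi
      obtain ⟨v, hv : r v < 1, rfl⟩ := hyi
      rw [hg'φ u hu.le, hg'φ v hv.le] at hxy
      have hruv : r u = r v := by
        have := congrFun hxy i
        rw [hGj, hGj] at this
        linarith
      rcases eq_or_ne u 0 with rfl | hu0
      · rw [hr.map_zero] at hruv
        rw [hr.eq_zero v hruv.symm]
      have hru : r u ≠ 0 := fun h => hu0 (hr.eq_zero u h)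
      have hv0 : v ≠ 0 := by
        rintro rfl
        exact hru (hruv.trans hr.map_zero)
      simp only [G, hruv, add_right_inj] at hxy
      rw [hruv] at hru
      have hxy := smul_right_injective _ hru hxy
      obtain ⟨l, hl, hul, -⟩ := hbd _ (hr.inv_smul hu0)
      obtain ⟨m, hm, hvm, -⟩ := hbd _ (hr.inv_smul hv0)
      rw [hruv] at hul
      have h1 := hg.injOn (mem_iUnion₂_of_mem hl hul) (mem_iUnion₂_of_mem hm hvm) hxy
      have h2 := h.injOn (show r _ ≤ 1 from hruv ▸ (hr.inv_smul hu0).le)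
        (show r _ ≤ 1 from (hr.inv_smul hv0).le) h1
      rw [smul_right_injective V (inv_ne_zero hru) h2]
    · rw [hg'L i hiL x hxi, hg'L i hiL y hyi] at hxy
      exact hg.injOn (mem_iUnion₂_of_mem hiL hxi) (mem_iUnion₂_of_mem hiL hyi) hxy
  · rintro w ⟨w1, w2, w3, w4⟩
    by_cases hw0 : w j = 0
    · obtain ⟨i, hi, x, hx, hxw⟩ := hg.surj w ⟨w1, w2, fun k hk =>
        Finset.mem_of_mem_insert_of_ne (w3 k hk) fun h => hk (h ▸ hw0), w4⟩
      exact ⟨i, Finset.mem_insert_of_mem hi, x, hx, (hg'L i hi x hx).trans hxw⟩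
    have hwj : 0 < w j := lt_of_le_of_ne (w1 j) (Ne.symm hw0)
    have hsum : w j + ∑ k ∈ Finset.univ.erase j, w k = 1 := by
      rw [Finset.add_sum_erase _ _ (Finset.mem_univ j), w2]
    have hsnn : 0 ≤ ∑ k ∈ Finset.univ.erase j, w k := Finset.sum_nonneg fun k _ => w1 k
    refine ⟨j, Finset.mem_insert_self _ _, ?_⟩
    by_cases hw1 : w j = 1
    · refine ⟨φ 0, (hmemj 0 (by simp [hr.map_zero])).2 (by simp [hr.map_zero]), ?_⟩
      rw [hg'φ 0 (by simp [hr.map_zero])]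
      ext k
      rcases eq_or_ne k j with rfl | hk
      · rw [hGj, hr.map_zero, hw1, sub_zero]
      · rw [hGk 0 k hk, hr.map_zero, zero_mul]
        have h0 : ∑ k ∈ Finset.univ.erase j, w k = 0 := by linarith
        exact ((Finset.sum_eq_zero_iff_of_nonneg fun k _ => w1 k).1 h0 k (by simp [hk])).symm
    have hlt : 0 < 1 - w j := lt_of_le_of_ne (by linarith) fun h => hw1 (by linarith)
    let w' : ι → ℝ := fun k => if k = j then 0 else w k / (1 - w j)
    have hw'j : w' j = 0 := if_pos rfl
    have hw'k : ∀ k, k ≠ j → w' k = w k / (1 - w j) := fun k hk => if_neg hk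
    have hne : ∀ k, w' k ≠ 0 → k ≠ j ∧ w k ≠ 0 := by
      intro k hk
      have hkj : k ≠ j := by
        rintro rfl
        exact hk hw'j
      rw [hw'k k hkj] at hk
      exact ⟨hkj, fun h => hk (by rw [h, zero_div])⟩
    have hw' : w' ∈ flagSimplex C L := by
      refine ⟨fun k => ?_, ?_, fun k hk =>
        Finset.mem_of_mem_insert_of_ne (w3 k (hne k hk).2) (hne k hk).1,
        fun k l hk hl => w4 k l (hne k hk).2 (hne l hl).2⟩
      · rcases eq_or_ne k j with rfl | hk
        · exact hw'j.ge
        · rw [hw'k k hk]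
          exact div_nonneg (w1 k) hlt.le
      · rw [← Finset.add_sum_erase _ _ (Finset.mem_univ j), hw'j, zero_add,
          Finset.sum_congr rfl fun k hk => hw'k k (Finset.ne_of_mem_erase hk), ← Finset.sum_div,
          div_eq_one_iff_eq hlt.ne']
        linarith
    obtain ⟨i, hi, x, hx, hxw⟩ := hg.surj w' hw'
    have hwi : w i ≠ 0 := (hne i (hxw ▸ (hg.pos i hi x hx).ne')).2
    have hij : C i ⊆ closure (C j) :=
      (w4 i j hwi hw0).resolve_right fun h => hj (hL i hi j h)
    have hxj := hij hx
    rw [hcl] at hxj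
    obtain ⟨u, hu : r u ≤ 1, rfl⟩ := hxj
    have hu1 : r u = 1 :=
      (lt_or_eq_of_le hu).resolve_left fun h => hLne i hi _ hx ((hmemj u hu).2 h)
    have hrv : r ((1 - w j) • u) = 1 - w j := by rw [hr.smul _ hlt.le, hu1, mul_one]
    have hrv1 : r ((1 - w j) • u) < 1 := by rw [hrv]; linarith
    refine ⟨φ ((1 - w j) • u), (hmemj _ hrv1.le).2 hrv1, ?_⟩
    rw [hg'φ _ hrv1.le]
    ext k
    rcases eq_or_ne k j with rfl | hk
    · rw [hGj, hrv, sub_sub_cancel]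
    · rw [hGk _ k hk, hrv, smul_smul, inv_mul_cancel₀ hlt.ne', one_smul, hxw, hw'k k hk]
      field_simp

theorem exists_isBarycentric (L : Finset ι)
    (hL : ∀ j ∈ L, ∀ i, C i ⊆ closure (C j) → i ∈ L) : ∃ g, IsBarycentric C L g := by
  induction L using Finset.strongInduction with
  | H L ih =>
  rcases L.eq_empty_or_nonempty with rfl | hne
  · refine ⟨fun _ => 0, .const _, by simp, by simp, by simp, by simp, by simp, ?_⟩
    rintro w ⟨-, w2, w3, -⟩
    have : w = 0 := by
      ext k
      by_contra hk
      simpa using w3 k hk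
    simp [this] at w2
  obtain ⟨j, hj, hmax⟩ := L.exists_maximalFor (fun i => closure (C i)) hne
  have hmax' : ∀ k ∈ L, C j ⊆ closure (C k) → k = j := fun k hk hjk =>
    hC.antisymm (subset_closure.trans (hmax hk (closure_minimal hjk isClosed_closure))) hjk
  have hlow : ∀ k ∈ L.erase j, ∀ i, C i ⊆ closure (C k) → i ∈ L.erase j := by
    intro k hk i hik
    have hkL := Finset.mem_of_mem_erase hk
    refine Finset.mem_erase.2 ⟨?_, hL k hkL i hik⟩
    rintro rfl
    exact Finset.ne_of_mem_erase hk (hmax' k hkL hik)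
  obtain ⟨g, hg⟩ := ih _ (Finset.erase_ssubset hj) hlow
  have := hC.exists_isBarycentric_insert (Finset.notMem_erase j L) hlow
    (fun i hi hij => Finset.mem_erase.2 ⟨hij, hL j hj i hi⟩) hg
  rwa [Finset.insert_erase hj] at this

end IsCellFamily

end Barycentric

section StandardFaces

variable {ι : Type} [Fintype ι] [DecidableEq ι]

/-- The standard basis vectors as an embedding. -/
def basisVec (ι : Type) [DecidableEq ι] : ι ↪ (ι → ℝ) where
  toFun i := Pi.single i 1
  inj' i j h := by
    by_contra hij
    simpa [hij] using congrFun h i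

omit [Fintype ι] in
theorem basisVec_apply (i k : ι) : basisVec ι i k = if k = i then 1 else 0 :=
  Pi.single_apply i 1 k

theorem convexHull_map_basisVec (t : Finset ι) :
    convexHull ℝ (↑(t.map (basisVec ι)) : Set (ι → ℝ)) =
      {w | (∀ k, 0 ≤ w k) ∧ ∑ k, w k = 1 ∧ ∀ k, w k ≠ 0 → k ∈ t} := by
  refine Subset.antisymm (convexHull_min ?_ ?_) ?_
  · intro w hw
    obtain ⟨i, hi, rfl⟩ := Finset.mem_map.1 (Finset.mem_coe.1 hw)
    refine ⟨fun k => ?_, by simp [basisVec_apply], fun k hk => ?_⟩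
    · rw [basisVec_apply]
      split_ifs <;> norm_num
    · rw [basisVec_apply] at hk
      rwa [of_not_not fun h => hk (if_neg h)]
  · rintro v ⟨v1, v2, v3⟩ w ⟨w1, w2, w3⟩ a b ha hb hab
    refine ⟨fun k => add_nonneg (mul_nonneg ha (v1 k)) (mul_nonneg hb (w1 k)), ?_, fun k hk => ?_⟩
    · simp [Finset.sum_add_distrib, ← Finset.mul_sum, v2, w2, hab]
    · by_contra hkt
      refine hk ?_
      have hv : v k = 0 := by_contra fun h => hkt (v3 k h)
      have hw : w k = 0 := by_contra fun h => hkt (w3 k h)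
      simp [hv, hw]
  · rintro w ⟨w1, w2, w3⟩
    have hw0 : ∀ k, k ∉ t → w k = 0 := fun k hk => by_contra fun h => hk (w3 k h)
    have hw : w = ∑ i ∈ t, w i • basisVec ι i := by
      ext k
      simp only [Finset.sum_apply, Pi.smul_apply, basisVec_apply, smul_eq_mul, mul_ite, mul_one,
        mul_zero, Finset.sum_ite_eq]
      split_ifs with hk
      · rfl
      · exact hw0 k hk
    rw [hw]
    refine (convex_convexHull ℝ _).sum_mem (fun i _ => w1 i) ?_ fun i hi =>
      subset_convexHull ℝ _ (Finset.mem_coe.2 (Finset.mem_map_of_mem _ hi))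
    rw [← w2]
    exact Finset.sum_subset (Finset.subset_univ t) fun k _ hk => hw0 k hk

theorem SA.convexHull_map_basisVec (t : Finset ι) :
    SA (convexHull ℝ (↑(t.map (basisVec ι)) : Set (ι → ℝ))) := by
  rw [_root_.convexHull_map_basisVec]
  refine SA.and (SA.forall_finite fun k => SA.le (.const _) (.apply k))
    (SA.and (SA.eq ?_ (.const _)) (SA.forall_finite fun k => SA.imp (SA.not
      (SA.eq (.apply k) (.const _))) (SA.const _)))
  simpa using SAfun.linear (∑ k, LinearMap.proj k : (ι → ℝ) →ₗ[ℝ] ℝ)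

omit [Fintype ι] in
theorem affineIndependent_basisVec : AffineIndependent ℝ (basisVec ι) := by
  rw [affineIndependent_iff]
  intro s w _ hw i hi
  have := congrFun hw i
  simpa [Finset.sum_apply, basisVec_apply, hi] using this

/-- The simplicial complex with vertices the standard basis vectors and simplices the members of
a lower set of finite sets. -/
noncomputable def standardComplex (𝒯 : Set (Finset ι)) (h𝒯 : IsLowerSet 𝒯) :
    Geometry.SimplicialComplex ℝ (ι → ℝ) :=
  .ofErase ((fun t => t.map (basisVec ι)) '' 𝒯)
    (by
      rintro _ ⟨t, -, rfl⟩
      refine affineIndependent_basisVec.range.mono ?_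
      rw [Finset.coe_map]
      exact image_subset_range _ _)
    (by
      rintro _ s hs ⟨t, ht, rfl⟩
      obtain ⟨u, hu, rfl⟩ := Finset.subset_map_iff.1 hs
      exact ⟨u, h𝒯 hu ht, rfl⟩)
    (by
      rintro _ ⟨t, -, rfl⟩ _ ⟨u, -, rfl⟩ w ⟨hwt, hwu⟩
      rw [← Finset.coe_inter, ← Finset.map_inter]
      rw [convexHull_map_basisVec] at *
      exact ⟨hwt.1, hwt.2.1, fun k hk => Finset.mem_inter.2 ⟨hwt.2.2 k hk, hwu.2.2 k hk⟩⟩)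

theorem standardComplex_faces (𝒯 : Set (Finset ι)) (h𝒯 : IsLowerSet 𝒯) :
    (standardComplex 𝒯 h𝒯).faces = (fun t => t.map (basisVec ι)) '' 𝒯 \ {∅} := rfl

theorem mem_space_standardComplex {𝒯 : Set (Finset ι)} {h𝒯 : IsLowerSet 𝒯} {w : ι → ℝ} :
    w ∈ (standardComplex 𝒯 h𝒯).space ↔
      (∀ k, 0 ≤ w k) ∧ ∑ k, w k = 1 ∧ (Finset.univ.filter fun k => w k ≠ 0) ∈ 𝒯 := by
  rw [Geometry.SimplicialComplex.mem_space_iff, standardComplex_faces]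
  constructor
  · rintro ⟨_, ⟨⟨t, ht, rfl⟩, -⟩, hw⟩
    rw [convexHull_map_basisVec] at hw
    refine ⟨hw.1, hw.2.1, h𝒯 (fun k hk => ?_) ht⟩
    exact hw.2.2 k (Finset.mem_filter.1 hk).2
  · rintro ⟨w1, w2, w3⟩
    refine ⟨_, ⟨⟨_, w3, rfl⟩, ?_⟩, ?_⟩
    · intro h0
      rw [mem_singleton_iff, Finset.map_eq_empty, Finset.filter_eq_empty_iff] at h0
      have : ∀ k, w k = 0 := fun k => of_not_not (h0 (Finset.mem_univ k))
      simp [this] at w2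
    · rw [convexHull_map_basisVec]
      exact ⟨w1, w2, fun k hk => Finset.mem_filter.2 ⟨Finset.mem_univ k, hk⟩⟩

theorem SA.openSimplex_map_basisVec {N : ℕ} (t : Finset (Fin N)) :
    SA (openSimplex (t.map (basisVec (Fin N)))) := by
  refine SA.and (SA.convexHull_map_basisVec t) (SA.not ?_)
  have hfin : {u : Finset (Fin N → ℝ) | u ⊂ t.map (basisVec (Fin N))}.Finite := by
    classical
    refine (t.map (basisVec (Fin N))).powerset.finite_toSet.subset fun u hu => ?_
    exact Finset.mem_coe.2 (Finset.mem_powerset.2 hu.1)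
  have : (⋃ (u : Finset (Fin N → ℝ)) (_ : u ⊂ t.map (basisVec (Fin N))),
      convexHull ℝ (u : Set (Fin N → ℝ))) =
      {x | ∃ u ∈ {u : Finset (Fin N → ℝ) | u ⊂ t.map (basisVec (Fin N))},
        x ∈ convexHull ℝ (u : Set (Fin N → ℝ))} := by
    ext x
    simp
  change SA (⋃ (u : Finset (Fin N → ℝ)) (_ : u ⊂ t.map (basisVec (Fin N))), _)
  rw [this]
  refine SA.exists_mem hfin fun u hu => ?_
  obtain ⟨v, -, rfl⟩ := Finset.subset_map_iff.1 hu.1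
  exact SA.convexHull_map_basisVec v

end StandardFaces

section Assembly

theorem IsCellComplex.exists_isCellFamily {E : Type} [NormedAddCommGroup E] [NormedSpace ℝ E]
    {𝒞 : Set (Set E)} (h : IsCellComplex 𝒞) {S : Set E} (hS : IsClosed S) (hcov : S ⊆ ⋃₀ 𝒞)
    (hcompat : ∀ C ∈ 𝒞, ∀ x ∈ C, ∀ y ∈ C, x ∈ S → y ∈ S) :
    ∃ (N : ℕ) (C : Fin N → Set E), IsCellFamily C ∧ ⋃ i, C i = S := by
  have hfin : Finite {C ∈ 𝒞 | C ⊆ S} := h.finite.subset fun C hC => hC.1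
  obtain ⟨N, ⟨e⟩⟩ := Finite.exists_equiv_fin {C ∈ 𝒞 | C ⊆ S}
  have hsurj : ∀ C ∈ 𝒞, C ⊆ S → ∃ i, (e.symm i).1 = C := fun C hC hCS =>
    ⟨e ⟨C, hC, hCS⟩, by rw [e.symm_apply_apply]⟩
  refine ⟨N, fun i => (e.symm i).1, ⟨fun i => h.isCell _ (e.symm i).2.1, fun i j x hi hj => ?_,
    fun j x hx => ?_⟩, ?_⟩
  · exact e.symm.injective
      (Subtype.ext (h.eq_of_mem _ (e.symm i).2.1 _ (e.symm j).2.1 x hi hj))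
  · obtain ⟨C, hC, hxC, hCj⟩ := h.frontier _ (e.symm j).2.1 x hx
    obtain ⟨i, rfl⟩ := hsurj C hC (hCj.trans (closure_minimal (e.symm j).2.2 hS))
    exact ⟨i, hxC, hCj⟩
  · refine Subset.antisymm (iUnion_subset fun i => (e.symm i).2.2) fun x hx => ?_
    obtain ⟨C, hC, hxC⟩ := hcov hx
    obtain ⟨i, rfl⟩ := hsurj C hC fun y hy => hcompat C hC x hxC y hy hx
    exact mem_iUnion.2 ⟨i, hxC⟩

end Assembly

end

/-- Every compact semialgebraic set `S ⊆ ℝⁿ` can be triangulated by semialgebraic simplices: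
there are a finite simplicial complex `K` in some `ℝ^N` and a homeomorphism `h : |K| ≃ S`
which is a semialgebraic map and maps each open simplex of `K` onto a semialgebraic subset
of `ℝⁿ`. -/
theorem compact_semialgebraic_triangulation (n : ℕ) (S : Set (Fin n → ℝ))
    (hS : IsSemialgebraic n S) (hcpt : IsCompact S) :
    ∃ (N : ℕ) (K : Geometry.SimplicialComplex ℝ (Fin N → ℝ)) (_ : K.faces.Finite)
      (h : K.space ≃ₜ S),
      IsSemialgebraicMap K.space S h ∧
      ∀ s ∈ K.faces,
        IsSemialgebraic n (Subtype.val '' (h '' {z : K.space | (z : Fin N → ℝ) ∈ openSimplex s})) := by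
  classical
  rw [isSemialgebraic_iff] at hS
  obtain ⟨𝒞, h𝒞, hcov, hcompat⟩ := exists_isCellComplex _ (Fin n → ℝ) rfl {S}
    (Set.finite_singleton S)
    (by simpa using hS) S hcpt.isBounded
  obtain ⟨N, C, hC, hCS⟩ := h𝒞.exists_isCellFamily hcpt.isClosed hcov
    fun C hC x hx y hy => hcompat C hC S rfl x hx y hy
  obtain ⟨g, hg⟩ := hC.exists_isBarycentric Finset.univ fun _ _ i _ => Finset.mem_univ i
  have hcont : ContinuousOn g S := by simpa [hCS] using hg.continuousOn
  have hinj : Set.InjOn g S := by simpa [hCS] using hg.injOn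
  let K := standardComplex {t : Finset (Fin N) | ∀ i ∈ t, ∀ j ∈ t,
    C i ⊆ closure (C j) ∨ C j ⊆ closure (C i)} fun t u hut ht i hi j hj => ht i (hut hi) j (hut hj)
  have hK : K.space = flagSimplex C Finset.univ := by
    ext w
    refine mem_space_standardComplex.trans ?_
    simp only [flagSimplex, Set.mem_ofPred_eq, Finset.mem_filter, Finset.mem_univ, true_and,
      implies_true]
    exact ⟨fun h => ⟨h.1, h.2.1, fun i j hi hj => h.2.2 i hi j hj⟩,
      fun h => ⟨h.1, h.2.1, fun i hi j hj => h.2.2 i j hi hj⟩⟩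
  have hbij : Set.BijOn g S K.space := by
    rw [hK]
    refine ⟨fun x hx => ?_, hinj, fun w hw => ?_⟩
    · rw [← hCS] at hx
      obtain ⟨i, hx⟩ := Set.mem_iUnion.1 hx
      exact hg.mem i (Finset.mem_univ i) x hx
    · obtain ⟨i, -, x, hx, hxw⟩ := hg.surj w hw
      exact ⟨x, hCS ▸ Set.mem_iUnion.2 ⟨i, hx⟩, hxw⟩
  have : CompactSpace S := isCompact_iff_compactSpace.1 hcpt
  let f : S ≃ K.space := hbij.equiv g
  have hf : Continuous f := (hcont.mapsToRestrict hbij.mapsTo)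
  let h : K.space ≃ₜ S := hf.homeoOfEquivCompactToT2.symm
  have hh : ∀ (w : K.space) (x : S), h w = x ↔ w.1 = g x.1 := by
    intro w x
    have h1 : h w = x ↔ w = f x := f.symm_apply_eq
    rw [h1, Subtype.ext_iff]
    rfl
  refine ⟨N, K, ?_, h, ⟨h.continuous, ?_⟩, ?_⟩
  · exact ((Set.toFinite _).image _).subset Set.sdiff_subset
  · rw [isSemialgebraic_iff]
    have hgraph : {z : Fin (N + n) → ℝ | ∃ w : K.space, z = Fin.append w.1 (h w).1} =
        {z : Fin (N + n) → ℝ | (fun i => z (Fin.natAdd N i)) ∈ S ∧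
          (fun i => z (Fin.castAdd n i)) = g fun i => z (Fin.natAdd N i)} := by
      ext z
      constructor
      · rintro ⟨w, rfl⟩
        simp only [Set.mem_ofPred_eq, Fin.append_left, Fin.append_right]
        exact ⟨(h w).2, (hh w (h w)).1 rfl⟩
      · rintro ⟨h1, h2⟩
        refine ⟨⟨fun i => z (Fin.castAdd n i), h2 ▸ hbij.mapsTo h1⟩, ?_⟩
        rw [(hh _ ⟨_, h1⟩).2 h2]
        exact (Fin.append_castAdd_natAdd).symm
    rw [hgraph]
    have h1 : SAfun fun (z : Fin (N + n) → ℝ) i => z (Fin.natAdd N i) := .pi fun i => .apply _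
    have h2 : SAfun fun (z : Fin (N + n) → ℝ) i => z (Fin.castAdd n i) := .pi fun i => .apply _
    exact SA.and (hS.preimage h1) (SA.eq h2 (hg.saFun.comp h1))
  · rintro _ ⟨⟨t, -, rfl⟩, -⟩
    rw [isSemialgebraic_iff]
    have himage : Subtype.val '' (h '' {z : K.space |
        (z : Fin N → ℝ) ∈ openSimplex (t.map (basisVec (Fin N)))}) =
        {x | x ∈ S ∧ g x ∈ openSimplex (t.map (basisVec (Fin N)))} := by
      ext x
      constructor
      · rintro ⟨_, ⟨w, hw, rfl⟩, rfl⟩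
        exact ⟨(h w).2, (hh w _).1 rfl ▸ hw⟩
      · rintro ⟨hx, hgx⟩
        exact ⟨⟨x, hx⟩, ⟨⟨g x, hbij.mapsTo hx⟩, hgx, (hh _ _).2 rfl⟩, rfl⟩
    rw [himage]
    exact SA.and hS ((SA.openSimplex_map_basisVec t).preimage hg.saFun)
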